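/- Let p be an odd prime and d a divisor of p−1. Define R ⊆ Z_{p²} by R = { n : 0 ≤ n ≤ p²−1, there exists y with 1 ≤ y ≤ p−1 and q_p(n) ≡ y^d (mod p) }, where q_p is the Fermat quotient modulo p. Then |R| = (p−1)²/d exactly, and there is an absolute constant c > 0 such that for every positive integer k, C_k(R, p²) ≤ c·k·p^{5/3}. -/

import Mathlib

open Finset Filter

/-- The function `f_R` from the paper: `1 - |R|/q` on `R`, `-|R|/q` off `R`. -/
noncomputable def fsub (q : ℕ) (R : Finset ℕ) (n : ℕ) : ℝ :=
  if n % q ∈ R then 1 - (R.card : ℝ) / q else -((R.card : ℝ) / q)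

/-- The correlation measure `C_k(R,q)` of order `k` of a subset `R ⊆ Z_q`. -/
noncomputable def corrK (R : Finset ℕ) (q k : ℕ) : ℝ :=
  sSup {x : ℝ | ∃ (M : ℕ) (d : Fin k → ℕ), 1 ≤ M ∧ M ≤ q ∧ StrictMono d ∧
    (∀ i, d i ≤ q - 1) ∧ x = |∑ n ∈ Finset.range M, ∏ i, fsub q R (n + d i)|}

/-- `C(R,q,s) = max_{1 ≤ k ≤ s} C_k(R,q)`. -/
noncomputable def corrMeasure (R : Finset ℕ) (q s : ℕ) : ℝ :=
  sSup {x : ℝ | ∃ k, 1 ≤ k ∧ k ≤ s ∧ x = corrK R q k}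

-- The Fermat quotient `q_p(n)` viewed in `ZMod p`: for `gcd(n,p) = 1` it is
-- `(n^(p-1) - 1)/p mod p` (the division is exact by Fermat's little theorem),
-- and it is `0` when `p ∣ n`.
noncomputable def fermatQuotient (p n : ℕ) : ZMod p :=
  if p ∣ n then 0 else (((n ^ (p - 1) - 1) / p : ℕ) : ZMod p)

-- The subset of `Z_{p²}` of all `n` whose Fermat quotient is a nonzero `d`-th
-- power residue modulo `p`.
open scoped Classical in
noncomputable def fermatQuotientSet (p d : ℕ) : Finset ℕ :=
  (Finset.range (p ^ 2)).filter (fun n => ∃ y : ℕ, 1 ≤ y ∧ y ≤ p - 1 ∧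
    fermatQuotient p n = (y : ZMod p) ^ d)

namespace FermatCorr

open Polynomial

section CoeffDegree

variable {K : Type*} [Field K]

/-- All coefficients (polynomials in the inner variable) have degree at most `N`. -/
def InnerDegLE (N : ℕ) (B : K[X][X]) : Prop := ∀ e, (B.coeff e).natDegree ≤ N

lemma InnerDegLE.mono {N N' : ℕ} {B : K[X][X]} (h : InnerDegLE N B) (hN : N ≤ N') :
    InnerDegLE N' B := fun e => (h e).trans hN

lemma InnerDegLE.zero {N : ℕ} : InnerDegLE N (0 : K[X][X]) := fun e => by simp

lemma InnerDegLE.add {N : ℕ} {A B : K[X][X]} (hA : InnerDegLE N A) (hB : InnerDegLE N B) :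
    InnerDegLE N (A + B) := fun e => by
  rw [coeff_add]; exact natDegree_add_le_of_degree_le (hA e) (hB e)

lemma InnerDegLE.neg {N : ℕ} {A : K[X][X]} (hA : InnerDegLE N A) :
    InnerDegLE N (-A) := fun e => by
  rw [coeff_neg, natDegree_neg]; exact hA e

lemma InnerDegLE.sub {N : ℕ} {A B : K[X][X]} (hA : InnerDegLE N A) (hB : InnerDegLE N B) :
    InnerDegLE N (A - B) := by
  rw [sub_eq_add_neg]; exact hA.add hB.neg

lemma InnerDegLE.sum {ι : Type*} {s : Finset ι} {N : ℕ} {A : ι → K[X][X]}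
    (hA : ∀ i ∈ s, InnerDegLE N (A i)) : InnerDegLE N (∑ i ∈ s, A i) := fun e => by
  rw [finsetSum_coeff]
  exact natDegree_sum_le_of_forall_le _ _ fun i hi => hA i hi e

lemma InnerDegLE.mul {M N : ℕ} {A B : K[X][X]} (hA : InnerDegLE M A) (hB : InnerDegLE N B) :
    InnerDegLE (M + N) (A * B) := fun e => by
  rw [coeff_mul]
  exact natDegree_sum_le_of_forall_le _ _ fun i _ => natDegree_mul_le_of_le (hA _) (hB _)

lemma InnerDegLE.C {N : ℕ} {f : K[X]} (hf : f.natDegree ≤ N) : InnerDegLE N (C f) := fun e => by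
  rw [coeff_C]; split_ifs <;> simp [hf]

lemma InnerDegLE.one : InnerDegLE 0 (1 : K[X][X]) := InnerDegLE.C (by simp)

lemma InnerDegLE.X_pow (n : ℕ) : InnerDegLE 0 ((X : K[X][X]) ^ n) := fun e => by
  rw [coeff_X_pow]; split_ifs <;> simp

lemma InnerDegLE.X : InnerDegLE 0 (X : K[X][X]) := by
  simpa using InnerDegLE.X_pow (K := K) 1

lemma InnerDegLE.pow {N : ℕ} {A : K[X][X]} (hA : InnerDegLE N A) (n : ℕ) :
    InnerDegLE (n * N) (A ^ n) := by
  induction n with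
  | zero => simpa using InnerDegLE.one
  | succ n ih => rw [pow_succ]; exact (ih.mul hA).mono (by rw [Nat.succ_mul])

lemma InnerDegLE.prod {ι : Type*} {s : Finset ι} {N : ι → ℕ} {A : ι → K[X][X]}
    (hA : ∀ i ∈ s, InnerDegLE (N i) (A i)) : InnerDegLE (∑ i ∈ s, N i) (∏ i ∈ s, A i) := by
  classical
  induction s using Finset.induction_on with
  | empty => simpa using InnerDegLE.one
  | insert a s ha ih =>
    rw [Finset.prod_insert ha, Finset.sum_insert ha]
    exact (hA a (by simp)).mul (ih fun i hi => hA i (by simp [hi]))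

lemma InnerDegLE.det {n N : ℕ} {A : Matrix (Fin n) (Fin n) K[X][X]}
    (hA : ∀ i j, InnerDegLE N (A i j)) : InnerDegLE (n * N) A.det := by
  rw [Matrix.det_apply]
  refine InnerDegLE.sum fun σ _ => ?_
  have h : InnerDegLE (n * N) (∏ i, A (σ i) i) :=
    (InnerDegLE.prod (N := fun _ => N) fun i _ => hA (σ i) i).mono (by simp)
  rcases Int.units_eq_one_or (Equiv.Perm.sign σ) with h1 | h1 <;> rw [h1]
  · simpa using h
  · simpa using h.neg

lemma InnerDegLE.resultant {f g : K[X][X][X]} {m n N : ℕ}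
    (hf : ∀ i, InnerDegLE N (f.coeff i)) (hg : ∀ i, InnerDegLE N (g.coeff i)) :
    InnerDegLE ((m + n) * N) (f.resultant g m n) := by
  refine InnerDegLE.det fun i j => ?_
  rw [sylvester, Matrix.of_apply]
  refine Fin.addCases (fun j₁ => ?_) (fun j₁ => ?_) j
  · rw [Fin.addCases_left]; split_ifs
    exacts [hg _, InnerDegLE.zero]
  · rw [Fin.addCases_right]; split_ifs
    exacts [hf _, InnerDegLE.zero]

/-- A polynomial with coefficients of degree `< deg T` that vanishes at `T` is zero. -/
lemma eq_zero_of_eval_eq_zero_of_innerDegLE {N : ℕ} {T : K[X]} (hN : N < T.natDegree)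
    (n : ℕ) : ∀ B : K[X][X], B.natDegree < n → InnerDegLE N B → B.eval T = 0 → B = 0 := by
  have hT : T ≠ 0 := by rintro rfl; simp at hN
  induction n with
  | zero => intro B hB; omega
  | succ n ih =>
    intro B hB hD h0
    have hdec := B.divX_mul_X_add
    have hc : B.coeff 0 = 0 := by
      have hdvd : T ∣ B.coeff 0 := by
        rw [← hdec] at h0
        simp only [eval_add, eval_mul, eval_X, eval_C] at h0
        exact ⟨-B.divX.eval T, by linear_combination h0⟩
      by_contra hne
      have := natDegree_le_of_dvd hdvd hne
      have := hD 0
      omega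
    rw [hc, C_0, add_zero] at hdec
    have hd : B.divX = 0 := by
      by_cases hB0 : B.natDegree = 0
      · rw [divX_eq_zero_iff, eq_C_of_natDegree_eq_zero hB0]; simp
      refine ih _ ?_ ?_ ?_
      · rw [natDegree_divX_eq_natDegree_tsub_one]; omega
      · intro e; rw [coeff_divX]; exact hD _
      · rw [← hdec] at h0
        simpa [hT] using h0
    rw [← hdec, hd, zero_mul]

end CoeffDegree

section Kummer

lemma irreducible_X_pow_sub_C_of_forall_dvd {F : Type*} [Field F] {d : ℕ} (hd : 0 < d) {a : F}
    (h : ∀ (m : ℕ) (b : F), b ^ d = a ^ m → d ∣ m) : Irreducible (X ^ d - C a : F[X]) := by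
  have hmon : (X ^ d - C a : F[X]).Monic := monic_X_pow_sub_C a hd.ne'
  rw [hmon.irreducible_iff_natDegree]
  refine ⟨fun h1 => ?_, fun f g hf hg hfg => ?_⟩
  · have := congrArg natDegree h1
    rw [natDegree_X_pow_sub_C, natDegree_one] at this; omega
  have hdeg : f.natDegree + g.natDegree = d := by
    rw [← hf.natDegree_mul hg, hfg, natDegree_X_pow_sub_C]
  have key : ((-1) ^ f.natDegree * f.coeff 0) ^ d = a ^ f.natDegree := by
    let A := AlgebraicClosure F
    apply (algebraMap F A).injective
    have hs : (f.map (algebraMap F A)).Splits := IsAlgClosed.splits _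
    have hc := hs.coeff_zero_eq_prod_roots_of_monic (hf.map _)
    rw [coeff_map, natDegree_map] at hc
    have hcard : (f.map (algebraMap F A)).roots.card = f.natDegree := by
      rw [splits_iff_card_roots.1 hs, natDegree_map]
    rw [map_pow, map_mul, hc, map_pow, map_neg, map_one, ← mul_assoc, ← mul_pow]
    rw [neg_mul_neg, one_mul, one_pow, one_mul, ← Multiset.map_id' (f.map _).roots,
      ← Multiset.prod_map_pow]
    have : ∀ x ∈ (f.map (algebraMap F A)).roots, x ^ d = algebraMap F A a := by
      intro x hx
      have hx0 : (f.map (algebraMap F A)).eval x = 0 := (mem_roots'.1 hx).2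
      have := congrArg (fun q => (q.map (algebraMap F A)).eval x) hfg
      simp only [Polynomial.map_mul, eval_mul, hx0, zero_mul] at this
      simp at this
      linear_combination -this
    rw [Multiset.map_congr rfl this, Multiset.map_const', Multiset.prod_replicate, hcard, map_pow]
  have := h _ _ key
  rcases Nat.eq_zero_or_pos f.natDegree with h0 | h0
  · exact Or.inl h0
  · have := Nat.le_of_dvd h0 this
    right; omega

lemma dvd_of_pow_eq_mul_pow {R : Type*} [CommRing R] [IsDomain R] [WfDvdMonoid R] {ι : Type*}
    [DecidableEq ι]
    {U : Finset ι} {π : ι → R} (hπ : ∀ u ∈ U, Prime (π u))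
    (hne : ∀ u ∈ U, ∀ v ∈ U, u ≠ v → ¬ π u ∣ π v) {e : ι → ℕ} {c : R}
    (hc : ∀ u ∈ U, ¬ π u ∣ c) {d m : ℕ} (hcop : ∀ s, (∀ u ∈ U, d ∣ s * e u) → d ∣ s)
    {r s : R} (hs : s ≠ 0) (h : r ^ d = ((∏ u ∈ U, π u ^ e u) * c) ^ m * s ^ d) : d ∣ m := by
  refine hcop m fun u hu => ?_
  have hu' := hπ u hu
  have hfin : FiniteMultiplicity (π u) s :=
    FiniteMultiplicity.of_not_isUnit hu'.not_isUnit hs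
  have hemu : emultiplicity (π u) ((∏ v ∈ U, π v ^ e v) * c) = e u := by
    rw [emultiplicity_mul hu', emultiplicity_eq_zero.2 (hc u hu), add_zero,
      Finset.emultiplicity_prod hu', Finset.sum_eq_single_of_mem u hu]
    · rw [emultiplicity_pow hu', FiniteMultiplicity.emultiplicity_self
        (FiniteMultiplicity.of_not_isUnit hu'.not_isUnit hu'.ne_zero), mul_one]
    · intro v hv hvu
      rw [emultiplicity_pow hu', emultiplicity_eq_zero.2 (hne u hu v hv hvu.symm), mul_zero]
  have h2 := congrArg (emultiplicity (π u)) h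
  rw [emultiplicity_mul hu', emultiplicity_pow hu', emultiplicity_pow hu', emultiplicity_pow hu',
    hemu, hfin.emultiplicity_eq_multiplicity] at h2
  rcases Nat.eq_zero_or_pos d with rfl | hd
  · simp only [Nat.cast_zero, zero_mul, add_zero] at h2
    have h2 : 0 = m * e u := by exact_mod_cast h2
    rw [← h2]
  have hr : r ≠ 0 := by
    rintro rfl
    rw [zero_pow hd.ne', eq_comm, mul_eq_zero] at h
    rcases h with h | h
    · have h0 := of_not_not fun hne => pow_ne_zero m hne h
      rw [h0] at hemu
      simp at hemu
    · exact hs (pow_eq_zero_iff hd.ne' |>.1 h)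
  have hfr : FiniteMultiplicity (π u) r := FiniteMultiplicity.of_not_isUnit hu'.not_isUnit hr
  rw [hfr.emultiplicity_eq_multiplicity] at h2
  have h3 : d * multiplicity (π u) r = m * e u + d * multiplicity (π u) s := by exact_mod_cast h2
  exact (Nat.dvd_add_left (Dvd.intro _ rfl)).1 (h3 ▸ Dvd.intro _ rfl)

end Kummer

section Independence

variable {K : Type*} [Field K]

/-- `Z ^ p - Z + X - v` as a polynomial in the outer variable `Z` over `K[X]`. -/
noncomputable def artinSchreierFactor (p : ℕ) (v : K) : K[X][X] := X ^ p - X + C (X - C v)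

lemma prime_artinSchreierFactor (p : ℕ) (v : K) : Prime (artinSchreierFactor p v) := by
  rw [← MulEquiv.prime_iff (Bivariate.swap (R := K)).toMulEquiv]
  have : (Bivariate.swap (R := K)).toMulEquiv (artinSchreierFactor p v)
      = X - C (X - X ^ p + C v) := by
    simp [artinSchreierFactor, Bivariate.swap_Y, Bivariate.swap_C]
    ring
  rw [this]
  exact prime_X_sub_C _

lemma natDegree_artinSchreierFactor {p : ℕ} (hp : 1 < p) (v : K) :
    (artinSchreierFactor p v).natDegree = p := by
  rw [artinSchreierFactor, natDegree_add_C, natDegree_sub_eq_left_of_natDegree_lt] <;> simp [hp]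

lemma not_artinSchreierFactor_dvd_C {p : ℕ} (hp : 1 < p) (v : K) {g : K[X]} (hg : g ≠ 0) :
    ¬ artinSchreierFactor p v ∣ C g := fun h => by
  have := natDegree_le_of_dvd h (C_ne_zero.2 hg)
  rw [natDegree_artinSchreierFactor hp, natDegree_C] at this
  omega

lemma not_artinSchreierFactor_dvd {p : ℕ} (hp : 1 < p) {v w : K} (hvw : v ≠ w) :
    ¬ artinSchreierFactor p v ∣ artinSchreierFactor p w := fun h => by
  refine not_artinSchreierFactor_dvd_C hp v (g := C (v - w)) (C_ne_zero.2 (sub_ne_zero.2 hvw)) ?_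
  have := dvd_sub h (dvd_refl (artinSchreierFactor p v))
  convert this using 1
  simp [artinSchreierFactor]

lemma InnerDegLE.artinSchreierFactor (p : ℕ) (v : K) : InnerDegLE 1 (artinSchreierFactor p v) :=
  (((InnerDegLE.X_pow p).sub InnerDegLE.X).mono zero_le_one).add
    (InnerDegLE.C (natDegree_X_sub_C_le v))

/-- Powers of `f ^ N₀` are independent over polynomials in `X` and `T` of low degree in `X`. -/
theorem eq_zero_of_sum_eval_mul_pow_eq_zero {p Q d N₀ D E : ℕ} (hp : 1 < p) (hd : 0 < d)
    {T f : K[X]} (hT : T ^ p - T = X ^ Q - X) {U : Finset K} {e : K → ℕ}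
    (hf : f = ∏ v ∈ U, (X - C v) ^ e v) (hE : f.natDegree ≤ E)
    (hfQ : f.comp (X ^ Q) = f ^ Q) (hN₀ : d * N₀ + 1 = Q)
    (hcop : ∀ s, (∀ v ∈ U, d ∣ s * e v) → d ∣ s)
    (hdeg : 2 * d * (D + d * E) < T.natDegree)
    {h : ℕ → K[X][X]} (hD : ∀ i, InnerDegLE D (h i))
    (h0 : ∑ i ∈ range d, (h i).eval T * f ^ (i * N₀) = 0) : ∀ i < d, h i = 0 := by
  classical
  have hf0 : f ≠ 0 := by
    rw [hf]; exact prod_ne_zero_iff.2 fun v _ => pow_ne_zero _ (X_sub_C_ne_zero v)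
  have hE' : ∑ v ∈ U, e v ≤ E := by
    refine le_trans (le_of_eq ?_) hE
    rw [hf, natDegree_prod_of_monic _ _ fun v _ => (monic_X_sub_C v).pow _]
    exact Finset.sum_congr rfl fun v _ => by rw [(monic_X_sub_C v).natDegree_pow]; simp
  set a : K[X][X] := (∏ v ∈ U, artinSchreierFactor p v ^ e v) * C (f ^ (d - 1)) with ha
  set μ : K[X][X][X] := X ^ d - C a with hμ
  set β : K[X][X][X] := ∑ i ∈ range d, C (h i * C (f ^ (d - 1 - i))) * X ^ i with hβ
  have hβc : ∀ i < d, β.coeff i = h i * C (f ^ (d - 1 - i)) := fun i hi => by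
    rw [hβ, finsetSum_coeff]
    simp only [coeff_C_mul_X_pow]
    rw [Finset.sum_ite_eq, if_pos (mem_range.2 hi)]
  have hβd : β.degree < d := by
    rw [hβ]
    exact degree_sum_fin_lt (fun i : Fin d => _) |>.trans_eq' (by rw [Fin.sum_univ_eq_sum_range
      (fun i => C (h i * C (f ^ (d - 1 - i))) * (X : K[X][X][X]) ^ i)])
  suffices hβ0 : β = 0 by
    intro i hi
    have := hβc i hi
    rw [hβ0, coeff_zero, eq_comm, mul_eq_zero] at this
    exact this.resolve_right (C_ne_zero.2 (pow_ne_zero _ hf0))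
  by_contra hβ0
  have hμm : μ.Monic := monic_X_pow_sub_C a hd.ne'
  have hμd : μ.natDegree = d := natDegree_X_pow_sub_C
  have hβn : β.natDegree < d := (natDegree_lt_iff_degree_lt hβ0).2 hβd
  -- the resultant
  set r := μ.resultant β with hr
  have hrdeg : InnerDegLE (2 * d * (D + d * E)) r := by
    have : InnerDegLE ((μ.natDegree + β.natDegree) * (D + d * E)) r := by
      refine InnerDegLE.resultant (fun i => ?_) fun i => ?_
      · rw [hμ, coeff_sub, coeff_X_pow, coeff_C]
        refine InnerDegLE.sub ?_ ?_
        · split_ifs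
          exacts [InnerDegLE.one.mono zero_le, InnerDegLE.zero]
        · split_ifs
          · refine (InnerDegLE.mul (InnerDegLE.prod (N := e) fun v _ => by
              simpa using (InnerDegLE.artinSchreierFactor p v).pow (e v))
              (InnerDegLE.C (N := (d - 1) * E) (natDegree_pow_le_of_le _ hE))).mono ?_
            obtain ⟨d, rfl⟩ := Nat.exists_eq_add_of_lt hd
            simp only [zero_add, add_tsub_cancel_right]
            nlinarith
          · exact InnerDegLE.zero
      · rcases lt_or_ge i d with hi | hi
        · rw [hβc i hi]
          refine ((hD i).mul (InnerDegLE.C (N := (d - 1 - i) * E)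
            (natDegree_pow_le_of_le _ hE))).mono ?_
          gcongr; omega
        · rw [coeff_eq_zero_of_natDegree_lt (by omega)]; exact InnerDegLE.zero
    refine this.mono ?_
    gcongr; omega
  obtain ⟨s, t, -, -, hst⟩ := exists_mul_add_mul_eq_C_resultant μ β le_rfl le_rfl
    (Or.inl (by omega))
  have hrT : r.eval T = 0 := by
    have h1 := congrArg (eval₂ (evalRingHom T) (f ^ (N₀ + 1))) hst
    rw [eval₂_add, eval₂_mul, eval₂_mul, eval₂_C, coe_evalRingHom] at h1
    rw [← h1]
    have hμ0 : μ.eval₂ (evalRingHom T) (f ^ (N₀ + 1)) = 0 := by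
      rw [hμ, eval₂_sub, eval₂_X_pow, eval₂_C, ha, map_mul, map_prod]
      have : ∀ v ∈ U, evalRingHom T (artinSchreierFactor p v ^ e v)
          = ((X - C v : K[X]) ^ e v).comp (X ^ Q) := by
        intro v _
        simp only [artinSchreierFactor, map_pow, coe_evalRingHom, eval_add, eval_sub, eval_pow,
          eval_X, eval_C, hT, pow_comp, sub_comp, X_comp, C_comp]
        ring
      rw [Finset.prod_congr rfl this, ← Polynomial.prod_comp, ← hf, hfQ,
        coe_evalRingHom, eval_C, ← pow_mul,
        ← pow_add, sub_eq_zero]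
      congr 1
      rw [← hN₀]; obtain ⟨d, rfl⟩ := Nat.exists_eq_add_of_lt hd
      simp; ring
    have hβe : β.eval₂ (evalRingHom T) (f ^ (N₀ + 1)) = 0 := by
      rw [hβ, eval₂_finsetSum]
      have : ∀ i ∈ range d, (C (h i * C (f ^ (d - 1 - i))) * X ^ i : K[X][X][X]).eval₂
          (evalRingHom T) (f ^ (N₀ + 1)) = f ^ (d - 1) * ((h i).eval T * f ^ (i * N₀)) := by
        intro i hi
        rw [eval₂_mul, eval₂_C, eval₂_X_pow, coe_evalRingHom, eval_mul, eval_C]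
        have : f ^ (d - 1) = f ^ (d - 1 - i) * f ^ i := by
          rw [← pow_add]; congr 1; have := mem_range.1 hi; omega
        rw [this, ← pow_mul]; ring
      rw [Finset.sum_congr rfl this, ← Finset.mul_sum, h0, mul_zero]
    rw [hμ0, hβe, zero_mul, zero_mul, add_zero]
  have hr0 : r = 0 := eq_zero_of_eval_eq_zero_of_innerDegLE hdeg _ r (Nat.lt_succ_self _) hrdeg hrT
  -- contradiction over the fraction field
  let F := FractionRing K[X][X]
  have hinj : Function.Injective (algebraMap K[X][X] F) := IsFractionRing.injective _ _
  have hirr : Irreducible (μ.map (algebraMap K[X][X] F)) := by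
    rw [hμ, Polynomial.map_sub, Polynomial.map_pow, map_X, map_C]
    refine irreducible_X_pow_sub_C_of_forall_dvd hd fun m b hb => ?_
    obtain ⟨x, y, hy, rfl⟩ := IsFractionRing.div_surjective K[X][X] b
    have hy0 : y ≠ 0 := nonZeroDivisors.ne_zero hy
    have hy1 : algebraMap K[X][X] F y ≠ 0 := by
      rwa [Ne, map_eq_zero_iff _ hinj]
    rw [div_pow, div_eq_iff (pow_ne_zero _ hy1), ← map_pow, ← map_pow, ← map_pow, ← map_mul] at hb
    refine dvd_of_pow_eq_mul_pow (π := artinSchreierFactor p) (U := U)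
      (fun v _ => prime_artinSchreierFactor p v)
      (fun v _ w _ hvw => not_artinSchreierFactor_dvd hp hvw)
      (fun v _ => not_artinSchreierFactor_dvd_C hp v (pow_ne_zero _ hf0)) hcop hy0 (hinj hb)
  have hres : (μ.map (algebraMap K[X][X] F)).resultant (β.map (algebraMap K[X][X] F)) = 0 := by
    rw [natDegree_map_eq_of_injective hinj, natDegree_map_eq_of_injective hinj,
      resultant_map_map, ← hr, hr0, map_zero]
  refine (resultant_eq_zero_iff.1 hres).2 ((hirr.coprime_iff_not_dvd).2 fun hdvd => ?_)
  have hne : β.map (algebraMap K[X][X] F) ≠ 0 := (Polynomial.map_ne_zero_iff hinj).2 hβ0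
  have := natDegree_le_of_dvd hdvd hne
  rw [natDegree_map_eq_of_injective hinj, natDegree_map_eq_of_injective hinj] at this
  omega

end Independence

section Auxiliary

lemma exists_pow_mul_add_pow_eq {R : Type*} [CommRing R] (a y : R) (n M : ℕ) :
    ∃ w, a ^ M * (a + y) ^ n
      = a ^ n * (∑ s ∈ range M, (n.choose s : R) * y ^ s * a ^ (M - s)) + y ^ M * w := by
  have h1 : (a + y) ^ n = ∑ m ∈ range (M + (n + 1)), y ^ m * a ^ (n - m) * (n.choose m : R) := by
    rw [add_comm a y, add_pow, add_comm M (n + 1), sum_range_add _ (n + 1) M, eq_comm,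
      add_eq_left]
    refine Finset.sum_eq_zero fun x _ => ?_
    rw [Nat.choose_eq_zero_of_lt (by omega)]; simp
  refine ⟨a ^ M * ∑ m ∈ range (n + 1), y ^ m * a ^ (n - (M + m)) * (n.choose (M + m) : R), ?_⟩
  rw [h1, sum_range_add, mul_add]
  congr 1
  · rw [Finset.mul_sum, Finset.mul_sum]
    refine Finset.sum_congr rfl fun s hs => ?_
    have hs := mem_range.1 hs
    rcases le_or_gt s n with h | h
    · have : a ^ M * a ^ (n - s) = a ^ n * a ^ (M - s) := by
        rw [← pow_add, ← pow_add]; congr 1; omega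
      linear_combination (y ^ s * (n.choose s : R)) * this
    · rw [Nat.choose_eq_zero_of_lt h]; simp
  · rw [← mul_assoc, Finset.mul_sum, Finset.mul_sum]
    refine Finset.sum_congr rfl fun s _ => ?_
    ring

variable {K : Type*} [Field K]

lemma InnerDegLE.comp_X_add {N : ℕ} {f : K[X]} (hf : f.natDegree ≤ N) :
    InnerDegLE N ((f.map Polynomial.C).comp (Polynomial.X + Polynomial.C Polynomial.X)) := by
  rw [comp, eval₂_eq_sum_range, natDegree_map_eq_of_injective (C_injective)]
  refine InnerDegLE.sum fun i hi => ?_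
  have hi := mem_range.1 hi
  have h1 : InnerDegLE 1 (Polynomial.X + Polynomial.C Polynomial.X : K[X][X]) :=
    (InnerDegLE.X.mono zero_le_one).add (InnerDegLE.C natDegree_X_le)
  exact ((InnerDegLE.C (N := 0) (by simp)).mul (h1.pow i)).mono (by omega)

lemma InnerDegLE.divX {N : ℕ} {B : K[X][X]} (hB : InnerDegLE N B) : InnerDegLE N B.divX :=
  fun e => by rw [coeff_divX]; exact hB _

/-- The increment `(f (X + ε) - f X) / ε` as a polynomial in `ε` over `K[X]`. -/
noncomputable def increment (f : K[X]) : K[X][X] := ((f.map C).comp (X + C X)).divX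

lemma comp_X_add_C_eq (f : K[X]) (x : K) :
    f.comp (X + C x) = C (f.eval x) + X * (increment f).map (evalRingHom x) := by
  have h := congrArg (Polynomial.map (evalRingHom x)) (((f.map C).comp (X + C X)).divX_mul_X_add)
  have h1 : ((f.map C).comp (X + C X)).map (evalRingHom x) = f.comp (X + C x) := by
    rw [Polynomial.map_comp, Polynomial.map_map]
    have : (evalRingHom x).comp C = RingHom.id K := by ext; simp
    rw [this]; simp
  have h2 : ((f.map C).comp (X + C X)).coeff 0 = f := by
    rw [coeff_zero_eq_eval_zero, eval_comp, eval_map]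
    simp [eval₂_C_X]
  rw [h1, h2] at h
  rw [← h]
  simp [increment]
  ring

/-- The part of `f X ^ M * (f (X + ε) / f X) ^ n` of low order in the increment. -/
noncomputable def truncatedPow (f : K[X]) (M n : ℕ) : K[X][X] :=
  ∑ s ∈ range M, (n.choose s : K[X][X]) * (X * increment f) ^ s * (C f) ^ (M - s)

lemma InnerDegLE.truncatedPow {f : K[X]} {E : ℕ} (hE : f.natDegree ≤ E) (M n : ℕ) :
    InnerDegLE (M * E) (truncatedPow f M n) := by
  refine InnerDegLE.sum fun s hs => ?_
  have hs := mem_range.1 hs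
  have h1 : InnerDegLE E (Polynomial.X * increment f) := by
    have : InnerDegLE E (increment f) := (InnerDegLE.comp_X_add hE).divX
    simpa using InnerDegLE.X.mul this
  have h2 : InnerDegLE 0 ((n.choose s : ℕ) : K[X][X]) := by
    rw [← C_eq_natCast]; exact InnerDegLE.C (by rw [natDegree_natCast])
  refine ((h2.mul (h1.pow s)).mul ((InnerDegLE.C hE).pow (M - s))).mono ?_
  rw [zero_add, ← add_mul]
  gcongr; omega

lemma exists_truncatedPow_eq {f : K[X]} (M n : ℕ) (x : K) :
    ∃ w, C (f.eval x ^ M) * (f.comp (X + C x)) ^ n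
      = C (f.eval x ^ n) * (truncatedPow f M n).map (evalRingHom x) + X ^ M * w := by
  obtain ⟨w, hw⟩ := exists_pow_mul_add_pow_eq (C (f.eval x))
    (X * (increment f).map (evalRingHom x)) n M
  refine ⟨((increment f).map (evalRingHom x)) ^ M * w, ?_⟩
  rw [comp_X_add_C_eq, map_pow, hw, map_pow, mul_pow, mul_assoc, truncatedPow,
    Polynomial.map_sum]
  congr 2
  refine Finset.sum_congr rfl fun s _ => ?_
  simp

theorem card_mul_le_of_stepanov {p Q d N₀ D E M L : ℕ} (hp : 1 < p) (hd : 0 < d)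
    {T f : K[X]} (hT : T ^ p - T = X ^ Q - X) (hTadd : ∀ x, T.comp (X + C x) = T + C (T.eval x))
    {U : Finset K} {e : K → ℕ}
    (hf : f = ∏ v ∈ U, (X - C v) ^ e v) (hE : f.natDegree ≤ E)
    (hfQ : f.comp (X ^ Q) = f ^ Q) (hN₀ : d * N₀ + 1 = Q)
    (hcop : ∀ s, (∀ v ∈ U, d ∣ s * e v) → d ∣ s)
    (hdeg : 2 * d * (D + d * E) < T.natDegree) (hML : M + 1 ≤ d * L) (hMD : M ^ 2 * E ≤ D)
    {ζ t : K} {A : Finset K}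
    (hA : ∀ x ∈ A, f.eval x ≠ 0 ∧ f.eval x ^ N₀ = ζ ∧ T.eval x = t) :
    A.card * M ≤ D + L * T.natDegree + d * N₀ * E := by
  classical
  let ι := Fin d × Fin L × Fin (D + 1)
  let b : ι → K[X] := fun k => X ^ (k.2.2 : ℕ) * T ^ (k.2.1 : ℕ) * f ^ ((k.1 : ℕ) * N₀)
  let B : ι → K[X][X] := fun k => (X + C X) ^ (k.2.2 : ℕ) * (T.map C + C (C t)) ^ (k.2.1 : ℕ) *
    (C (C (ζ ^ (k.1 : ℕ))) * truncatedPow f M ((k.1 : ℕ) * N₀))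
  have hB : ∀ k, InnerDegLE (D + M * E) (B k) := fun k => by
    have h1 : InnerDegLE 1 (X + C X : K[X][X]) :=
      (InnerDegLE.X.mono zero_le_one).add (InnerDegLE.C natDegree_X_le)
    have h2 : InnerDegLE 0 (T.map C + C (C t)) :=
      InnerDegLE.add (fun e => by rw [coeff_map, natDegree_C]) (InnerDegLE.C (by rw [natDegree_C]))
    refine (((h1.pow _).mul (h2.pow _)).mul ((InnerDegLE.C (N := 0) (by rw [natDegree_C])).mul
      (InnerDegLE.truncatedPow hE M _))).mono ?_
    have := k.2.2.2
    simp only [mul_one, mul_zero, zero_add, add_zero]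
    omega
  have hbB : ∀ x ∈ A, ∀ k, ∃ w, C (f.eval x ^ M) * (b k).comp (X + C x)
      = (B k).map (evalRingHom x) + X ^ M * w := by
    intro x hx k
    obtain ⟨-, hζ, ht⟩ := hA x hx
    obtain ⟨w, hw⟩ := exists_truncatedPow_eq (f := f) M ((k.1 : ℕ) * N₀) x
    refine ⟨(X + C x) ^ (k.2.2 : ℕ) * (T + C t) ^ (k.2.1 : ℕ) * w, ?_⟩
    have h3 : (T.map C).map (evalRingHom x) = T := by
      rw [Polynomial.map_map]
      have : (evalRingHom x).comp C = RingHom.id K := by ext; simp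
      rw [this, Polynomial.map_id]
    have h4 : f.eval x ^ ((k.1 : ℕ) * N₀) = ζ ^ (k.1 : ℕ) := by
      rw [mul_comm, pow_mul, hζ]
    rw [h4] at hw
    simp only [b, B, mul_comp, pow_comp, X_comp, hTadd, ht, Polynomial.map_mul, Polynomial.map_pow,
      Polynomial.map_add, map_X, map_C, h3, coe_evalRingHom, eval_X, eval_C]
    linear_combination ((X + C x) ^ (k.2.2 : ℕ) * (T + C t) ^ (k.2.1 : ℕ)) * hw
  let Φ : (ι → K) →ₗ[K] (Fin M × Fin (D + M * E + 1) → K) :=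
    LinearMap.pi fun ej => ∑ k, ((B k).coeff ej.1).coeff ej.2 • LinearMap.proj k
  have hker : Φ.ker ≠ ⊥ := by
    apply LinearMap.ker_ne_bot_of_finrank_lt
    simp only [ι, Module.finrank_fintype_fun_eq_card, Fintype.card_prod, Fintype.card_fin]
    have h1 : (M + 1) * (D + 1) ≤ d * L * (D + 1) := Nat.mul_le_mul_right _ hML
    have h2 : M * (D + M * E + 1) = M * (D + 1) + M ^ 2 * E := by ring
    rw [← mul_assoc]
    nlinarith
  obtain ⟨c, hcker, hc0⟩ := (Submodule.ne_bot_iff _).1 hker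
  have hG : ∀ e < M, (∑ k, C (C (c k)) * B k).coeff e = 0 := by
    intro e he
    ext j
    rw [coeff_zero]
    rcases Nat.lt_or_ge j (D + M * E + 1) with hj | hj
    · have h1 := congrFun (LinearMap.mem_ker.1 hcker) (⟨e, he⟩, ⟨j, hj⟩)
      simp only [Φ, LinearMap.pi_apply, LinearMap.sum_apply, LinearMap.smul_apply,
        LinearMap.proj_apply, Pi.zero_apply, smul_eq_mul] at h1
      rw [finsetSum_coeff, finsetSum_coeff, ← h1]
      refine Finset.sum_congr rfl fun k _ => ?_
      rw [coeff_C_mul, coeff_C_mul, mul_comm]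
    · apply coeff_eq_zero_of_natDegree_lt
      refine lt_of_le_of_lt ?_ (Nat.lt_of_succ_le hj)
      exact InnerDegLE.sum (fun k _ => by
        simpa using (InnerDegLE.C (N := 0) (by rw [natDegree_C])).mul (hB k)) e
  set H : K[X] := ∑ k, C (c k) * b k with hH
  have hH0 : H ≠ 0 := by
    intro h0
    let h : ℕ → K[X][X] := fun i => if hi : i < d then
      ∑ l : Fin L, ∑ j : Fin (D + 1), C (C (c (⟨i, hi⟩, l, j)) * X ^ (j : ℕ)) * X ^ (l : ℕ) else 0
    have hh : ∀ i < d, h i = 0 := by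
      refine eq_zero_of_sum_eval_mul_pow_eq_zero hp hd hT hf hE hfQ hN₀ hcop hdeg ?_ ?_
      · intro i
        simp only [h]
        split_ifs with hi
        · refine InnerDegLE.sum fun l _ => InnerDegLE.sum fun j _ => ?_
          have hj := j.2
          simpa using (InnerDegLE.C (N := D) ((natDegree_C_mul_X_pow_le _ _).trans
            (by omega))).mul (InnerDegLE.X_pow (l : ℕ))
        · exact InnerDegLE.zero
      · rw [← h0, hH, Fintype.sum_prod_type, ← Fin.sum_univ_eq_sum_range
          (fun i => (h i).eval T * f ^ (i * N₀))]
        refine Finset.sum_congr rfl fun i _ => ?_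
        simp only [h, dif_pos i.2, eval_finsetSum, Fintype.sum_prod_type, Finset.sum_mul]
        refine Finset.sum_congr rfl fun l _ => Finset.sum_congr rfl fun j _ => ?_
        simp only [b, eval_mul, eval_C, eval_pow, eval_X]
        ring
    apply hc0
    ext ⟨i, l, j⟩
    have h1 := congrArg (fun B => (B.coeff (l : ℕ)).coeff (j : ℕ)) (hh i i.2)
    simp only [h, dif_pos i.2, finsetSum_coeff, coeff_C_mul_X_pow, coeff_zero] at h1
    rw [Finset.sum_eq_single l, Finset.sum_eq_single j] at h1
    · simpa using h1
    · intro j' _ hj'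
      simp [Fin.val_inj, hj'.symm]
    · simp
    · intro l' _ hl'
      simp [Fin.val_inj, hl'.symm]
    · simp
  have hdvd : ∀ x ∈ A, (X - C x) ^ M ∣ H := by
    intro x hx
    obtain ⟨hfx, -, -⟩ := hA x hx
    choose w hw using hbB x hx
    have h1 : X ^ M ∣ (∑ k, C (C (c k)) * B k).map (evalRingHom x) := by
      rw [X_pow_dvd_iff]
      intro e he
      rw [coeff_map, hG e he, map_zero]
    have h2 : C (f.eval x ^ M) * H.comp (X + C x)
        = (∑ k, C (C (c k)) * B k).map (evalRingHom x) + X ^ M * ∑ k, C (c k) * w k := by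
      rw [hH, Polynomial.sum_comp, Finset.mul_sum, Polynomial.map_sum, Finset.mul_sum,
        ← Finset.sum_add_distrib]
      refine Finset.sum_congr rfl fun k _ => ?_
      simp only [mul_comp, C_comp, Polynomial.map_mul, map_C, coe_evalRingHom, eval_C]
      linear_combination C (c k) * hw k
    have h3 : X ^ M ∣ C (f.eval x ^ M) * H.comp (X + C x) := by
      rw [h2]; exact dvd_add h1 (Dvd.intro _ rfl)
    have h4 : X ^ M ∣ H.comp (X + C x) :=
      ((isUnit_C.2 (IsUnit.mk0 _ (pow_ne_zero M hfx))).dvd_mul_left).1 h3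
    obtain ⟨q, hq⟩ := h4
    refine ⟨q.comp (X - C x), ?_⟩
    have := congrArg (fun r => r.comp (X - C x)) hq
    simp only [comp_assoc, add_comp, X_comp, C_comp, sub_add_cancel, comp_X, mul_comp,
      pow_comp] at this
    exact this
  have hprod : ∏ x ∈ A, (X - C x) ^ M ∣ H := by
    refine Finset.prod_dvd_of_coprime (fun x _ y _ hxy => ?_) hdvd
    exact (pairwise_coprime_X_sub_C Function.injective_id hxy).pow
  have hle := natDegree_le_of_dvd hprod hH0
  rw [natDegree_prod_of_monic _ _ fun x _ => (monic_X_sub_C x).pow _] at hle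
  simp only [(monic_X_sub_C _).natDegree_pow, natDegree_X_sub_C, mul_one, sum_const,
    smul_eq_mul] at hle
  refine hle.trans (natDegree_sum_le_of_forall_le _ _ fun k _ => ?_)
  refine (natDegree_C_mul_le _ _).trans ?_
  refine natDegree_mul_le_of_le (natDegree_mul_le_of_le ?_ ?_) ?_
  · rw [natDegree_X_pow]; have := k.2.2.2; omega
  · exact natDegree_pow_le_of_le _ le_rfl |>.trans (Nat.mul_le_mul_right _ k.2.1.2.le)
  · exact (natDegree_pow_le_of_le _ hE).trans
      (Nat.mul_le_mul_right _ (Nat.mul_le_mul_right _ k.1.2.le))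

end Auxiliary

section TracePolynomial

variable (p : ℕ) [Fact p.Prime] (K : Type*) [Field K]

/-- The polynomial `X + X ^ p + ⋯ + X ^ (p ^ (n - 1))`. -/
noncomputable def tracePoly (n : ℕ) : K[X] := ∑ i ∈ range n, X ^ p ^ i

lemma natDegree_tracePoly (n : ℕ) : (tracePoly p K (n + 1)).natDegree = p ^ n := by
  rw [tracePoly, Finset.sum_range_succ, natDegree_add_eq_right_of_degree_lt, natDegree_X_pow]
  rw [degree_X_pow]
  refine (degree_sum_le _ _).trans_lt ?_
  refine (Finset.sup_lt_iff (WithBot.bot_lt_coe _)).2 fun i hi => ?_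
  rw [degree_X_pow]
  exact_mod_cast Nat.pow_lt_pow_right (Fact.out : p.Prime).one_lt (mem_range.1 hi)

variable [CharP K p]

lemma tracePoly_pow_sub (n : ℕ) : tracePoly p K n ^ p - tracePoly p K n = X ^ p ^ n - X := by
  have h := sum_pow_char_pow (R := K[X]) p 1 (range n) (fun i => X ^ p ^ i)
  rw [pow_one] at h
  rw [tracePoly, h, ← Finset.sum_sub_distrib]
  simp only [← pow_mul, ← pow_succ]
  rw [Finset.sum_range_sub (fun i => (X : K[X]) ^ p ^ i)]
  simp

lemma tracePoly_comp (n : ℕ) (x : K) :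
    (tracePoly p K n).comp (X + C x) = tracePoly p K n + C ((tracePoly p K n).eval x) := by
  simp only [tracePoly, Polynomial.sum_comp, X_pow_comp, add_pow_char_pow, Finset.sum_add_distrib,
    eval_finsetSum, map_sum, eval_pow, eval_X, C_pow]

end TracePolynomial

section FieldPoints

variable {p : ℕ} [Fact p.Prime] {K : Type*} [Field K] [Fintype K] [Algebra (ZMod p) K]

theorem card_norm_trace_fiber_mul_le {m d : ℕ} (hd : d ∣ p - 1) (U : Finset (ZMod p))
    (e : ZMod p → ℕ) (hcop : ∀ s, (∀ v ∈ U, d ∣ s * e v) → d ∣ s)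
    (hK : Fintype.card K = p ^ (5 * m)) (hm : p * (2 * d * (∑ u ∈ U, e u) * (1 + d)) < p ^ m)
    (hm0 : 0 < m) (b t : ZMod p) {A : Finset K}
    (hA : ∀ x ∈ A, ∏ u ∈ U, (x - algebraMap (ZMod p) K u) ^ e u ≠ 0 ∧
      Algebra.norm (ZMod p) (∏ u ∈ U, (x - algebraMap (ZMod p) K u) ^ e u) ^ ((p - 1) / d)
        = b ∧ Algebra.trace (ZMod p) K x = t) :
    A.card * p ^ (2 * m) ≤ p ^ (4 * m) * (∑ u ∈ U, e u) + (p ^ (2 * m) / d + 1) * p ^ (5 * m - 1)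
      + p ^ (5 * m) * (∑ u ∈ U, e u) := by
  classical
  have hp : p.Prime := Fact.out
  have hp1 := hp.one_lt
  have hd0 : 0 < d := Nat.pos_of_dvd_of_pos hd (by omega)
  have : CharP K p := charP_of_injective_algebraMap (algebraMap (ZMod p) K).injective p
  set E := ∑ u ∈ U, e u with hEdef
  set j := algebraMap (ZMod p) K with hj
  have hjinj : Function.Injective j := (algebraMap (ZMod p) K).injective
  set f : K[X] := ∏ u ∈ U, (X - C (j u)) ^ e u with hf
  have hfx : ∀ x, f.eval x = ∏ u ∈ U, (x - j u) ^ e u := fun x => by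
    simp [f, eval_prod]
  obtain ⟨n, hn⟩ : ∃ n, 5 * m = n + 1 := ⟨5 * m - 1, by omega⟩
  have hfin : Module.finrank (ZMod p) K = 5 * m := by
    have := Module.card_eq_pow_finrank (K := ZMod p) (V := K)
    rw [hK, ZMod.card] at this
    exact (Nat.pow_right_injective hp.two_le this).symm
  have hdQ : d ∣ p ^ (5 * m) - 1 := hd.trans (by simpa using Nat.sub_dvd_pow_sub_pow p 1 (5 * m))
  have hQ0 : 0 < p ^ (5 * m) := by positivity
  obtain ⟨N₀, hN₀⟩ := hdQ
  have hN₀' : d * N₀ + 1 = p ^ (5 * m) := by omega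
  have hfU : f = ∏ v ∈ U.image j, (X - C v) ^ e (Function.invFun j v) := by
    rw [Finset.prod_image (fun a _ b _ h => hjinj h)]
    simp only [Function.leftInverse_invFun hjinj _, hf]
  have hfdeg : f.natDegree ≤ E := by
    rw [hf, natDegree_prod_of_monic _ _ fun v _ => (monic_X_sub_C _).pow _]
    exact le_of_eq (Finset.sum_congr rfl fun v _ => by rw [(monic_X_sub_C _).natDegree_pow]; simp)
  have hfQ : f.comp (X ^ p ^ (5 * m)) = f ^ p ^ (5 * m) := by
    rw [hf, Polynomial.prod_comp, ← Finset.prod_pow]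
    refine Finset.prod_congr rfl fun u _ => ?_
    rw [pow_comp, sub_comp, X_comp, C_comp, pow_right_comm, sub_pow_char_pow, ← C_pow]
    rw [← hK, FiniteField.pow_card]
  have hcop' : ∀ s, (∀ v ∈ U.image j, d ∣ s * e (Function.invFun j v)) → d ∣ s := by
    intro s hs
    refine hcop s fun v hv => ?_
    have := hs (j v) (mem_image_of_mem _ hv)
    rwa [Function.leftInverse_invFun hjinj] at this
  set P := p ^ m with hP
  have hP2 : p ^ (2 * m) = P ^ 2 := by rw [hP, ← pow_mul, mul_comm]
  have hP4 : p ^ (4 * m) = P ^ 4 := by rw [hP, ← pow_mul, mul_comm]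
  have hP5 : p ^ (5 * m) = P ^ 5 := by rw [hP, ← pow_mul, mul_comm]
  have hP5' : p * p ^ n = P ^ 5 := by rw [← hP5, hn, pow_succ']
  have hP0 : 0 < P := by positivity
  have hdeg : 2 * d * (P ^ 4 * E + d * E) < p ^ n := by
    have h1 : p * (2 * d * E * (1 + d)) * P ^ 4 < P * P ^ 4 :=
      Nat.mul_lt_mul_of_pos_right hm (by positivity)
    have h2 : p * (2 * d * (P ^ 4 * E + d * E)) ≤ p * (2 * d * E * (1 + d)) * P ^ 4 := by
      have : 1 ≤ P ^ 4 := Nat.one_le_pow _ _ hP0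
      have : d * E * 1 ≤ d * E * P ^ 4 := Nat.mul_le_mul_left _ this
      have : P ^ 4 * E + d * E ≤ E * (1 + d) * P ^ 4 := by nlinarith
      calc p * (2 * d * (P ^ 4 * E + d * E)) ≤ p * (2 * d * (E * (1 + d) * P ^ 4)) := by gcongr
        _ = _ := by ring
    have h3 : p * (2 * d * (P ^ 4 * E + d * E)) < p * p ^ n := by
      rw [hP5']; calc _ ≤ _ := h2
        _ < _ := h1
        _ = _ := by ring
    exact Nat.lt_of_mul_lt_mul_left h3
  have key := card_mul_le_of_stepanov (K := K) (p := p) (Q := p ^ (5 * m)) (d := d) (N₀ := N₀)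
    (D := P ^ 4 * E) (E := E) (M := P ^ 2) (L := P ^ 2 / d + 1) hp1 hd0
    (T := tracePoly p K (5 * m)) (f := f) (tracePoly_pow_sub p K (5 * m))
    (tracePoly_comp p K (5 * m)) hfU hfdeg hfQ hN₀' hcop'
    (by rw [hn, natDegree_tracePoly]; exact hdeg)
    (by have := Nat.lt_mul_div_succ (P ^ 2) hd0; omega)
    (by rw [← pow_mul]) (ζ := j b) (t := j t) (A := A) (by
      intro x hx
      obtain ⟨h1, h2, h3⟩ := hA x hx
      rw [hfx]
      refine ⟨h1, ?_, ?_⟩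
      · rw [← h2, map_pow, FiniteField.algebraMap_norm_eq_pow, ← pow_mul]
        congr 1
        rw [Nat.card_eq_fintype_card, Nat.card_eq_fintype_card, ZMod.card, hK, hN₀]
        obtain ⟨g, hg⟩ := hd
        rw [hg, Nat.mul_div_cancel_left _ hd0]
        have hg0 : 0 < g := Nat.pos_of_ne_zero (by rintro rfl; omega)
        have h5 : d * g ∣ d * N₀ := by
          rw [← hg, ← hN₀]; simpa using Nat.sub_dvd_pow_sub_pow p 1 (5 * m)
        obtain ⟨c, rfl⟩ := Nat.dvd_of_mul_dvd_mul_left hd0 h5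
        rw [show d * (g * c) = d * g * c by ring, Nat.mul_div_cancel_left _ (by positivity)]
        ring
      · rw [← h3, hj, FiniteField.algebraMap_trace_eq_sum_pow, tracePoly, eval_finsetSum, hfin,
          Nat.card_eq_fintype_card, ZMod.card]
        simp)
  rw [hn, natDegree_tracePoly] at key
  rw [hP2, hP4, show 5 * m - 1 = n by omega]
  refine key.trans ?_
  gcongr
  omega

end FieldPoints

section CharacterSums

variable {p : ℕ} [Fact p.Prime]

lemma isCyclic_mulChar_zmod (p : ℕ) [Fact p.Prime] : IsCyclic (MulChar (ZMod p) ℂ) :=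
  isCyclic_of_surjective _ (MulChar.mulEquiv_units (ZMod p) ℂ).some.symm.surjective

lemma exists_common_mulChar (U : Finset (ZMod p)) (χ : ZMod p → MulChar (ZMod p) ℂ) :
    ∃ (χ₁ : MulChar (ZMod p) ℂ) (e : ZMod p → ℕ), (∀ u ∈ U, χ u = χ₁ ^ e u) ∧
      ∀ s, (∀ u ∈ U, orderOf χ₁ ∣ s * e u) → orderOf χ₁ ∣ s := by
  classical
  have := isCyclic_mulChar_zmod p
  let G := Subgroup.closure (Set.image χ U)
  obtain ⟨⟨χ₁, h₁⟩, hgen⟩ := IsCyclic.exists_generator (α := G)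
  have hU : ∀ u ∈ U, ∃ n : ℕ, χ u = χ₁ ^ n := fun u hu => by
    have := hgen ⟨χ u, Subgroup.subset_closure (Set.mem_image_of_mem χ hu)⟩
    rw [← mem_powers_iff_mem_zpowers] at this
    obtain ⟨n, hn⟩ := this
    exact ⟨n, by simpa using (congrArg Subtype.val hn).symm⟩
  choose! e he using hU
  refine ⟨χ₁, e, he, fun s hs => orderOf_dvd_of_pow_eq_one ?_⟩
  have : G ≤ (powMonoidHom s : MulChar (ZMod p) ℂ →* _).ker := by
    rw [Subgroup.closure_le]
    rintro _ ⟨u, hu, rfl⟩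
    rw [SetLike.mem_coe, MonoidHom.mem_ker, powMonoidHom_apply, he u hu, ← pow_mul, mul_comm]
    exact orderOf_dvd_iff_pow_eq_one.1 (hs u hu)
  exact this h₁

lemma orderOf_mulChar_dvd (χ : MulChar (ZMod p) ℂ) : orderOf χ ∣ p - 1 := by
  refine orderOf_dvd_of_pow_eq_one ?_
  have := χ.pow_card_eq_one
  rwa [ZMod.card_units] at this

lemma mulChar_apply_eq_of_pow_eq (χ : MulChar (ZMod p) ℂ) {g : ℕ} (hg : orderOf χ * g = p - 1)
    {y b : (ZMod p)ˣ} (h : y ^ g = b ^ g) : χ y = χ b := by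
  obtain ⟨γ, hγ⟩ := IsCyclic.exists_generator (α := (ZMod p)ˣ)
  have hp1 : 0 < p - 1 := by have := (Fact.out : p.Prime).one_lt; omega
  have hg0 : 0 < g := Nat.pos_of_ne_zero (by rintro rfl; omega)
  have hγo : orderOf γ = p - 1 := by
    rw [orderOf_eq_card_of_forall_mem_zpowers hγ, Nat.card_eq_fintype_card, ZMod.card_units]
  obtain ⟨i, hi⟩ := mem_powers_iff_mem_zpowers.2 (hγ (y * b⁻¹))
  have hi' : γ ^ i = y * b⁻¹ := hi
  have h1 : γ ^ (i * g) = 1 := by rw [pow_mul, hi', mul_pow, inv_pow, h, mul_inv_cancel]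
  have h2 : orderOf χ ∣ i := by
    have := orderOf_dvd_of_pow_eq_one h1
    rw [hγo, ← hg] at this
    exact Nat.dvd_of_mul_dvd_mul_right hg0 this
  obtain ⟨c, rfl⟩ := h2
  have h3 : χ (y * b⁻¹ : (ZMod p)ˣ) = 1 := by
    rw [← hi', mul_comm, pow_mul]
    rw [Units.val_pow_eq_pow_val, map_pow, ← MulChar.pow_apply_coe, pow_orderOf_eq_one]
    exact MulChar.one_apply_coe _
  have h4 : y = (y * b⁻¹) * b := by group
  rw [h4, Units.val_mul, map_mul, h3, one_mul]

lemma card_filter_pow_eq {g : ℕ} (hg : g ∣ p - 1) (b : (ZMod p)ˣ) :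
    (univ.filter fun y : (ZMod p)ˣ => y ^ g = b ^ g).card = g := by
  have h1 := IsCyclic.card_powMonoidHom_ker (ZMod p)ˣ g
  rw [Nat.card_eq_fintype_card (α := (ZMod p)ˣ), ZMod.card_units, Nat.gcd_eq_right hg] at h1
  refine Eq.trans ?_ h1
  rw [Nat.card_eq_fintype_card, Fintype.card_subtype]
  refine Finset.card_equiv (Equiv.mulLeft b⁻¹) fun y => ?_
  simp [MonoidHom.mem_ker, mul_pow, inv_mul_eq_one, eq_comm]

theorem exists_norm_charSum_le (U : Finset (ZMod p)) (χ : ZMod p → MulChar (ZMod p) ℂ)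
    (ψ : AddChar (ZMod p) ℂ) (hχ : ∃ u ∈ U, χ u ≠ 1) :
    ∃ (c : ℝ) (m₀ : ℕ), ∀ m ≥ m₀, ∀ (K : Type) [Field K] [Fintype K] [Algebra (ZMod p) K],
      Fintype.card K = p ^ (5 * m) →
      ‖∑ x : K, (∏ u ∈ U, χ u (Algebra.norm (ZMod p) (x - algebraMap (ZMod p) K u)))
        * ψ (Algebra.trace (ZMod p) K x)‖ ≤ c * ((p : ℝ) ^ 3) ^ m := by
  classical
  have hp : p.Prime := Fact.out
  have hp1 := hp.one_lt
  obtain ⟨χ₁, e, he, hcop⟩ := exists_common_mulChar U χ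
  set d := orderOf χ₁ with hd
  have hχ₁ : χ₁ ≠ 1 := by
    rintro rfl
    obtain ⟨u, hu, h⟩ := hχ
    exact h (by rw [he u hu, one_pow])
  have hdp : d ∣ p - 1 := orderOf_mulChar_dvd χ₁
  obtain ⟨g, hg⟩ := id hdp
  have hd0 : 0 < d := Nat.pos_of_dvd_of_pos hdp (by omega)
  have hg0 : 0 < g := Nat.pos_of_ne_zero (by rintro rfl; omega)
  have hgdiv : (p - 1) / d = g := by rw [hg, Nat.mul_div_cancel_left _ hd0]
  set E := ∑ u ∈ U, e u with hE
  refine ⟨2 * (p * (p - 1 : ℕ)) * (2 * E + 1) + U.card, p * (2 * d * E * (1 + d)) + 1, ?_⟩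
  intro m hm K _ _ _ hK
  set j := algebraMap (ZMod p) K with hj
  set good : Finset K := univ.filter fun x => ∀ u ∈ U, x ≠ j u with hgood
  set N : K → ZMod p := fun x => Algebra.norm (ZMod p) (∏ u ∈ U, (x - j u) ^ e u) with hN
  have hfx : ∀ x ∈ good, ∏ u ∈ U, (x - j u) ^ e u ≠ 0 := fun x hx =>
    prod_ne_zero_iff.2 fun u hu => pow_ne_zero _ (sub_ne_zero.2 ((mem_filter.1 hx).2 u hu))
  have hN0 : ∀ x ∈ good, N x ≠ 0 := fun x hx => by
    rw [hN]; exact Algebra.norm_ne_zero_iff.2 (hfx x hx)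
  let Tr : K → ZMod p := fun x => Algebra.trace (ZMod p) K x
  have hS : ∑ x : K, (∏ u ∈ U, χ u (Algebra.norm (ZMod p) (x - j u))) * ψ (Tr x)
      = ∑ x ∈ good, χ₁ (N x) * ψ (Tr x) := by
    rw [hgood, Finset.sum_filter]
    refine Finset.sum_congr rfl fun x _ => ?_
    split_ifs with hx
    · congr 1
      simp only [hN, map_prod, map_pow]
      refine Finset.prod_congr rfl fun u hu => ?_
      have : Algebra.norm (ZMod p) (x - j u) ≠ 0 :=
        Algebra.norm_ne_zero_iff.2 (sub_ne_zero.2 (hx u hu))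
      rw [he u hu, ← Units.val_mk0 this, MulChar.pow_apply_coe]
    · push Not at hx
      obtain ⟨u, hu, rfl⟩ := hx
      rw [Finset.prod_eq_zero hu, zero_mul]
      rw [sub_self, Algebra.norm_zero, MulChar.map_zero]
  let A : (ZMod p)ˣ → ZMod p → Finset K := fun y t =>
    good.filter fun x => N x ^ g = (y : ZMod p) ^ g ∧ Tr x = t
  have hcount : ∀ (φ : (ZMod p)ˣ → ℂ) (ψ' : ZMod p → ℂ) (φ' : ZMod p → ℂ),
      (∀ y b : (ZMod p)ˣ, y ^ g = b ^ g → φ y = φ' b) →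
      ∑ y : (ZMod p)ˣ, ∑ t : ZMod p, φ y * ψ' t * ((A y t).card : ℂ)
        = g * ∑ x ∈ good, φ' (N x) * ψ' (Tr x) := by
    intro φ ψ' φ' hφ
    have h1 : ∀ y t, φ y * ψ' t * ((A y t).card : ℂ) = ∑ x ∈ good,
        if N x ^ g = (y : ZMod p) ^ g ∧ Tr x = t then φ y * ψ' t else 0 := fun y t => by
      rw [← Finset.sum_filter, sum_const, nsmul_eq_mul, mul_comm]
    simp only [h1]
    rw [Finset.mul_sum]
    simp only [Finset.sum_comm (t := good)]
    refine Finset.sum_congr rfl fun x hx => ?_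
    simp only [ite_and]
    have h2 : ∀ y : (ZMod p)ˣ, (∑ t : ZMod p, if N x ^ g = (y : ZMod p) ^ g then
        if Tr x = t then φ y * ψ' t else 0 else 0)
        = if y ^ g = (Units.mk0 _ (hN0 x hx)) ^ g then φ' (N x) * ψ' (Tr x) else 0 := by
      intro y
      have h3 : N x ^ g = (y : ZMod p) ^ g ↔ y ^ g = (Units.mk0 _ (hN0 x hx)) ^ g := by
        rw [Units.ext_iff, eq_comm]; simp
      simp only [h3]
      split_ifs with h
      · rw [Finset.sum_ite_eq, if_pos (mem_univ _), hφ _ _ h, Units.val_mk0]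
      · simp
    rw [Finset.sum_congr rfl fun y _ => h2 y, ← Finset.sum_filter, sum_const,
      card_filter_pow_eq (hg ▸ Dvd.intro_left d rfl), nsmul_eq_mul]
  have hc1 := hcount (fun y => χ₁ y) ψ χ₁ fun y b h => mulChar_apply_eq_of_pow_eq χ₁ hg.symm h
  have hc2 := hcount (fun _ => 1) (fun _ => 1) (fun _ => 1) fun _ _ _ => rfl
  set Q : ℝ := (p : ℝ) ^ (5 * m) with hQ
  set w : (ZMod p)ˣ → ZMod p → ℝ := fun y t => (A y t).card - Q / (d * p) with hw
  set P : ℝ := (p : ℝ) ^ m with hP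
  have hP0 : 1 ≤ P := one_le_pow₀ (by exact_mod_cast hp1.le)
  have hw_le : ∀ y t, w y t ≤ (2 * E + 1) * P ^ 3 := by
    intro y t
    have h1 := card_norm_trace_fiber_mul_le hdp U e hcop hK
      ((Nat.lt_of_succ_le hm).trans (Nat.lt_pow_self hp1)) (by omega) ((y : ZMod p) ^ g) t
      (A := A y t) (fun x hx => ⟨hfx x (mem_filter.1 hx).1,
        by rw [hgdiv]; exact (mem_filter.1 hx).2.1, (mem_filter.1 hx).2.2⟩)
    have h2 : ((A y t).card : ℝ) * P ^ 2 ≤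
        P ^ 4 * E + (P ^ 2 / d + 1) * (P ^ 5 / p) + P ^ 5 * E := by
      have h3 : ((A y t).card * p ^ (2 * m) : ℝ) ≤ p ^ (4 * m) * E
        + ((p ^ (2 * m) / d : ℕ) + 1) * p ^ (5 * m - 1) + p ^ (5 * m) * E := by exact_mod_cast h1
      have h4 : ((p ^ (2 * m) / d : ℕ) : ℝ) ≤ (p : ℝ) ^ (2 * m) / d :=
        Nat.cast_div_le.trans (by push_cast; rfl)
      have h5 : (p : ℝ) ^ (5 * m - 1) = P ^ 5 / p := by
        rw [eq_div_iff (by positivity), ← pow_succ, hP, ← pow_mul]; congr 1; omega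
      have h6 : ∀ k, (p : ℝ) ^ (k * m) = P ^ k := fun k => by rw [hP, ← pow_mul, mul_comm]
      rw [h5, h6, h6, h6] at h3
      rw [h6] at h4
      refine h3.trans ?_
      gcongr
    have h6 : (A y t).card ≤ P ^ 2 * E + P ^ 5 / (d * p) + P ^ 3 / p + P ^ 3 * E := by
      have : 0 < P ^ 2 := by positivity
      refine le_of_mul_le_mul_right (h2.trans (le_of_eq ?_)) this
      have : (d : ℝ) ≠ 0 := by positivity
      have : (p : ℝ) ≠ 0 := by positivity
      field_simp
      ring
    have h7 : P ^ 3 / p ≤ P ^ 3 := div_le_self (by positivity) (by exact_mod_cast hp1.le)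
    have h8 : P ^ 2 * E ≤ P ^ 3 * E := by gcongr; norm_num
    have h9 : Q = P ^ 5 := by rw [hQ, hP, ← pow_mul, mul_comm]
    rw [hw, h9]
    linarith
  have hgS : (g : ℂ) * ∑ x ∈ good, χ₁ (N x) * ψ (Tr x)
      = ∑ y : (ZMod p)ˣ, ∑ t : ZMod p, χ₁ y * ψ t * (w y t : ℂ) := by
    rw [← hc1]
    simp only [hw, Complex.ofReal_sub, Complex.ofReal_natCast, mul_sub, Finset.sum_sub_distrib]
    rw [eq_comm, sub_eq_self]
    have h1 : ∑ y : (ZMod p)ˣ, χ₁ y = 0 := by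
      rw [← MulChar.sum_eq_zero_of_ne_one hχ₁]
      refine Fintype.sum_of_injective _ Units.val_injective _ _ (fun x hx => ?_) fun _ => rfl
      rw [MulChar.map_nonunit _ fun h => hx ⟨h.unit, rfl⟩]
    simp only [mul_assoc, ← Finset.mul_sum, ← Finset.sum_mul]
    rw [h1, zero_mul]
  have hsumw : -((g * U.card : ℕ) : ℝ) ≤ ∑ y : (ZMod p)ˣ, ∑ t : ZMod p, w y t := by
    have h1 : (∑ y : (ZMod p)ˣ, ∑ t : ZMod p, ((A y t).card : ℝ)) = g * good.card := by
      have : (∑ y : (ZMod p)ˣ, ∑ t : ZMod p, ((A y t).card : ℂ)) = g * good.card := by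
        simpa using hc2
      exact_mod_cast this
    have h2 : Fintype.card K ≤ good.card + U.card := by
      have : (univ : Finset K) ⊆ good ∪ U.image j := fun x _ => by
        simp only [hgood, mem_union, mem_filter, mem_univ, true_and, mem_image]
        by_contra! h
        exact absurd h.1 (by push Not; exact fun u hu => (h.2 u hu).symm)
      exact (card_le_card this).trans ((card_union_le _ _).trans (by gcongr; exact card_image_le))
    have h3 : Q ≤ good.card + U.card := by
      rw [hK] at h2; rw [hQ]; exact_mod_cast h2
    simp only [hw, Finset.sum_sub_distrib, h1, sum_const, card_univ, ZMod.card_units, ZMod.card,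
      nsmul_eq_mul, hg]
    have h4 : ((d * g : ℕ) : ℝ) * (p * (Q / (d * p))) = g * Q := by
      push_cast; field_simp
    rw [h4]
    push_cast
    have : (g : ℝ) * Q ≤ g * (good.card + U.card) := by gcongr
    linarith
  have hbound : ‖(g : ℂ) * ∑ x ∈ good, χ₁ (N x) * ψ (Tr x)‖
      ≤ 2 * (p * (p - 1 : ℕ)) * ((2 * E + 1) * P ^ 3) + g * U.card := by
    rw [hgS]
    have h1 : ∀ (y : (ZMod p)ˣ) t, ‖χ₁ y * ψ t * (w y t : ℂ)‖ ≤
        2 * ((2 * E + 1) * P ^ 3) - w y t := by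
      intro y t
      rw [norm_mul, norm_mul, Complex.norm_real, AddChar.norm_apply, mul_one, Real.norm_eq_abs]
      have h2 : ‖χ₁ y‖ ≤ 1 := DirichletCharacter.norm_le_one χ₁ _
      have h3 := hw_le y t
      have h4 : (0 : ℝ) ≤ (2 * E + 1) * P ^ 3 := by positivity
      calc _ ≤ 1 * |w y t| := by gcongr
        _ ≤ _ := by rw [one_mul, abs_le]; constructor <;> linarith
    refine (norm_sum_le _ _).trans ((Finset.sum_le_sum fun y _ => (norm_sum_le _ _).trans
      (Finset.sum_le_sum fun t _ => h1 y t)).trans ?_)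
    simp only [Finset.sum_sub_distrib, sum_const, card_univ, ZMod.card_units, ZMod.card,
      nsmul_eq_mul]
    push_cast at hsumw
    linarith
  rw [hS]
  rw [norm_mul, Complex.norm_natCast] at hbound
  have hg1 : (1 : ℝ) ≤ g := by exact_mod_cast hg0
  have hP3 : ((p : ℝ) ^ 3) ^ m = P ^ 3 := by rw [hP, pow_right_comm]
  rw [hP3]
  have h1 : (g : ℝ) * ‖∑ x ∈ good, χ₁ (N x) * ψ (Tr x)‖
      ≤ g * ((2 * (p * (p - 1 : ℕ)) * (2 * E + 1) + U.card) * P ^ 3) := by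
    refine hbound.trans ?_
    have h2 : (U.card : ℝ) ≤ U.card * P ^ 3 := le_mul_of_one_le_right (Nat.cast_nonneg _)
      (one_le_pow₀ hP0)
    have h3 : (0 : ℝ) ≤ 2 * (p * (p - 1 : ℕ)) * ((2 * E + 1) * P ^ 3) := by positivity
    nlinarith
  exact le_of_mul_le_mul_left h1 (by positivity)

end CharacterSums

section LFunction

variable (F : Type*) [Field F] [Finite F]

lemma finite_monic_natDegree_eq (n : ℕ) : {g : F[X] | g.Monic ∧ g.natDegree = n}.Finite := by
  have : Finite (degreeLT F (n + 1)) := Module.finite_of_finite F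
  refine Set.Finite.subset (Set.toFinite (degreeLT F (n + 1) : Set F[X])) ?_
  rintro g ⟨-, hg⟩
  refine mem_degreeLT.2 (degree_le_natDegree.trans_lt ?_)
  rw [hg]
  exact_mod_cast n.lt_succ_self

/-- The monic polynomials of degree `n` over a finite field. -/
noncomputable def monicPolys (n : ℕ) : Finset F[X] := (finite_monic_natDegree_eq F n).toFinset

variable {F}

@[simp] lemma mem_monicPolys {n : ℕ} {g : F[X]} :
    g ∈ monicPolys F n ↔ g.Monic ∧ g.natDegree = n := by simp [monicPolys]

lemma monicPolys_zero : monicPolys F 0 = {1} := by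
  ext g
  rw [mem_monicPolys, mem_singleton]
  constructor
  · rintro ⟨h1, h2⟩; exact h1.natDegree_eq_zero.1 h2
  · rintro rfl; exact ⟨monic_one, natDegree_one⟩

/-- The coefficient at degree `n` of the `L`-function of `l`. -/
noncomputable def lCoeff (l : F[X] → ℂ) (n : ℕ) : ℂ := ∑ g ∈ monicPolys F n, l g

open scoped Classical in
/-- The coefficient at degree `r` of the logarithmic derivative of the `L`-function of `l`. -/
noncomputable def lPower (l : F[X] → ℂ) (r : ℕ) : ℂ :=
  ∑ s ∈ r.divisors, ∑ P ∈ (monicPolys F s).filter Irreducible, s * l P ^ (r / s)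

lemma sum_natDegree_mul_card_eq {n : ℕ} {g : F[X]} (hg : g ∈ monicPolys F n) :
    open scoped Classical in
    ∑ s ∈ Icc 1 n, ∑ P ∈ (monicPolys F s).filter Irreducible,
      s * ((Icc 1 n).filter fun j => P ^ j ∣ g).card = n := by
  classical
  obtain ⟨hm, hd⟩ := mem_monicPolys.1 hg
  have hg0 : g ≠ 0 := hm.ne_zero
  set Z := UniqueFactorizationMonoid.normalizedFactors g with hZ
  have hZm : ∀ P, P ∈ Z ↔ Irreducible P ∧ P.Monic ∧ P ∣ g := fun P =>
    Polynomial.mem_normalizedFactors_iff hg0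
  have hdeg : ∑ P ∈ Z.toFinset, Z.count P * P.natDegree = n := by
    have h1 : Z.prod = g := by
      have := leadingCoeff_mul_prod_normalizedFactors g
      rwa [hm.leadingCoeff, map_one, one_mul] at this
    rw [← hd]
    conv_rhs => rw [← h1, natDegree_multiset_prod_of_monic _ fun P hP => ((hZm P).1 hP).2.1]
    rw [Finset.sum_multiset_map_count]
    rfl
  have hcount : ∀ P : F[X], Irreducible P → P.Monic →
      ((Icc 1 n).filter fun j => P ^ j ∣ g).card = Z.count P := by
    intro P hP hPm
    have h1 : ∀ j, P ^ j ∣ g ↔ j ≤ Z.count P := fun j => by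
      rw [pow_dvd_iff_le_emultiplicity,
        UniqueFactorizationMonoid.emultiplicity_eq_count_normalizedFactors hP hg0,
        hPm.normalize_eq_self, Nat.cast_le]
    have h2 : Z.count P ≤ n := by
      by_cases hPZ : P ∈ Z
      · rw [← hdeg]
        refine le_trans ?_ (Finset.single_le_sum (f := fun P => Z.count P * P.natDegree)
          (fun _ _ => Nat.zero_le _) (Multiset.mem_toFinset.2 hPZ))
        exact Nat.le_mul_of_pos_right _ hP.natDegree_pos
      · rw [Multiset.count_eq_zero_of_notMem hPZ]; exact Nat.zero_le _
    have h3 : ((Icc 1 n).filter fun j => P ^ j ∣ g) = Icc 1 (Z.count P) := by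
      ext j
      simp only [mem_filter, mem_Icc, h1]
      omega
    rw [h3, Nat.card_Icc, Nat.add_sub_cancel]
  refine Eq.trans ?_ hdeg
  rw [← Finset.sum_fiberwise_of_maps_to (s := Z.toFinset) (t := Icc 1 n) (g := natDegree)]
  · refine Finset.sum_congr rfl fun s hs => ?_
    symm
    refine Finset.sum_subset_zero_on_sdiff ?_ ?_ ?_
    · intro P hP
      simp only [mem_filter, Multiset.mem_toFinset, hZm, mem_monicPolys] at hP ⊢
      exact ⟨⟨hP.1.2.1, hP.2⟩, hP.1.1⟩
    · intro P hP
      simp only [Finset.mem_sdiff, mem_filter, Multiset.mem_toFinset, mem_monicPolys] at hP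
      rw [hcount P hP.1.2 hP.1.1.1, Multiset.count_eq_zero_of_notMem fun h => hP.2 ⟨h, hP.1.1.2⟩,
        mul_zero]
    · intro P hP
      simp only [mem_filter, Multiset.mem_toFinset, hZm] at hP
      rw [hcount P hP.1.1 hP.1.2.1, hP.2, mul_comm]
  · intro P hP
    obtain ⟨h1, -, h3⟩ := (hZm P).1 (Multiset.mem_toFinset.1 hP)
    exact mem_Icc.2 ⟨h1.natDegree_pos, hd ▸ natDegree_le_of_dvd h3 hg0⟩

lemma sum_filter_dvd_eq {l : F[X] → ℂ}
    (hl : ∀ g h : F[X], g.Monic → h.Monic → l (g * h) = l g * l h)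
    {n k : ℕ} {P : F[X]} (hP : P ∈ monicPolys F k) :
    open scoped Classical in
    ∑ g ∈ (monicPolys F n).filter (P ∣ ·), l g
      = if k ≤ n then l P * lCoeff l (n - k) else 0 := by
  classical
  obtain ⟨hPm, hPd⟩ := mem_monicPolys.1 hP
  split_ifs with hk
  · rw [lCoeff, Finset.mul_sum]
    symm
    refine Finset.sum_bij (fun g _ => P * g) ?_ ?_ ?_ ?_
    · intro g hg
      obtain ⟨h1, h2⟩ := mem_monicPolys.1 hg
      rw [mem_filter, mem_monicPolys, hPm.natDegree_mul h1]
      exact ⟨⟨hPm.mul h1, by omega⟩, Dvd.intro _ rfl⟩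
    · intro g _ g' _ h
      exact mul_left_cancel₀ hPm.ne_zero h
    · intro g hg
      rw [mem_filter, mem_monicPolys] at hg
      obtain ⟨⟨h1, h2⟩, q, rfl⟩ := hg
      have hq := hPm.of_mul_monic_left h1
      rw [hPm.natDegree_mul hq] at h2
      exact ⟨q, mem_monicPolys.2 ⟨hq, by omega⟩, rfl⟩
    · intro g hg
      exact (hl _ _ hPm (mem_monicPolys.1 hg).1).symm
  · rw [Finset.filter_false_of_mem, Finset.sum_empty]
    intro g hg h
    obtain ⟨h1, h2⟩ := mem_monicPolys.1 hg
    have := natDegree_le_of_dvd h h1.ne_zero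
    omega

lemma sum_mul_le_eq_sum_divisors (n : ℕ) (G : ℕ → ℕ → ℕ → ℂ) :
    ∑ s ∈ Icc 1 n, ∑ j ∈ Icc 1 n with s * j ≤ n, G s j (s * j)
      = ∑ r ∈ Icc 1 n, ∑ s ∈ r.divisors, G s (r / s) r := by
  rw [Finset.sum_sigma', Finset.sum_sigma']
  refine Finset.sum_bij' (fun x _ => ⟨x.1 * x.2, x.1⟩) (fun y _ => ⟨y.2, y.1 / y.2⟩) ?_ ?_ ?_ ?_ ?_
  · rintro ⟨s, j⟩ h
    simp only [mem_sigma, mem_filter, mem_Icc] at h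
    simp only [mem_sigma, mem_Icc, Nat.mem_divisors]
    have : 1 ≤ s * j := Nat.mul_pos h.1.1 h.2.1.1
    exact ⟨⟨this, h.2.2⟩, Dvd.intro _ rfl, by omega⟩
  · rintro ⟨r, s⟩ h
    simp only [mem_sigma, mem_Icc, Nat.mem_divisors] at h
    simp only [mem_sigma, mem_filter, mem_Icc]
    obtain ⟨⟨hr1, hrn⟩, ⟨j, rfl⟩, -⟩ := h
    have hs : 0 < s := Nat.pos_of_mul_pos_right hr1
    have hj : 0 < j := Nat.pos_of_mul_pos_left hr1
    rw [Nat.mul_div_cancel_left _ hs]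
    refine ⟨⟨hs, (Nat.le_mul_of_pos_right _ hj).trans hrn⟩,
      ⟨hj, (Nat.le_mul_of_pos_left _ hs).trans hrn⟩, hrn⟩
  · rintro ⟨s, j⟩ h
    simp only [mem_sigma, mem_filter, mem_Icc] at h
    simp [Nat.mul_div_cancel_left _ (show 0 < s by omega)]
  · rintro ⟨r, s⟩ h
    simp only [mem_sigma, mem_Icc, Nat.mem_divisors] at h
    simp [Nat.mul_div_cancel' h.2.1]
  · rintro ⟨s, j⟩ h
    simp only [mem_sigma, mem_filter, mem_Icc] at h
    simp [Nat.mul_div_cancel_left _ (show 0 < s by omega)]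

theorem natCast_mul_lCoeff {l : F[X] → ℂ} (hl1 : l 1 = 1)
    (hl : ∀ g h : F[X], g.Monic → h.Monic → l (g * h) = l g * l h) (n : ℕ) :
    n * lCoeff l n = ∑ r ∈ Icc 1 n, lPower l r * lCoeff l (n - r) := by
  classical
  have hpow : ∀ P : F[X], P.Monic → ∀ j, l (P ^ j) = l P ^ j := by
    intro P hP j
    induction j with
    | zero => simpa using hl1
    | succ j ih => rw [pow_succ, hl _ _ (hP.pow j) hP, ih, pow_succ]
  have h1 : n * lCoeff l n = ∑ s ∈ Icc 1 n, ∑ P ∈ (monicPolys F s).filter Irreducible,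
      ∑ j ∈ Icc 1 n, ∑ g ∈ (monicPolys F n).filter (P ^ j ∣ ·), s * l g := by
    rw [lCoeff, Finset.mul_sum]
    have h2 : ∀ g ∈ monicPolys F n, n * l g = ∑ s ∈ Icc 1 n,
        ∑ P ∈ (monicPolys F s).filter Irreducible, ∑ j ∈ Icc 1 n,
          if P ^ j ∣ g then s * l g else 0 := by
      intro g hg
      have := congrArg (fun k : ℕ => (k : ℂ)) (sum_natDegree_mul_card_eq hg)
      simp only [Nat.cast_sum, Nat.cast_mul] at this
      rw [← this, Finset.sum_mul]
      refine Finset.sum_congr rfl fun s _ => ?_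
      rw [Finset.sum_mul]
      refine Finset.sum_congr rfl fun P _ => ?_
      rw [← Finset.sum_filter, sum_const, nsmul_eq_mul]
      ring
    rw [Finset.sum_congr rfl h2, Finset.sum_comm]
    refine Finset.sum_congr rfl fun s _ => ?_
    rw [Finset.sum_comm]
    refine Finset.sum_congr rfl fun P _ => ?_
    rw [Finset.sum_comm]
    refine Finset.sum_congr rfl fun j _ => ?_
    rw [Finset.sum_filter]
  rw [h1]
  simp only [lPower, Finset.sum_mul]
  have h3 : ∀ s ∈ Icc 1 n, (∑ P ∈ (monicPolys F s).filter Irreducible,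
      ∑ j ∈ Icc 1 n, ∑ g ∈ (monicPolys F n).filter (P ^ j ∣ ·), s * l g)
      = ∑ j ∈ Icc 1 n with s * j ≤ n, ∑ P ∈ (monicPolys F s).filter Irreducible,
        s * l P ^ j * lCoeff l (n - s * j) := by
    intro s _
    rw [Finset.sum_comm, Finset.sum_filter]
    refine Finset.sum_congr rfl fun j _ => ?_
    have h4 : ∀ P ∈ (monicPolys F s).filter Irreducible,
        ∑ g ∈ (monicPolys F n).filter (P ^ j ∣ ·), s * l g
          = if s * j ≤ n then s * l P ^ j * lCoeff l (n - s * j) else 0 := by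
      intro P hP
      rw [mem_filter, mem_monicPolys] at hP
      rw [← Finset.mul_sum, sum_filter_dvd_eq hl (k := s * j) (P := P ^ j)
        (mem_monicPolys.2 ⟨hP.1.1.pow j, by rw [hP.1.1.natDegree_pow, hP.1.2, mul_comm]⟩),
        hpow P hP.1.1]
      split_ifs <;> ring
    rw [Finset.sum_congr rfl h4]
    split_ifs <;> simp
  rw [Finset.sum_congr rfl h3]
  exact sum_mul_le_eq_sum_divisors n fun s j r => ∑ P ∈ (monicPolys F s).filter Irreducible,
    s * l P ^ j * lCoeff l (n - r)

end LFunction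

section PowerSums

lemma exists_esymm_eq {k : ℕ} {a : ℕ → ℂ} (h0 : a 0 = 1) (hk : ∀ n, k < n → a n = 0) :
    ∃ ω : Fin k → ℂ, ∀ n, a n = (-1) ^ n * (Finset.univ.val.map ω).esymm n := by
  set Q : ℂ[X] := ∑ i ∈ range (k + 1), C (a (k - i)) * X ^ i with hQ
  have hcoeff : ∀ i, Q.coeff i = if i ≤ k then a (k - i) else 0 := by
    intro i
    simp only [hQ, finsetSum_coeff, coeff_C_mul, coeff_X_pow, mul_ite, mul_one, mul_zero]
    rw [Finset.sum_ite_eq]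
    simp
  have hQd : Q.natDegree = k := by
    refine natDegree_eq_of_le_of_coeff_ne_zero ?_ ?_
    · refine natDegree_le_iff_coeff_eq_zero.2 fun i hi => ?_
      rw [hcoeff, if_neg (by omega)]
    · rw [hcoeff, if_pos le_rfl, Nat.sub_self, h0]; exact one_ne_zero
  have hQm : Q.leadingCoeff = 1 := by
    rw [leadingCoeff, hQd, hcoeff, if_pos le_rfl, Nat.sub_self, h0]
  have hroots : Q.roots.card = Q.natDegree :=
    (splits_iff_card_roots.1 (IsAlgClosed.splits Q))
  have hlen : Q.roots.toList.length = k := by rw [Multiset.length_toList, hroots, hQd]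
  refine ⟨fun i => Q.roots.toList.get (i.cast hlen.symm), fun n => ?_⟩
  have hmap : Finset.univ.val.map (fun i : Fin k => Q.roots.toList.get (i.cast hlen.symm))
      = Q.roots := by
    conv_rhs => rw [← Q.roots.coe_toList]
    rw [Fin.univ_val_map]
    congr 1
    refine List.ext_get (by simp [hlen]) fun i h1 h2 => ?_
    simp
  rw [hmap]
  rcases le_or_gt n k with hn | hn
  · have := coeff_eq_esymm_roots_of_card hroots (k := k - n) (by omega)
    rw [hcoeff, if_pos (Nat.sub_le _ _), hQm, hQd, one_mul] at this
    rwa [show k - (k - n) = n by omega] at this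
  · rw [hk n hn, Multiset.esymm, Multiset.powersetCard_eq_empty _ (by rw [hroots, hQd]; exact hn)]
    simp

theorem exists_eq_neg_sum_pow {k : ℕ} {a S : ℕ → ℂ} (h0 : a 0 = 1) (hk : ∀ n, k < n → a n = 0)
    (h : ∀ n, n * a n = ∑ r ∈ Icc 1 n, S r * a (n - r)) :
    ∃ ω : Fin k → ℂ, ∀ n, 1 ≤ n → S n = -∑ j, ω j ^ n := by
  obtain ⟨ω, hω⟩ := exists_esymm_eq h0 hk
  refine ⟨ω, fun n => ?_⟩
  have newton : ∀ n, n * a n = ∑ r ∈ Icc 1 n, (-∑ j, ω j ^ r) * a (n - r) := by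
    intro n
    have := congrArg (MvPolynomial.aeval ω) (MvPolynomial.mul_esymm_eq_sum (Fin k) ℂ n)
    simp only [map_mul, map_sum, map_pow, map_neg, map_one, map_natCast,
      MvPolynomial.aeval_esymm_eq_multiset_esymm, MvPolynomial.psum, MvPolynomial.aeval_X,
      ← hω] at this
    rw [hω n, mul_left_comm, this, ← mul_assoc, ← pow_add,
      show n + (n + 1) = 2 * n + 1 by ring, pow_succ, pow_mul]
    simp only [neg_one_sq, one_pow, one_mul, neg_mul, Finset.sum_neg_distrib, neg_inj]
    refine Finset.sum_bij (fun x _ => x.2) ?_ ?_ ?_ ?_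
    · rintro ⟨i, j⟩ hij
      simp only [mem_filter, HasAntidiagonal.mem_antidiagonal] at hij
      simp only [mem_Icc]; omega
    · rintro ⟨i, j⟩ hij ⟨i', j'⟩ hij' h
      simp only [mem_filter, HasAntidiagonal.mem_antidiagonal] at hij hij'
      simp only [Prod.mk.injEq] at h ⊢; omega
    · intro r hr
      rw [mem_Icc] at hr
      exact ⟨(n - r, r), by simp only [mem_filter, HasAntidiagonal.mem_antidiagonal]; omega, rfl⟩
    · rintro ⟨i, j⟩ hij
      simp only [mem_filter, HasAntidiagonal.mem_antidiagonal] at hij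
      rw [show n - j = i by omega, mul_comm]
  induction n using Nat.strong_induction_on with
  | _ n ih =>
    intro hn
    have h1 := (h n).symm.trans (newton n)
    obtain ⟨m, rfl⟩ : ∃ m, n = m + 1 := ⟨n - 1, by omega⟩
    rw [Finset.sum_Icc_succ_top (by omega), Finset.sum_Icc_succ_top (by omega),
      Nat.sub_self, h0, mul_one, mul_one] at h1
    have h2 : ∑ r ∈ Icc 1 m, S r * a (m + 1 - r)
        = ∑ r ∈ Icc 1 m, (-∑ j, ω j ^ r) * a (m + 1 - r) :=
      Finset.sum_congr rfl fun r hr => by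
        rw [mem_Icc] at hr; rw [ih r (by omega) hr.1]
    rw [h2] at h1
    exact add_left_cancel h1

/-- If the power sums of finitely many complex numbers grow at most like `R ^ m`, then all these
numbers have absolute value at most `R`. -/
theorem norm_le_of_norm_sum_pow_le {k : ℕ} (z : Fin k → ℂ) {C R : ℝ} (hR : 0 < R) {m₀ : ℕ}
    (h : ∀ m, m₀ ≤ m → ‖∑ j, z j ^ m‖ ≤ C * R ^ m) (j : Fin k) : ‖z j‖ ≤ R := by
  classical
  by_contra! hj
  -- unit directions of the `z i`
  have hdir : ∀ i, ∃ u : Circle, z i = ‖z i‖ * u := by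
    intro i
    by_cases hz : z i = 0
    · exact ⟨1, by simp [hz]⟩
    · refine ⟨⟨z i / ‖z i‖, ?_⟩, ?_⟩
      · rw [Submonoid.unitSphere, Submonoid.mem_mk]
        simp only [Subsemigroup.mem_mk, mem_sphere_zero_iff_norm]
        rw [norm_div, Complex.norm_real, norm_norm, div_self (norm_ne_zero_iff.2 hz)]
      · change z i = ‖z i‖ * (z i / ‖z i‖)
        rw [mul_div_cancel₀]
        exact_mod_cast norm_ne_zero_iff.2 hz
  choose u hu using hdir
  have hcl := mapClusterPt_one_atTop_pow (u : Fin k → Circle)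
  set V : Set (Fin k → Circle) := {v | ∀ i, (1 / 2 : ℝ) < (v i : ℂ).re} with hV
  have hVn : V ∈ nhds (1 : Fin k → Circle) := by
    refine IsOpen.mem_nhds ?_ ?_
    · rw [hV, Set.ofPred_forall]
      refine isOpen_iInter_of_finite fun i => isOpen_lt continuous_const ?_
      exact Complex.continuous_re.comp (continuous_subtype_val.comp (continuous_apply i))
    · intro i; simp; norm_num
  have hfreq : ∃ᶠ m in atTop, u ^ m ∈ V := mapClusterPt_iff_frequently.1 hcl V hVn
  have hratio : 1 < ‖z j‖ / R := (one_lt_div hR).2 hj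
  have htend := tendsto_pow_atTop_atTop_of_one_lt hratio
  have hev : ∀ᶠ m in atTop, m₀ ≤ m ∧ 2 * C < (‖z j‖ / R) ^ m :=
    (eventually_ge_atTop m₀).and (htend.eventually_gt_atTop _)
  obtain ⟨m, hmV, hm0, hmC⟩ := (hfreq.and_eventually hev).exists
  have h1 := h m hm0
  have h2 : ‖z j‖ ^ m * (1 / 2) ≤ (∑ i, z i ^ m).re := by
    rw [Complex.re_sum]
    have h3 : ∀ i, (z i ^ m).re = ‖z i‖ ^ m * ((u ^ m) i : ℂ).re := by
      intro i
      conv_lhs => rw [hu i, mul_pow, ← Complex.ofReal_pow, Complex.re_ofReal_mul]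
      simp
    calc ‖z j‖ ^ m * (1 / 2) ≤ (z j ^ m).re := by
          rw [h3]; exact mul_le_mul_of_nonneg_left (hmV j).le (by positivity)
      _ ≤ _ := Finset.single_le_sum (f := fun i => (z i ^ m).re) (fun i _ => by
          rw [h3]; exact mul_nonneg (by positivity) (by linarith [hmV i])) (mem_univ j)
  have h4 := (h2.trans (Complex.re_le_norm _)).trans h1
  rw [div_pow, lt_div_iff₀ (by positivity)] at hmC
  linarith

end PowerSums

section Minpoly

open IntermediateField

variable {F K : Type*} [Field F] [Field K] [Fintype K] [Algebra F K]

lemma finrank_adjoin_simple_eq_div (x : K) :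
    Module.finrank F⟮x⟯ K = Module.finrank F K / (minpoly F x).natDegree := by
  have hx : IsIntegral F x := IsIntegral.of_finite F x
  rw [← IntermediateField.adjoin.finrank hx, ← Module.finrank_mul_finrank F F⟮x⟯ K,
    Nat.mul_div_cancel_left _ Module.finrank_pos]

lemma norm_sub_algebraMap (x : K) (u : F) :
    Algebra.norm F (x - algebraMap F K u) = (-1) ^ Module.finrank F K *
      (minpoly F x).eval u ^ (Module.finrank F K / (minpoly F x).natDegree) := by
  set y := x - algebraMap F K u with hy
  have hy' : IsIntegral F y := IsIntegral.of_finite F y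
  have hx' : IsIntegral F x := IsIntegral.of_finite F x
  have hm : minpoly F y = (minpoly F x).comp (X + C u) := minpoly.sub_algebraMap x u
  have hd : (minpoly F y).natDegree = (minpoly F x).natDegree := by
    rw [hm, natDegree_comp, natDegree_X_add_C, mul_one]
  have h1 : Algebra.norm F (IntermediateField.AdjoinSimple.gen F y)
      = (-1) ^ (minpoly F x).natDegree * (minpoly F x).eval u := by
    have := Algebra.PowerBasis.norm_gen_eq_coeff_zero_minpoly
      (IntermediateField.adjoin.powerBasis hy')
    rw [IntermediateField.adjoin.powerBasis_gen, IntermediateField.adjoin.powerBasis_dim,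
      IntermediateField.minpoly_gen, hd] at this
    rw [this, hm, coeff_zero_eq_eval_zero, eval_comp]
    simp
  rw [Algebra.norm_eq_norm_adjoin, h1, finrank_adjoin_simple_eq_div, hd, mul_pow, ← pow_mul,
    Nat.mul_div_cancel' (minpoly.degree_dvd hx')]

lemma trace_eq_mul_nextCoeff (x : K) :
    Algebra.trace F K x = ((Module.finrank F K / (minpoly F x).natDegree : ℕ) : F) *
      -(minpoly F x).nextCoeff := by
  rw [trace_eq_finrank_mul_minpoly_nextCoeff, finrank_adjoin_simple_eq_div]

lemma sum_minpoly_eq [Finite F] (h : F[X] → ℂ) :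
    open scoped Classical in
    ∑ x : K, h (minpoly F x) = ∑ s ∈ (Module.finrank F K).divisors,
      ∑ P ∈ (monicPolys F s).filter Irreducible, s * h P := by
  classical
  have hK0 : Module.finrank F K ≠ 0 := Module.finrank_pos.ne'
  have hInt : ∀ x : K, IsIntegral F x := fun x => IsIntegral.of_finite F x
  rw [← Finset.sum_fiberwise_of_maps_to (t := (Module.finrank F K).divisors)
    (g := fun x => (minpoly F x).natDegree)
    (fun x _ => Nat.mem_divisors.2 ⟨minpoly.degree_dvd (hInt x), hK0⟩)]
  refine Finset.sum_congr rfl fun s hs => ?_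
  rw [← Finset.sum_fiberwise_of_maps_to (t := (monicPolys F s).filter Irreducible)
    (g := fun x => minpoly F x) (fun x hx => by
      rw [mem_filter, mem_monicPolys]
      exact ⟨⟨minpoly.monic (hInt x), (mem_filter.1 hx).2⟩, minpoly.irreducible (hInt x)⟩)]
  refine Finset.sum_congr rfl fun P hP => ?_
  rw [mem_filter, mem_monicPolys] at hP
  obtain ⟨⟨hPm, hPd⟩, hPi⟩ := hP
  have hset : (({x : K | (minpoly F x).natDegree = s} : Finset K).filter fun x => minpoly F x = P)
      = (P.rootSet K).toFinset := by
    ext x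
    rw [mem_filter, mem_filter, Set.mem_toFinset, mem_rootSet]
    constructor
    · rintro ⟨-, rfl⟩
      exact ⟨hPi.ne_zero, minpoly.aeval F x⟩
    · rintro ⟨-, hx⟩
      have := minpoly.eq_of_irreducible_of_monic hPi hx hPm
      exact ⟨⟨mem_univ _, this ▸ hPd⟩, this.symm⟩
  rw [Finset.sum_congr rfl fun x hx => by rw [(mem_filter.1 hx).2], sum_const, nsmul_eq_mul, hset]
  congr 1
  rw [Set.toFinset_card, card_rootSet_eq_natDegree (PerfectField.separable_of_irreducible hPi), hPd]
  have h1 : P ∣ X ^ Nat.card F ^ Module.finrank F K - X :=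
    hPi.natDegree_dvd_iff_dvd_X_pow_card_pow_sub_X.1 (hPd ▸ (Nat.mem_divisors.1 hs).1)
  have h2 : Nat.card F ^ Module.finrank F K = Fintype.card K := by
    rw [← Module.natCard_eq_pow_finrank, Nat.card_eq_fintype_card]
  rw [h2] at h1
  have h3 : (X ^ Fintype.card K - X : K[X]).Splits := by
    rw [splits_iff_card_roots, FiniteField.roots_X_pow_card_sub_X,
      FiniteField.X_pow_card_sub_X_natDegree_eq _ Fintype.one_lt_card]
    rfl
  refine h3.of_dvd (FiniteField.X_pow_card_sub_X_ne_zero _ Fintype.one_lt_card) ?_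
  simpa using map_dvd (algebraMap F K) h1

end Minpoly

section WeakWeil

variable {p : ℕ} [Fact p.Prime]

/-- The multiplicative function on monic polynomials attached to the characters `χ u` and `ψ`. -/
noncomputable def charPoly (U : Finset (ZMod p)) (χ : ZMod p → MulChar (ZMod p) ℂ)
    (ψ : AddChar (ZMod p) ℂ) (g : (ZMod p)[X]) : ℂ :=
  (∏ u ∈ U, χ u (g.eval u)) * ψ g.nextCoeff

variable (U : Finset (ZMod p)) (χ : ZMod p → MulChar (ZMod p) ℂ) (ψ : AddChar (ZMod p) ℂ)

lemma charPoly_one : charPoly U χ ψ 1 = 1 := by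
  simp [charPoly, nextCoeff]

lemma charPoly_mul {g h : (ZMod p)[X]} (hg : g.Monic) (hh : h.Monic) :
    charPoly U χ ψ (g * h) = charPoly U χ ψ g * charPoly U χ ψ h := by
  simp only [charPoly, hg.nextCoeff_mul hh, AddChar.map_add_eq_mul, eval_mul, map_mul,
    Finset.prod_mul_distrib]
  ring

variable {U χ} in
lemma lCoeff_charPoly_eq_zero (hχ : ∃ u ∈ U, χ u ≠ 1) {n : ℕ} (hn : U.card < n) :
    lCoeff (charPoly U χ ψ) n = 0 := by
  classical
  obtain ⟨u₀, hu₀, hne⟩ := hχ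
  obtain ⟨c, hc⟩ : ∃ c : (ZMod p)ˣ, χ u₀ c ≠ 1 := by
    by_contra! h
    exact hne (MulChar.ext fun c => by rw [h c, MulChar.one_apply_coe])
  set B : (ZMod p)[X] := Lagrange.basis U id u₀ with hB
  have hUpos : 0 < U.card := card_pos.2 ⟨u₀, hu₀⟩
  have hinj : Set.InjOn (id : ZMod p → ZMod p) U := Function.injective_id.injOn
  have hBd : B.natDegree = U.card - 1 := Lagrange.natDegree_basis hinj hu₀
  have hB0 : B.eval u₀ = 1 := Lagrange.eval_basis_self (v := id) hinj hu₀
  have hB1 : ∀ u ∈ U, u ≠ u₀ → B.eval u = 0 := fun u hu h =>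
    Lagrange.eval_basis_of_ne (v := id) h.symm hu
  let φ : (ZMod p)ˣ → (ZMod p)[X] → (ZMod p)[X] := fun c g => g + C ((c - 1) * g.eval u₀) * B
  have hφdeg : ∀ (c : (ZMod p)ˣ) (g : (ZMod p)[X]),
      (C ((c - 1 : ZMod p) * g.eval u₀) * B).natDegree < n - 1 :=
    fun c g => (natDegree_C_mul_le _ _).trans_lt (by omega)
  have hφmem : ∀ c : (ZMod p)ˣ, ∀ g ∈ monicPolys (ZMod p) n, φ c g ∈ monicPolys (ZMod p) n := by
    intro c g hg
    obtain ⟨h1, h2⟩ := mem_monicPolys.1 hg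
    have h3 : (C (((c : (ZMod p)ˣ) - 1 : ZMod p) * g.eval u₀) * B).natDegree < g.natDegree := by
      have := hφdeg c g; omega
    exact mem_monicPolys.2 ⟨h1.add_of_left (degree_lt_degree h3),
      (natDegree_add_eq_left_of_natDegree_lt h3).trans h2⟩
  have hφ0 : ∀ c g, (φ c g).eval u₀ = c * g.eval u₀ := fun c g => by
    simp only [φ, eval_add, eval_mul, eval_C, hB0]; ring
  have hφ1 : ∀ c g, ∀ u ∈ U, u ≠ u₀ → (φ c g).eval u = g.eval u := fun c g u hu h => by
    simp only [φ, eval_add, eval_mul, eval_C, hB1 u hu h]; ring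
  have hφφ : ∀ c d g, φ d (φ c g) = φ (d * c) g := by
    intro c d g
    change φ c g + C ((d - 1) * (φ c g).eval u₀) * B = _
    rw [hφ0]
    simp only [φ, add_assoc, ← add_mul, ← C_add]
    congr 3
    push_cast; ring
  have hφone : ∀ g, φ 1 g = g := fun g => by simp [φ]
  have hφnext : ∀ c : (ZMod p)ˣ, ∀ g ∈ monicPolys (ZMod p) n, (φ c g).nextCoeff = g.nextCoeff := by
    intro c g hg
    have h2 := (mem_monicPolys.1 hg).2
    have h3 := (mem_monicPolys.1 (hφmem c g hg)).2
    rw [nextCoeff_of_natDegree_pos (by omega), nextCoeff_of_natDegree_pos (by omega), h2, h3]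
    simp only [φ, coeff_add]
    rw [coeff_eq_zero_of_natDegree_lt (hφdeg c g), add_zero]
  have key : lCoeff (charPoly U χ ψ) n = χ u₀ c * lCoeff (charPoly U χ ψ) n := by
    conv_lhs => rw [lCoeff]
    rw [lCoeff, Finset.mul_sum]
    symm
    refine Finset.sum_bij' (fun g _ => φ c g) (fun g _ => φ c⁻¹ g) (hφmem c) (hφmem c⁻¹)
      (fun g _ => by rw [hφφ, inv_mul_cancel, hφone])
      (fun g _ => by rw [hφφ, mul_inv_cancel, hφone]) fun g hg => ?_
    simp only [charPoly, hφnext c g hg]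
    have hprod : ∏ u ∈ U.erase u₀, χ u ((φ c g).eval u) = ∏ u ∈ U.erase u₀, χ u (g.eval u) :=
      Finset.prod_congr rfl fun u hu => by
        rw [hφ1 c g u (mem_of_mem_erase hu) (ne_of_mem_erase hu)]
    rw [← Finset.mul_prod_erase _ _ hu₀, ← Finset.mul_prod_erase _ _ hu₀, hφ0, map_mul, hprod]
    ring
  have : (1 - χ u₀ c) * lCoeff (charPoly U χ ψ) n = 0 := by
    rw [sub_mul, one_mul, ← key, sub_self]
  exact (mul_eq_zero.1 this).resolve_left (sub_ne_zero.2 hc.symm)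

lemma norm_lPower_charPoly {K : Type*} [Field K] [Fintype K] [Algebra (ZMod p) K] :
    ‖lPower (charPoly U χ ψ⁻¹) (Module.finrank (ZMod p) K)‖
      = ‖∑ x : K, (∏ u ∈ U, χ u (Algebra.norm (ZMod p) (x - algebraMap (ZMod p) K u))) *
        ψ (Algebra.trace (ZMod p) K x)‖ := by
  classical
  set r := Module.finrank (ZMod p) K with hr
  have h1 : lPower (charPoly U χ ψ⁻¹) r
      = ∑ x : K, charPoly U χ ψ⁻¹ (minpoly (ZMod p) x) ^ (r / (minpoly (ZMod p) x).natDegree) := by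
    rw [sum_minpoly_eq (F := ZMod p) (K := K) fun P => charPoly U χ ψ⁻¹ P ^ (r / P.natDegree), lPower]
    refine Finset.sum_congr rfl fun s _ => Finset.sum_congr rfl fun P hP => ?_
    rw [(mem_monicPolys.1 (mem_filter.1 hP).1).2]
  set e : ℂ := ∏ u ∈ U, χ u ((-1) ^ r) with he
  have hen : ‖e‖ = 1 := by
    rw [he, norm_prod]
    refine Finset.prod_eq_one fun u _ => ?_
    have : (((-1) ^ r : (ZMod p)ˣ) : ZMod p) = (-1) ^ r := by push_cast; rfl
    rw [← this]
    exact DirichletCharacter.unit_norm_eq_one (χ u) _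
  have h2 : ∑ x : K, (∏ u ∈ U, χ u (Algebra.norm (ZMod p) (x - algebraMap (ZMod p) K u))) *
        ψ (Algebra.trace (ZMod p) K x) = e * lPower (charPoly U χ ψ⁻¹) r := by
    rw [h1, Finset.mul_sum]
    refine Finset.sum_congr rfl fun x _ => ?_
    rw [charPoly, trace_eq_mul_nextCoeff, mul_pow, ← mul_assoc, ← Finset.prod_pow, he,
      ← Finset.prod_mul_distrib]
    congr 1
    · refine Finset.prod_congr rfl fun u _ => ?_
      rw [norm_sub_algebraMap, map_mul, map_pow (χ u) (eval _ _)]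
    · rw [← nsmul_eq_mul, AddChar.map_nsmul_eq_pow, AddChar.inv_apply]
  rw [h2, norm_mul, hen, one_mul]

variable {U χ} in
/-- A weak form of Weil's bound for mixed character sums. -/
theorem norm_charSum_le (hχ : ∃ u ∈ U, χ u ≠ 1) :
    ‖∑ b : ZMod p, (∏ u ∈ U, χ u (b - u)) * ψ b‖ ≤ U.card * (p : ℝ) ^ (3 / 5 : ℝ) := by
  have hp : (0 : ℝ) < p := by exact_mod_cast (Fact.out : p.Prime).pos
  obtain ⟨ω, hω⟩ := exists_eq_neg_sum_pow (k := U.card) (a := lCoeff (charPoly U χ ψ⁻¹))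
    (S := lPower (charPoly U χ ψ⁻¹))
    (by rw [lCoeff, monicPolys_zero, sum_singleton, charPoly_one])
    (fun n hn => lCoeff_charPoly_eq_zero ψ⁻¹ hχ hn)
    (natCast_mul_lCoeff (charPoly_one U χ ψ⁻¹) fun g h hg hh => charPoly_mul U χ ψ⁻¹ hg hh)
  obtain ⟨c, m₀, hc⟩ := exists_norm_charSum_le U χ ψ hχ
  have hω5 : ∀ j, ‖ω j ^ 5‖ ≤ (p : ℝ) ^ 3 := by
    refine norm_le_of_norm_sum_pow_le (fun j => ω j ^ 5) (C := c) (by positivity)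
      (m₀ := max m₀ 1) fun m hm => ?_
    have hm1 : 1 ≤ m := (le_max_right _ _).trans hm
    let : Fintype (GaloisField p (5 * m)) := Fintype.ofFinite _
    have hcard : Fintype.card (GaloisField p (5 * m)) = p ^ (5 * m) := by
      rw [← Nat.card_eq_fintype_card, GaloisField.card _ _ (by omega)]
    have h1 := hc m ((le_max_left _ _).trans hm) (GaloisField p (5 * m)) hcard
    rw [← norm_lPower_charPoly, GaloisField.finrank p (by omega), hω _ (by omega), norm_neg] at h1
    simpa only [pow_mul] using h1
  have hω1 : ∀ j, ‖ω j‖ ≤ (p : ℝ) ^ (3 / 5 : ℝ) := by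
    intro j
    have h1 := hω5 j
    rw [norm_pow] at h1
    refine le_of_pow_le_pow_left₀ (n := 5) (by norm_num) (by positivity) (h1.trans_eq ?_)
    rw [← Real.rpow_natCast, ← Real.rpow_natCast, ← Real.rpow_mul hp.le]
    norm_num
  have h1 := norm_lPower_charPoly U χ ψ (K := ZMod p)
  simp only [Module.finrank_self, Algebra.norm_self, Algebra.trace_self, MonoidHom.id_apply,
    LinearMap.id_apply, Algebra.algebraMap_self, RingHom.id_apply] at h1
  rw [← h1, hω 1 le_rfl, norm_neg]
  refine (norm_sum_le _ _).trans ?_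
  simp only [pow_one]
  refine (Finset.sum_le_card_nsmul _ _ _ fun j _ => hω1 j).trans_eq ?_
  simp

end WeakWeil

section Completion

variable {p : ℕ} [Fact p.Prime]

lemma sum_zmod_val_eq {M : Type*} [AddCommMonoid M] (G : ℕ → M) :
    ∑ t : ZMod p, G t.val = ∑ j ∈ range p, G j := by
  refine Finset.sum_nbij' ZMod.val (fun j => (j : ZMod p)) ?_ ?_ ?_ ?_ ?_
  · exact fun t _ => mem_range.2 t.val_lt
  · exact fun j _ => mem_univ _
  · exact fun t _ => ZMod.natCast_zmod_val t
  · exact fun j hj => ZMod.val_cast_of_lt (mem_range.1 hj)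
  · exact fun _ _ => rfl

lemma norm_sum_stdAddChar_le {j : ℕ} (hj : 0 < j) (hjp : j < p) (H : ℕ) :
    ‖∑ b ∈ range H, ZMod.stdAddChar (N := p) (j * b)‖ ≤ p / 2 * (1 / j + 1 / (p - j : ℕ)) := by
  have hp : (0 : ℝ) < p := by exact_mod_cast (Fact.out : p.Prime).pos
  have hj' : (0 : ℝ) < j := by exact_mod_cast hj
  have hpj : (0 : ℝ) < (p - j : ℕ) := by exact_mod_cast Nat.sub_pos_of_lt hjp
  have hpj' : ((p - j : ℕ) : ℝ) = p - j := by rw [Nat.cast_sub hjp.le]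
  set z : ℂ := ZMod.stdAddChar (N := p) j with hz
  have hzn : ‖z‖ = 1 := AddChar.norm_apply _ _
  have h1 : ∀ b : ℕ, ZMod.stdAddChar (N := p) (j * b) = z ^ b := by
    intro b
    rw [mul_comm, ← nsmul_eq_mul, AddChar.map_nsmul_eq_pow]
  simp only [h1]
  have hsin : (2 : ℝ) * min (j / p : ℝ) ((p - j : ℕ) / p) ≤ Real.sin (Real.pi * j / p) := by
    have hle : (j : ℝ) ≤ p := by exact_mod_cast hjp.le
    rcases le_total (j / p : ℝ) (1 / 2) with h | h
    · have := Real.mul_le_sin (x := Real.pi * j / p) (by positivity)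
        (by rw [mul_div_assoc]; nlinarith [Real.pi_pos])
      refine le_trans ?_ this
      have h2 : 2 / Real.pi * (Real.pi * j / p) = 2 * (j / p) := by
        field_simp
      rw [h2]
      gcongr
      exact min_le_left _ _
    · have h3 : Real.pi * j / p = Real.pi - Real.pi * ((p - j : ℕ) / p) := by
        rw [hpj']; field_simp; ring
      have h4 : ((p - j : ℕ) / p : ℝ) ≤ 1 / 2 := by
        rw [hpj', sub_div, div_self hp.ne']; linarith
      have := Real.mul_le_sin (x := Real.pi * ((p - j : ℕ) / p)) (by positivity)
        (by nlinarith [Real.pi_pos])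
      rw [h3, Real.sin_pi_sub]
      refine le_trans ?_ this
      have h2 : 2 / Real.pi * (Real.pi * ((p - j : ℕ) / p)) = 2 * ((p - j : ℕ) / p) := by
        field_simp
      rw [h2]
      gcongr
      exact min_le_right _ _
  have hmin : 0 < min (j / p : ℝ) ((p - j : ℕ) / p) := lt_min (by positivity) (by positivity)
  have hz1 : ‖z - 1‖ = 2 * Real.sin (Real.pi * j / p) := by
    have : z = Complex.exp (Complex.I * ((2 * Real.pi * j / p : ℝ) : ℂ)) := by
      have := ZMod.stdAddChar_coe (N := p) j
      rw [Int.cast_natCast] at this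
      rw [hz, this]
      push_cast
      congr 1
      ring
    rw [this, Complex.norm_exp_I_mul_ofReal_sub_one, Real.norm_eq_abs, abs_of_pos]
    · congr 2; ring
    · rw [show 2 * Real.pi * j / p / 2 = Real.pi * j / p by ring]
      linarith
  have hne : z ≠ 1 := by
    intro h
    rw [h, sub_self, norm_zero] at hz1
    linarith
  rw [geom_sum_eq hne, norm_div, hz1]
  have h2 : ‖z ^ H - 1‖ ≤ 2 := by
    refine (norm_sub_le _ _).trans ?_
    rw [norm_pow, hzn]; norm_num
  calc ‖z ^ H - 1‖ / (2 * Real.sin (Real.pi * j / p))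
      ≤ 2 / (2 * (2 * min (j / p : ℝ) ((p - j : ℕ) / p))) := by gcongr
    _ = 1 / 2 * (min (j / p : ℝ) ((p - j : ℕ) / p))⁻¹ := by field_simp
    _ ≤ 1 / 2 * (p / j + p / (p - j : ℕ)) := by
      gcongr
      rcases min_choice (j / p : ℝ) ((p - j : ℕ) / p) with h | h <;> rw [h, inv_div]
      · exact le_add_of_nonneg_right (by positivity)
      · exact le_add_of_nonneg_left (by positivity)
    _ = _ := by ring

/-- The completion method: an incomplete sum is controlled by the complete twisted sums. -/
theorem norm_sum_range_le {f : ZMod p → ℂ} {B : ℝ}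
    (hB : ∀ ψ : AddChar (ZMod p) ℂ, ‖∑ x, f x * ψ x‖ ≤ B) {H : ℕ} (hH : H ≤ p) :
    ‖∑ b ∈ range H, f b‖ ≤ B * (2 + Real.log p) := by
  have hp : (0 : ℝ) < p := by exact_mod_cast (Fact.out : p.Prime).pos
  have hp0 : (p : ℂ) ≠ 0 := by exact_mod_cast hp.ne'
  have hB0 : 0 ≤ B := (norm_nonneg _).trans (hB 1)
  have h1 : (p : ℂ) * ∑ b ∈ range H, f b = ∑ t : ZMod p,
      (∑ b ∈ range H, ZMod.stdAddChar (N := p) (t.val * b)) *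
        ∑ x, f x * AddChar.mulShift (ZMod.stdAddChar (N := p)) (-t) x := by
    have h2 : ∀ b : ℕ, (p : ℂ) * f b = ∑ t : ZMod p, ∑ x, ZMod.stdAddChar (N := p) (t.val * b) *
        (f x * AddChar.mulShift (ZMod.stdAddChar (N := p)) (-t) x) := by
      intro b
      rw [Finset.sum_comm]
      have h3 : ∀ x : ZMod p, ∑ t : ZMod p, ZMod.stdAddChar (N := p) (t.val * b) *
          (f x * AddChar.mulShift (ZMod.stdAddChar (N := p)) (-t) x)
          = if x = b then p * f b else 0 := by
        intro x
        have h4 : ∀ t : ZMod p, ZMod.stdAddChar (N := p) (t.val * b) *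
            (f x * AddChar.mulShift (ZMod.stdAddChar (N := p)) (-t) x)
            = f x * ZMod.stdAddChar (N := p) (t * (b - x)) := by
          intro t
          rw [ZMod.natCast_zmod_val, AddChar.mulShift_apply, mul_left_comm, ← AddChar.map_add_eq_mul]
          congr 2
          ring
        simp only [h4, ← Finset.mul_sum]
        rw [AddChar.sum_mulShift _ (ZMod.isPrimitive_stdAddChar p), ZMod.card]
        by_cases hx : x = b
        · rw [if_pos (by rw [hx, sub_self]), if_pos hx, hx, mul_comm]
        · rw [if_neg (sub_ne_zero.2 (Ne.symm hx)), if_neg hx]; simp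
      simp only [h3]
      simp
    rw [Finset.mul_sum, Finset.sum_congr rfl fun b _ => h2 b, Finset.sum_comm]
    refine Finset.sum_congr rfl fun t _ => ?_
    rw [Finset.sum_mul]
    refine Finset.sum_congr rfl fun b _ => ?_
    rw [Finset.mul_sum]
  have h5 : ∑ t : ZMod p, ‖∑ b ∈ range H, ZMod.stdAddChar (N := p) (t.val * b)‖
      ≤ p * (2 + Real.log p) := by
    rw [sum_zmod_val_eq fun j => ‖∑ b ∈ range H, ZMod.stdAddChar (N := p) (j * b)‖]
    obtain ⟨q, hq⟩ : ∃ q, p = q + 1 := ⟨p - 1, by have := (Fact.out : p.Prime).pos; omega⟩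
    have h6 : ∀ j ∈ range q, ‖∑ b ∈ range H, ZMod.stdAddChar (N := p) (((j + 1 : ℕ) : ZMod p) * b)‖
        ≤ p / 2 * (1 / (j + 1 : ℕ) + 1 / ((q - 1 - j : ℕ) + 1 : ℕ)) := by
      intro j hj
      rw [mem_range] at hj
      refine (norm_sum_stdAddChar_le (p := p) (by omega) (by omega) H).trans_eq ?_
      rw [show p - (j + 1) = q - 1 - j + 1 by omega]
    have h7 : ∑ j ∈ range p, ‖∑ b ∈ range H, ZMod.stdAddChar (N := p) (j * b)‖
        = ∑ j ∈ range q, ‖∑ b ∈ range H, ZMod.stdAddChar (N := p) (((j + 1 : ℕ) : ZMod p) * b)‖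
          + ‖∑ b ∈ range H, ZMod.stdAddChar (N := p) (((0 : ℕ) : ZMod p) * b)‖ := by
      rw [← Finset.sum_range_succ' fun j => ‖∑ b ∈ range H, ZMod.stdAddChar (N := p) (j * b)‖, ← hq]
    rw [h7]
    have h8 : ‖∑ b ∈ range H, ZMod.stdAddChar (N := p) (((0 : ℕ) : ZMod p) * b)‖ ≤ p := by
      simpa using hH
    have h9 : ∑ j ∈ range q, (1 / (j + 1 : ℕ) : ℝ) ≤ 1 + Real.log p := by
      have h10 := harmonic_le_one_add_log q
      have h11 : ((harmonic q : ℚ) : ℝ) = ∑ j ∈ range q, (1 / (j + 1 : ℕ) : ℝ) := by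
        simp [harmonic]
      rw [h11] at h10
      refine h10.trans ?_
      rcases Nat.eq_zero_or_pos q with rfl | hq0
      · simp only [CharP.cast_eq_zero, Real.log_zero, add_zero, hq]; simp
      · gcongr
        omega
    have h12 := Finset.sum_le_sum h6
    rw [← Finset.mul_sum, Finset.sum_add_distrib,
      Finset.sum_range_reflect (fun j => (1 / (j + 1 : ℕ) : ℝ)) q] at h12
    calc _ ≤ p / 2 * (1 + Real.log p + (1 + Real.log p)) + p :=
          add_le_add (h12.trans (by gcongr)) h8
      _ = _ := by ring
  have h13 : (p : ℝ) * ‖∑ b ∈ range H, f b‖ ≤ p * (B * (2 + Real.log p)) := by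
    calc (p : ℝ) * ‖∑ b ∈ range H, f b‖ = ‖(p : ℂ) * ∑ b ∈ range H, f b‖ := by
          rw [norm_mul, Complex.norm_natCast]
      _ ≤ ∑ t : ZMod p, ‖∑ b ∈ range H, ZMod.stdAddChar (N := p) (t.val * b)‖ * B := by
          rw [h1]
          refine (norm_sum_le _ _).trans (Finset.sum_le_sum fun t _ => ?_)
          rw [norm_mul]
          gcongr
          exact hB _
      _ ≤ p * (2 + Real.log p) * B := by rw [← Finset.sum_mul]; gcongr
      _ = _ := by ring
  exact le_of_mul_le_mul_left h13 hp

theorem norm_sum_range_prod_le {U : Finset (ZMod p)} {χ : ZMod p → MulChar (ZMod p) ℂ}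
    (hχ : ∃ u ∈ U, χ u ≠ 1) {H : ℕ} (hH : H ≤ p) :
    ‖∑ b ∈ range H, ∏ u ∈ U, χ u (b - u)‖ ≤ 17 * U.card * (p : ℝ) ^ (2 / 3 : ℝ) := by
  have hp1 : (1 : ℝ) ≤ p := by exact_mod_cast (Fact.out : p.Prime).one_lt.le
  have hp : (0 : ℝ) < p := by linarith
  refine (norm_sum_range_le (f := fun b => ∏ u ∈ U, χ u (b - u))
    (fun ψ => norm_charSum_le ψ hχ) hH).trans ?_
  have h1 : 2 + Real.log p ≤ 17 * (p : ℝ) ^ (1 / 15 : ℝ) := by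
    have h2 := Real.log_le_rpow_div hp.le (ε := 1 / 15) (by norm_num)
    have h3 : (1 : ℝ) ≤ (p : ℝ) ^ (1 / 15 : ℝ) := Real.one_le_rpow hp1 (by norm_num)
    linarith
  calc _ ≤ U.card * (p : ℝ) ^ (3 / 5 : ℝ) * (17 * (p : ℝ) ^ (1 / 15 : ℝ)) := by gcongr
    _ = 17 * U.card * ((p : ℝ) ^ (3 / 5 : ℝ) * (p : ℝ) ^ (1 / 15 : ℝ)) := by ring
    _ = _ := by rw [← Real.rpow_add hp]; norm_num

end Completion

section TruncatedLogarithm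

/-- The truncated logarithm `∑ X ^ j / j`, `1 ≤ j ≤ p - 1`, over `ZMod p`. -/
noncomputable def truncLog (p : ℕ) : (ZMod p)[X] :=
  ∑ j ∈ range (p - 1), C ((j + 1 : ZMod p)⁻¹) * X ^ (j + 1)

lemma natDegree_truncLog_le {p : ℕ} : (truncLog p).natDegree ≤ p - 1 := by
  refine natDegree_sum_le_of_forall_le _ _ fun j hj => (natDegree_C_mul_X_pow_le _ _).trans ?_
  rw [mem_range] at hj
  omega

variable {p : ℕ} [Fact p.Prime]

lemma natCast_ne_zero_of_lt {n : ℕ} (h0 : 0 < n) (hn : n < p) : (n : ZMod p) ≠ 0 := by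
  rw [Ne, ZMod.natCast_eq_zero_iff]
  exact Nat.not_dvd_of_pos_of_lt h0 hn

lemma natCast_inj_of_lt {m n : ℕ} (hm : m < p) (hn : n < p) (h : (m : ZMod p) = n) : m = n := by
  rw [← ZMod.val_cast_of_lt hm, h, ZMod.val_cast_of_lt hn]

lemma derivative_truncLog : derivative (truncLog p) = ∑ j ∈ range (p - 1), X ^ j := by
  rw [truncLog, derivative_sum]
  refine Finset.sum_congr rfl fun j hj => ?_
  rw [mem_range] at hj
  have : ((j + 1 : ℕ) : ZMod p) ≠ 0 := natCast_ne_zero_of_lt (by omega) (by omega)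
  rw [derivative_C_mul_X_pow, Nat.add_sub_cancel, Nat.cast_add, Nat.cast_one, inv_mul_cancel₀,
    C_1, one_mul]
  exact_mod_cast this

lemma one_sub_X_mul_derivative_truncLog :
    (1 - X) * derivative (truncLog p) = 1 - X ^ (p - 1) := by
  rw [derivative_truncLog, mul_neg_geom_sum]

lemma one_sub_X_mul_derivative_pow (a : ℕ) :
    (1 - X) * derivative ((1 - X : (ZMod p)[X]) ^ a) = -C (a : ZMod p) * (1 - X) ^ a := by
  cases a with
  | zero => simp
  | succ a =>
    rw [derivative_pow_succ, derivative_sub, derivative_one, derivative_X]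
    simp only [pow_succ, map_natCast, Nat.cast_add, Nat.cast_one, map_add, map_one]
    ring

theorem eq_zero_of_X_pow_dvd_sum {A : ℕ} (hA : A ≤ p) {n : ℕ → ℕ} {f : ℕ → (ZMod p)[X]}
    (hf : ∀ a < A, ∀ m, n a ≤ m → (f a).coeff m = 0) (hn : ∑ a ∈ range A, n a ≤ p)
    (hdvd : X ^ (∑ a ∈ range A, n a) ∣ ∑ a ∈ range A, (1 - X) ^ a * (f a).comp (truncLog p)) :
    ∀ a < A, f a = 0 := by
  induction hw : ∑ a ∈ range A, n a generalizing n f with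
  | zero =>
    intro a ha
    rw [Finset.sum_eq_zero_iff] at hw
    ext m
    rw [hf a ha m (by rw [hw a (mem_range.2 ha)]; exact Nat.zero_le _), coeff_zero]
  | succ w ih =>
    obtain ⟨a₀, ha₀, hna₀⟩ : ∃ a₀ < A, 0 < n a₀ := by
      by_contra! h
      rw [Finset.sum_eq_zero fun a ha => Nat.le_zero.1 (h a (mem_range.1 ha))] at hw
      omega
    rw [hw] at hn hdvd
    set G := ∑ a ∈ range A, (1 - X) ^ a * (f a).comp (truncLog p) with hG
    set f' : ℕ → (ZMod p)[X] := fun a => derivative (f a) + C ((a₀ : ZMod p) - a) * f a with hf'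
    have hGd : (1 - X) * derivative G + C (a₀ : ZMod p) * G
        = (∑ a ∈ range A, (1 - X) ^ a * (f' a).comp (truncLog p))
          - X ^ (p - 1) * ∑ a ∈ range A, (1 - X) ^ a * (derivative (f a)).comp (truncLog p) := by
      rw [hG, derivative_sum, Finset.mul_sum, Finset.mul_sum, Finset.mul_sum,
        ← Finset.sum_add_distrib, ← Finset.sum_sub_distrib]
      refine Finset.sum_congr rfl fun a _ => ?_
      rw [derivative_mul, derivative_comp, mul_add, ← mul_assoc (1 - X),
        one_sub_X_mul_derivative_pow]
      simp only [hf', add_comp, mul_comp, C_comp]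
      rw [C_sub]
      linear_combination ((1 - X) ^ a * (derivative (f a)).comp (truncLog p)) *
        one_sub_X_mul_derivative_truncLog (p := p)
    have hdvd' : X ^ w ∣ ∑ a ∈ range A, (1 - X) ^ a * (f' a).comp (truncLog p) := by
      rw [sub_eq_iff_eq_add.1 hGd.symm]
      refine dvd_add (dvd_add (Dvd.dvd.mul_left ?_ _) (Dvd.dvd.mul_left ?_ _))
        (Dvd.dvd.mul_right (pow_dvd_pow _ (by omega)) _)
      · simpa using pow_sub_one_dvd_derivative_of_pow_dvd hdvd
      · exact (pow_dvd_pow _ w.le_succ).trans hdvd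
    set n' := Function.update n a₀ (n a₀ - 1) with hn'
    have hw' : ∑ a ∈ range A, n' a = w := by
      have h1 := Finset.add_sum_erase _ n (mem_range.2 ha₀)
      have h2 := Finset.add_sum_erase _ n' (mem_range.2 ha₀)
      have h3 : ∑ a ∈ (range A).erase a₀, n' a = ∑ a ∈ (range A).erase a₀, n a :=
        Finset.sum_congr rfl fun a ha => Function.update_of_ne (ne_of_mem_erase ha) _ _
      have h4 : n' a₀ = n a₀ - 1 := Function.update_self ..
      omega
    have hf'0 : ∀ a < A, f' a = 0 := by
      refine ih (n := n') ?_ (by omega) (by rwa [hw']) hw'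
      intro a ha m hm
      rw [hf', coeff_add, coeff_derivative, coeff_C_mul]
      rcases eq_or_ne a a₀ with rfl | hne
      · rw [hn', Function.update_self] at hm
        rw [hf a ha (m + 1) (by omega), sub_self]
        ring
      · rw [hn', Function.update_of_ne hne] at hm
        rw [hf a ha (m + 1) (by omega), hf a ha m hm]
        ring
    have hfa : ∀ a < A, a ≠ a₀ → f a = 0 := by
      intro a ha hne
      have h1 := congrArg (fun g => g.coeff (f a).natDegree) (hf'0 a ha)
      simp only [hf', coeff_add, coeff_derivative, coeff_C_mul, coeff_zero] at h1
      rw [coeff_eq_zero_of_natDegree_lt (Nat.lt_succ_self _), zero_mul, zero_add] at h1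
      refine leadingCoeff_eq_zero.1 ((mul_eq_zero.1 h1).resolve_left fun h => hne ?_)
      exact (natCast_inj_of_lt (by omega) (by omega) (sub_eq_zero.1 h)).symm
    have hnp : n a₀ ≤ p := by
      have := Finset.single_le_sum (f := n) (fun _ _ => Nat.zero_le _) (mem_range.2 ha₀)
      omega
    have hfa₀ : f a₀ = C ((f a₀).coeff 0) := by
      ext m
      rw [coeff_C]
      split_ifs with hm
      · rw [hm]
      · obtain ⟨m, rfl⟩ := Nat.exists_eq_succ_of_ne_zero hm
        by_cases hmn : m + 1 < n a₀
        · have h1 := congrArg (fun g => g.coeff m) (hf'0 a₀ ha₀)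
          simp only [hf', coeff_add, coeff_derivative, coeff_C_mul, coeff_zero, sub_self, zero_mul,
            add_zero] at h1
          refine (mul_eq_zero.1 h1).resolve_right ?_
          exact_mod_cast natCast_ne_zero_of_lt (p := p) (n := m + 1) (by omega) (by omega)
        · exact hf a₀ ha₀ _ (by omega)
    have hc : (f a₀).coeff 0 = 0 := by
      have h1 : G = (1 - X) ^ a₀ * C ((f a₀).coeff 0) := by
        rw [hG, Finset.sum_eq_single_of_mem a₀ (mem_range.2 ha₀), hfa₀, C_comp, coeff_C_zero]
        intro a ha hne
        rw [hfa a (mem_range.1 ha) hne, zero_comp, mul_zero]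
      have h2 : X ∣ G := (dvd_pow_self _ w.succ_ne_zero).trans hdvd
      rw [X_dvd_iff, coeff_zero_eq_eval_zero, h1] at h2
      simpa using h2
    intro a ha
    rcases eq_or_ne a a₀ with rfl | hne
    · rw [hfa₀, hc, C_0]
    · exact hfa a ha hne

end TruncatedLogarithm

section TruncatedLogarithm

/-- The polynomials in `X`, `truncLog p` and `X ^ p` of degree at most `e` in `X` and `X ^ p`. -/
noncomputable def truncLogSpan (p e : ℕ) : Submodule (ZMod p) (ZMod p)[X] :=
  Submodule.span (ZMod p) {g | ∃ (q : (ZMod p)[X]) (j k : ℕ), q.natDegree + k ≤ e ∧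
    g = q * truncLog p ^ j * X ^ (p * k)}

variable {p : ℕ} [Fact p.Prime]

lemma truncLogSpan_mul_mem {e : ℕ} {q : (ZMod p)[X]} {j k : ℕ} (h : q.natDegree + k ≤ e) :
    q * truncLog p ^ j * X ^ (p * k) ∈ truncLogSpan p e :=
  Submodule.subset_span ⟨q, j, k, h, rfl⟩

lemma natDegree_one_sub_X : (1 - X : (ZMod p)[X]).natDegree = 1 := by
  rw [← natDegree_neg, neg_sub]
  simpa using natDegree_X_sub_C (1 : ZMod p)

lemma mul_mem_truncLogSpan {e d : ℕ} {f h : (ZMod p)[X]} (hf : f ∈ truncLogSpan p e)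
    (hh : h.natDegree ≤ d) : h * f ∈ truncLogSpan p (e + d) := by
  induction hf using Submodule.span_induction with
  | mem g hg =>
    obtain ⟨q, j, k, hq, rfl⟩ := hg
    rw [← mul_assoc, ← mul_assoc]
    refine truncLogSpan_mul_mem ?_
    have := natDegree_mul_le (p := h) (q := q)
    omega
  | zero => rw [mul_zero]; exact Submodule.zero_mem _
  | add f g _ _ hf hg => rw [mul_add]; exact Submodule.add_mem _ hf hg
  | smul c f _ hf => rw [mul_smul_comm]; exact Submodule.smul_mem _ c hf

lemma mul_derivative_mem_truncLogSpan {e : ℕ} {f : (ZMod p)[X]} (hf : f ∈ truncLogSpan p e) :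
    X * (1 - X) * derivative f ∈ truncLogSpan p (e + 1) := by
  have hp := (Fact.out : p.Prime).pos
  induction hf using Submodule.span_induction with
  | mem g hg =>
    obtain ⟨q, j, k, hq, rfl⟩ := hg
    have h1 : derivative (X ^ (p * k) : (ZMod p)[X]) = 0 := by
      rw [derivative_X_pow]; simp
    have h2 : X * ((1 - X) * derivative (truncLog p)) = X - X ^ p := by
      rw [one_sub_X_mul_derivative_truncLog, mul_sub, mul_one, ← pow_succ', Nat.sub_add_cancel hp]
    have h3 : X * (1 - X) * derivative (q * truncLog p ^ j * X ^ (p * k))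
        = (X * (1 - X) * derivative q) * truncLog p ^ j * X ^ (p * k)
          + ((C (j : ZMod p) * q * X) * truncLog p ^ (j - 1) * X ^ (p * k)
            - (C (j : ZMod p) * q) * truncLog p ^ (j - 1) * X ^ (p * (k + 1))) := by
      rw [derivative_mul, h1, derivative_mul, derivative_pow, mul_add p, pow_add, mul_one]
      linear_combination C (j : ZMod p) * q * truncLog p ^ (j - 1) * X ^ (p * k) * h2
    rw [h3]
    refine Submodule.add_mem _ (truncLogSpan_mul_mem ?_) (Submodule.sub_mem _
      (truncLogSpan_mul_mem ?_) (truncLogSpan_mul_mem ?_))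
    · rcases Nat.eq_zero_or_pos q.natDegree with h0 | h0
      · rw [derivative_of_natDegree_zero h0, mul_zero, natDegree_zero]; omega
      · have h4 := natDegree_derivative_le q
        have h5 := natDegree_mul_le (p := X * (1 - X)) (q := derivative q)
        have h6 := natDegree_mul_le (p := X) (q := (1 - X : (ZMod p)[X]))
        rw [natDegree_one_sub_X, natDegree_X] at h6
        omega
    · have h4 := natDegree_mul_le (p := C (j : ZMod p) * q) (q := X)
      have h5 := natDegree_C_mul_le (j : ZMod p) q
      rw [natDegree_X] at h4
      omega
    · have h5 := natDegree_C_mul_le (j : ZMod p) q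
      omega
  | zero => rw [derivative_zero, mul_zero]; exact Submodule.zero_mem _
  | add f g _ _ hf hg => rw [derivative_add, mul_add]; exact Submodule.add_mem _ hf hg
  | smul c f _ hf => rw [derivative_smul, mul_smul_comm]; exact Submodule.smul_mem _ c hf

lemma pow_mul_iterate_derivative_mem_truncLogSpan {e : ℕ} {f : (ZMod p)[X]}
    (hf : f ∈ truncLogSpan p e) (n : ℕ) :
    (X * (1 - X)) ^ n * derivative^[n] f ∈ truncLogSpan p (e + n) := by
  induction n with
  | zero => simpa using hf
  | succ n ih =>
    have h1 : (X * (1 - X)) ^ (n + 1) * derivative^[n + 1] f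
        = X * (1 - X) * derivative ((X * (1 - X)) ^ n * derivative^[n] f)
          - (C (n : ZMod p) * (1 - C 2 * X)) * ((X * (1 - X)) ^ n * derivative^[n] f) := by
      rw [Function.iterate_succ_apply', derivative_mul, derivative_pow]
      cases n with
      | zero => simp
      | succ n =>
        simp only [derivative_mul, derivative_X, derivative_sub, derivative_one,
          Nat.add_sub_cancel, pow_succ]
        simp only [map_ofNat]
        ring
    rw [h1, ← add_assoc]
    refine Submodule.sub_mem _ (mul_derivative_mem_truncLogSpan ih) (mul_mem_truncLogSpan ih ?_)
    refine (natDegree_C_mul_le _ _).trans ?_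
    refine (natDegree_sub_le _ _).trans ?_
    rw [natDegree_one]
    exact max_le (by omega) ((natDegree_C_mul_le 2 X).trans natDegree_X_le)

/-- Evaluation at the points of a finite set. -/
noncomputable def evalOn (S : Finset (ZMod p)) : (ZMod p)[X] →ₗ[ZMod p] S → ZMod p :=
  LinearMap.pi fun x => leval (x : ZMod p)

@[simp] lemma evalOn_apply (S : Finset (ZMod p)) (f : (ZMod p)[X]) (x : S) :
    evalOn S f x = f.eval (x : ZMod p) := rfl

lemma evalOn_mem_of_mem_truncLogSpan {S : Finset (ZMod p)} {r : ZMod p}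
    (hS : ∀ x ∈ S, (truncLog p).eval x = r) {e : ℕ} {f : (ZMod p)[X]}
    (hf : f ∈ truncLogSpan p e) :
    evalOn S f ∈ (degreeLT (ZMod p) (e + 1)).map (evalOn S) := by
  have : truncLogSpan p e ≤ ((degreeLT (ZMod p) (e + 1)).map (evalOn S)).comap (evalOn S) := by
    refine Submodule.span_le.2 ?_
    rintro _ ⟨q, j, k, hq, rfl⟩
    refine ⟨C (r ^ j) * q * X ^ k, ?_, ?_⟩
    · refine mem_degreeLT.2 (degree_le_natDegree.trans_lt ?_)
      have h1 := natDegree_mul_le (p := C (r ^ j) * q) (q := X ^ k)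
      have h2 := natDegree_C_mul_le (r ^ j) q
      rw [natDegree_X_pow] at h1
      exact_mod_cast (by omega : (C (r ^ j) * q * X ^ k).natDegree < e + 1)
    · ext x
      simp only [evalOn_apply, eval_mul, eval_pow, eval_C, eval_X, hS x x.2, pow_mul, ZMod.pow_card]
      ring
  exact this hf

lemma finrank_map_evalOn_le (S : Finset (ZMod p)) (n : ℕ) :
    Module.finrank (ZMod p) ((degreeLT (ZMod p) n).map (evalOn S)) ≤ n := by
  have : Module.Finite (ZMod p) (degreeLT (ZMod p) n) :=
    Module.Finite.equiv (degreeLTEquiv (ZMod p) n).symm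
  refine (Submodule.finrank_map_le _ _).trans ?_
  rw [(degreeLTEquiv (ZMod p) n).finrank_eq]
  simp

lemma eq_zero_of_sum_X_pow_mul_eq_zero {n C : ℕ} {G : ℕ → (ZMod p)[X]}
    (h : ∑ c ∈ range C, X ^ (n * c) * G c = 0) (hG : ∀ c < C, X ^ n ∣ G c → G c = 0) :
    ∀ c < C, G c = 0 := by
  induction C generalizing G with
  | zero => intro c hc; omega
  | succ C ih =>
    rw [Finset.sum_range_succ'] at h
    have h1 : ∑ c ∈ range C, X ^ (n * (c + 1)) * G (c + 1)
        = X ^ n * ∑ c ∈ range C, X ^ (n * c) * G (c + 1) := by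
      rw [Finset.mul_sum]
      refine Finset.sum_congr rfl fun c _ => ?_
      ring
    rw [h1, mul_zero, pow_zero, one_mul] at h
    have h0 : G 0 = 0 := hG 0 (by omega) ⟨-∑ c ∈ range C, X ^ (n * c) * G (c + 1), by
      linear_combination h⟩
    rw [h0, add_zero] at h
    have h2 := (mul_eq_zero.1 h).resolve_left (pow_ne_zero _ X_ne_zero)
    intro c hc
    cases c with
    | zero => exact h0
    | succ c => exact ih h2 (fun c hc => hG (c + 1) (by omega)) c (by omega)

lemma eq_zero_of_sum_truncLog_eq_zero {A B C : ℕ} (hA : A ≤ p) (hAB : A * B ≤ p)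
    {μ : ℕ → ℕ → ℕ → ZMod p}
    (h : ∑ a ∈ range A, ∑ b ∈ range B, ∑ c ∈ range C,
      μ a b c • ((1 - X) ^ a * truncLog p ^ b * X ^ (p * c)) = 0) :
    ∀ a < A, ∀ b < B, ∀ c < C, μ a b c = 0 := by
  set f : ℕ → ℕ → (ZMod p)[X] := fun c a => ∑ b ∈ range B, Polynomial.C (μ a b c) * X ^ b with hf
  set G : ℕ → (ZMod p)[X] := fun c => ∑ a ∈ range A, (1 - X) ^ a * (f c a).comp (truncLog p) with hG
  have hsum : ∑ c ∈ range C, X ^ (p * c) * G c = 0 := by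
    have h1 : ∀ c, X ^ (p * c) * G c = ∑ a ∈ range A, ∑ b ∈ range B,
        μ a b c • ((1 - X) ^ a * truncLog p ^ b * X ^ (p * c)) := by
      intro c
      simp only [hG, hf, Finset.mul_sum, Polynomial.sum_comp, mul_comp, C_comp, X_comp, pow_comp,
        smul_eq_C_mul]
      refine Finset.sum_congr rfl fun a _ => Finset.sum_congr rfl fun b _ => ?_
      ring
    rw [Finset.sum_congr rfl fun c _ => h1 c, Finset.sum_comm, ← h]
    exact Finset.sum_congr rfl fun a _ => Finset.sum_comm
  have hfz : ∀ c, X ^ p ∣ G c → ∀ a < A, f c a = 0 := by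
    intro c hc
    refine eq_zero_of_X_pow_dvd_sum hA (n := fun _ => B) (fun a ha m hm => ?_) ?_ ?_
    · simp only [hf, finsetSum_coeff, coeff_C_mul, coeff_X_pow]
      refine Finset.sum_eq_zero fun b hb => ?_
      rw [mem_range] at hb
      rw [if_neg (by omega), mul_zero]
    · simpa using hAB
    · refine (pow_dvd_pow _ ?_).trans hc
      simpa using hAB
  have hGz := eq_zero_of_sum_X_pow_mul_eq_zero hsum fun c _ hc =>
    Finset.sum_eq_zero fun a ha => by rw [hfz c hc a (mem_range.1 ha), zero_comp, mul_zero]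
  intro a ha b hb c hc
  have h1 := hfz c (by rw [hGz c hc]; exact dvd_zero _) a ha
  have h2 := congrArg (fun g => g.coeff b) h1
  simp only [hf, finsetSum_coeff, coeff_C_mul, coeff_X_pow, mul_ite, mul_one, mul_zero,
    coeff_zero] at h2
  rwa [Finset.sum_ite_eq, if_pos (mem_range.2 hb)] at h2

theorem card_mul_le_of_truncLog {A B C D : ℕ} (hA : A ≤ p) (hAB : A * B ≤ p) (hD : D ≤ p)
    (hcount : D * (A + C + D) < A * B * C) {S : Finset (ZMod p)} {r : ZMod p}
    (hS : ∀ x ∈ S, (truncLog p).eval x = r) (hS0 : ∀ x ∈ S, x ≠ 0 ∧ x ≠ 1) :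
    S.card * D ≤ p * (B + C) := by
  classical
  set v : Fin A × Fin B × Fin C → (ZMod p)[X] := fun i =>
    (1 - X) ^ (i.1 : ℕ) * truncLog p ^ (i.2.1 : ℕ) * X ^ (p * (i.2.2 : ℕ)) with hv
  have hvmem : ∀ i, v i ∈ truncLogSpan p (A + C - 2) := by
    rintro ⟨a, b, c⟩
    refine truncLogSpan_mul_mem ?_
    have h1 := natDegree_pow_le (p := (1 - X : (ZMod p)[X])) (n := a)
    rw [natDegree_one_sub_X, mul_one] at h1
    have := a.2
    have := c.2
    dsimp only
    omega
  let E : ℕ → Submodule (ZMod p) (S → ZMod p) := fun n =>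
    (degreeLT (ZMod p) (A + C - 2 + n + 1)).map (evalOn S)
  let w : Fin A × Fin B × Fin C → (n : Fin D) → E n := fun i n =>
    ⟨evalOn S ((X * (1 - X)) ^ (n : ℕ) * derivative^[n] (v i)),
      evalOn_mem_of_mem_truncLogSpan hS
        (pow_mul_iterate_derivative_mem_truncLogSpan (hvmem i) n)⟩
  have hdep : ¬LinearIndependent (ZMod p) w := by
    intro hli
    have h1 := hli.fintype_card_le_finrank
    rw [Module.finrank_pi_fintype, Fintype.card_prod, Fintype.card_prod, Fintype.card_fin,
      Fintype.card_fin, Fintype.card_fin] at h1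
    have hAC : 0 < A ∧ 0 < C := by
      constructor <;> refine Nat.pos_of_ne_zero fun h => ?_ <;> simp [h] at hcount
    have h2 : ∀ n ∈ (univ : Finset (Fin D)), Module.finrank (ZMod p) (E n) ≤ A + C + D := by
      intro n _
      refine (finrank_map_evalOn_le S _).trans ?_
      have := n.2
      omega
    have h3 := Finset.sum_le_card_nsmul _ _ _ h2
    rw [card_univ, Fintype.card_fin, smul_eq_mul] at h3
    have := (h1.trans h3).trans_lt hcount
    rw [← mul_assoc] at this
    exact lt_irrefl _ this
  obtain ⟨g, hg, i₀, hi₀⟩ := Fintype.not_linearIndependent_iff.1 hdep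
  set Ψ : (ZMod p)[X] := ∑ i, g i • v i with hΨ
  have hΨ0 : Ψ ≠ 0 := by
    intro h0
    let μ : ℕ → ℕ → ℕ → ZMod p := fun a b c =>
      if h : a < A ∧ b < B ∧ c < C then g (⟨a, h.1⟩, ⟨b, h.2.1⟩, ⟨c, h.2.2⟩) else 0
    have hμ : ∀ (a : Fin A) (b : Fin B) (c : Fin C), g (a, b, c) = μ a b c := fun a b c => by
      simp [μ]
    refine hi₀ ?_
    obtain ⟨a, b, c⟩ := i₀
    rw [hμ]
    refine eq_zero_of_sum_truncLog_eq_zero hA hAB (μ := μ) ?_ a a.2 b b.2 c c.2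
    rw [hΨ, Fintype.sum_prod_type] at h0
    simp only [Fintype.sum_prod_type, hμ, hv] at h0
    rw [← h0, ← Fin.sum_univ_eq_sum_range fun a => ∑ b ∈ range B, ∑ c ∈ range C,
      μ a b c • ((1 - X) ^ a * truncLog p ^ b * X ^ (p * c))]
    refine Finset.sum_congr rfl fun a _ => ?_
    rw [← Fin.sum_univ_eq_sum_range fun b => ∑ c ∈ range C,
      μ a b c • ((1 - X) ^ (a : ℕ) * truncLog p ^ b * X ^ (p * c))]
    refine Finset.sum_congr rfl fun b _ => ?_
    rw [← Fin.sum_univ_eq_sum_range fun c =>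
      μ a b c • ((1 - X) ^ (a : ℕ) * truncLog p ^ (b : ℕ) * X ^ (p * c))]
  have hroot : ∀ x ∈ S, ∀ n < D, (derivative^[n] Ψ).IsRoot x := by
    intro x hx n hn
    have h1 := congrArg (fun f => (f ⟨n, hn⟩ : S → ZMod p) ⟨x, hx⟩) hg
    simp only [Finset.sum_apply, Pi.smul_apply, Submodule.coe_sum, Submodule.coe_smul, w,
      evalOn_apply, eval_mul, smul_eq_mul, Pi.zero_apply, Submodule.coe_zero] at h1
    have h2 : eval x ((X * (1 - X)) ^ n) * eval x (derivative^[n] Ψ) = 0 := by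
      rw [← h1, hΨ, iterate_derivative_sum, eval_finsetSum, Finset.mul_sum]
      refine Finset.sum_congr rfl fun i _ => ?_
      rw [iterate_derivative_smul, eval_smul, smul_eq_mul]
      ring
    refine (mul_eq_zero.1 h2).resolve_left ?_
    rw [eval_pow]
    refine pow_ne_zero _ ?_
    rw [eval_mul, eval_sub, eval_X, eval_one]
    exact mul_ne_zero (hS0 x hx).1 (sub_ne_zero.2 (hS0 x hx).2.symm)
  have hmult : ∀ x ∈ S, D ≤ Ψ.roots.count x := by
    intro x hx
    rw [count_roots]
    rcases Nat.eq_zero_or_pos D with h0 | h0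
    · omega
    · have := (lt_rootMultiplicity_iff_isRoot_iterate_derivative_of_mem_nonZeroDivisors' hΨ0
        (t := x) (n := D - 1) fun m hm hm0 => mem_nonZeroDivisors_of_ne_zero
          (natCast_ne_zero_of_lt (by omega) (by omega))).2 fun m hm => hroot x hx m (by omega)
      omega
  have hdeg : Ψ.natDegree ≤ p * (B + C) := by
    refine natDegree_sum_le_of_forall_le _ _ fun i _ => (natDegree_smul_le _ _).trans ?_
    obtain ⟨a, b, c⟩ := i
    have h1 := natDegree_pow_le (p := (1 - X : (ZMod p)[X])) (n := a)
    have h2 := natDegree_pow_le (p := truncLog p) (n := b)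
    have h3 := natDegree_mul_le (p := (1 - X : (ZMod p)[X]) ^ (a : ℕ)) (q := truncLog p ^ (b : ℕ))
    have h4 := natDegree_mul_le (p := (1 - X : (ZMod p)[X]) ^ (a : ℕ) * truncLog p ^ (b : ℕ))
      (q := X ^ (p * (c : ℕ)))
    rw [natDegree_one_sub_X, mul_one] at h1
    rw [natDegree_X_pow] at h4
    have h5 : (b : ℕ) * (truncLog p).natDegree ≤ b * p :=
      Nat.mul_le_mul_left _ (natDegree_truncLog_le.trans (Nat.sub_le _ _))
    have h6 : p * (c + 1) ≤ p * C := Nat.mul_le_mul_left _ c.2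
    have h7 : (b + 1) * p ≤ B * p := Nat.mul_le_mul_right _ b.2
    have := a.2
    nlinarith
  calc S.card * D = ∑ x ∈ S, D := by rw [sum_const, smul_eq_mul]
    _ ≤ ∑ x ∈ S, Ψ.roots.count x := Finset.sum_le_sum hmult
    _ ≤ Ψ.roots.card := by
      rw [← Multiset.toFinset_sum_count_eq]
      refine (Finset.sum_le_sum_of_ne_zero fun x _ h => ?_)
      exact Multiset.mem_toFinset.2 (Multiset.count_ne_zero.1 h)
    _ ≤ Ψ.natDegree := card_roots' _
    _ ≤ _ := hdeg

end TruncatedLogarithm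

section TruncatedLogarithmCount

variable {p : ℕ} [Fact p.Prime]

theorem card_eval_truncLog_eq_le (r : ZMod p) :
    ((univ.filter fun x : ZMod p => (truncLog p).eval x = r).card : ℝ) ≤
      8 * (p : ℝ) ^ (2 / 3 : ℝ) := by
  classical
  have hp1 : (1 : ℝ) ≤ p := by exact_mod_cast (Fact.out : p.Prime).one_lt.le
  set t : ℝ := (p : ℝ) ^ (1 / 3 : ℝ) with ht
  have ht1 : 1 ≤ t := Real.one_le_rpow hp1 (by norm_num)
  have ht3 : t ^ 3 = p := by
    rw [ht, ← Real.rpow_natCast, ← Real.rpow_mul (by linarith)]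
    norm_num
  have ht2 : (p : ℝ) ^ (2 / 3 : ℝ) = t ^ 2 := by
    rw [ht, ← Real.rpow_natCast, ← Real.rpow_mul (by linarith)]
    norm_num
  rw [ht2]
  set m : ℕ := ⌊t⌋₊ with hm
  have hmt : (m : ℝ) ≤ t := Nat.floor_le (by linarith)
  have htm : t < m + 1 := Nat.lt_floor_add_one t
  set T := univ.filter fun x : ZMod p => (truncLog p).eval x = r with hT
  rcases lt_or_ge m 3 with h3 | h3
  · have h1 : T.card ≤ p := (card_le_univ _).trans_eq (ZMod.card p)
    have h2 : (T.card : ℝ) ≤ t ^ 3 := by rw [ht3]; exact_mod_cast h1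
    have h4 : (m : ℝ) ≤ 2 := by exact_mod_cast Nat.lt_succ_iff.1 h3
    nlinarith [sq_nonneg t]
  · have hm3 : m ^ 3 ≤ p := by
      have : (m : ℝ) ^ 3 ≤ p := by
        rw [← ht3]
        exact pow_le_pow_left₀ (Nat.cast_nonneg _) hmt 3
      exact_mod_cast this
    have hm2 : m ^ 2 ≤ p := (Nat.pow_le_pow_right (by omega) (by norm_num)).trans hm3
    set D := m ^ 2 / 2 with hD
    have hD2 : 2 * D ≤ m ^ 2 := by omega
    have hD3 : m ^ 2 ≤ 2 * D + 1 := by omega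
    have hcount : D * (m ^ 2 + m + D) < m ^ 2 * m * m := by
      have h5 : 2 * D * (2 * m ^ 2 + 2 * m + 2 * D) ≤
          m ^ 2 * (2 * m ^ 2 + 2 * m + m ^ 2) := by gcongr
      have h6 : 0 < m ^ 3 := by positivity
      nlinarith
    have key := card_mul_le_of_truncLog (p := p) (A := m ^ 2) (B := m) (C := m) (D := D) hm2
      (by rw [← pow_succ]; exact hm3) (by omega) hcount (S := (T.erase 0).erase 1) (r := r)
      (fun x hx => (mem_filter.1 (mem_of_mem_erase (mem_of_mem_erase hx))).2)
      (fun x hx => ⟨ne_of_mem_erase (mem_of_mem_erase hx), ne_of_mem_erase hx⟩)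
    set N := ((T.erase 0).erase 1).card with hN
    have hNT : T.card ≤ N + 2 := by
      have h7 := pred_card_le_card_erase (s := T) (a := 0)
      have h8 := pred_card_le_card_erase (s := T.erase 0) (a := 1)
      omega
    have hNT' : (T.card : ℝ) ≤ N + 2 := by exact_mod_cast hNT
    have key' : (N : ℝ) * D ≤ p * (m + m) := by exact_mod_cast key
    have hD3' : (m : ℝ) ^ 2 ≤ 2 * D + 1 := by exact_mod_cast hD3
    have h3' : (3 : ℝ) ≤ m := by exact_mod_cast h3
    have hN0 : (0 : ℝ) ≤ N := Nat.cast_nonneg _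
    have hmt2 : (0 : ℝ) ≤ 6 * (m - 1) * t ^ 2 := mul_nonneg (by linarith) (sq_nonneg t)
    have h9 : (N : ℝ) * (m - 1) * (m + 1) ≤ 6 * t ^ 2 * (m - 1) * (m + 1) := by
      calc (N : ℝ) * (m - 1) * (m + 1) = N * (m ^ 2 - 1) := by ring
        _ ≤ N * (2 * D) := by gcongr; linarith
        _ = 2 * (N * D) := by ring
        _ ≤ 2 * (p * (m + m)) := by gcongr
        _ = 4 * m * t ^ 2 * t := by rw [← ht3]; ring
        _ ≤ 6 * (m - 1) * t ^ 2 * (m + 1) :=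
          mul_le_mul (mul_le_mul_of_nonneg_right (by linarith) (sq_nonneg t)) htm.le
            (by linarith) hmt2
        _ = _ := by ring
    have h10 : (N : ℝ) ≤ 6 * t ^ 2 :=
      le_of_mul_le_mul_right (le_of_mul_le_mul_right h9 (by linarith)) (by linarith)
    nlinarith

end TruncatedLogarithmCount

section FermatQuotientLemmas

variable {p : ℕ} [Fact p.Prime]

lemma fermatQuotient_eq_zero_of_dvd {n : ℕ} (hn : p ∣ n) : fermatQuotient p n = 0 := if_pos hn

lemma exists_pow_sub_one_eq {n : ℕ} (hn : ¬p ∣ n) :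
    ∃ Q : ℕ, n ^ (p - 1) = 1 + p * Q ∧ (Q : ZMod p) = fermatQuotient p n := by
  have hp : p.Prime := Fact.out
  have h0 : (n : ZMod p) ≠ 0 := by rwa [Ne, ZMod.natCast_eq_zero_iff]
  have h1 : 1 ≤ n ^ (p - 1) :=
    Nat.one_le_pow _ _ (Nat.pos_of_ne_zero fun h => hn (h ▸ dvd_zero p))
  have h2 : p ∣ n ^ (p - 1) - 1 := by
    rw [← ZMod.natCast_eq_zero_iff, Nat.cast_sub h1]
    simp [ZMod.pow_card_sub_one_eq_one h0]
  refine ⟨(n ^ (p - 1) - 1) / p, ?_, ?_⟩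
  · rw [Nat.mul_div_cancel' h2]
    omega
  · rw [fermatQuotient, if_neg hn]

lemma fermatQuotient_eq_of_dvd {n : ℕ} {z : ℤ} (hn : ¬p ∣ n)
    (h : (p : ℤ) ^ 2 ∣ (n : ℤ) ^ (p - 1) - 1 - p * z) : fermatQuotient p n = z := by
  have hp : (p : ℤ) ≠ 0 := by exact_mod_cast (Fact.out : p.Prime).ne_zero
  obtain ⟨Q, hQ, hq⟩ := exists_pow_sub_one_eq hn
  rw [← hq]
  have h1 : (n : ℤ) ^ (p - 1) = 1 + p * Q := by exact_mod_cast hQ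
  rw [h1, show (1 + (p : ℤ) * Q - 1 - p * z) = p * (Q - z) by ring, pow_two,
    mul_dvd_mul_iff_left hp] at h
  have h2 := (ZMod.intCast_zmod_eq_zero_iff_dvd _ p).2 h
  push_cast at h2
  exact sub_eq_zero.1 h2

lemma fermatQuotient_add_mul_sq (n b : ℕ) :
    fermatQuotient p (n + p ^ 2 * b) = fermatQuotient p n := by
  have h0 : p ∣ n + p ^ 2 * b ↔ p ∣ n :=
    (Nat.dvd_add_iff_left ((dvd_pow_self p two_ne_zero).mul_right b)).symm
  by_cases hn : p ∣ n
  · rw [fermatQuotient_eq_zero_of_dvd hn, fermatQuotient_eq_zero_of_dvd (h0.2 hn)]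
  · obtain ⟨Q, hQ, hq⟩ := exists_pow_sub_one_eq hn
    rw [fermatQuotient_eq_of_dvd (z := Q) (mt h0.1 hn), ← hq]
    · simp
    · have h1 : (n : ℤ) ^ (p - 1) = 1 + p * Q := by exact_mod_cast hQ
      rw [sub_sub, ← h1]
      refine dvd_trans ?_ (sub_dvd_pow_sub_pow _ _ _)
      push_cast
      exact ⟨b, by ring⟩

lemma fermatQuotient_mod (n : ℕ) : fermatQuotient p (n % p ^ 2) = fermatQuotient p n := by
  conv_rhs => rw [← Nat.mod_add_div n (p ^ 2), fermatQuotient_add_mul_sq]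

/-- The Fermat quotient is affine along arithmetic progressions of difference `p`. -/
theorem mul_fermatQuotient_add_mul {n : ℕ} (hn : ¬p ∣ n) (b : ℕ) :
    (n : ZMod p) * fermatQuotient p (n + p * b) = n * fermatQuotient p n - b := by
  have hn' : ¬p ∣ n + p * b := fun h => hn ((Nat.dvd_add_iff_left (dvd_mul_right p b)).2 h)
  obtain ⟨Q, hQ, hq⟩ := exists_pow_sub_one_eq hn
  obtain ⟨R, hR, hr⟩ := exists_pow_sub_one_eq hn'
  have hp : p.Prime := Fact.out
  have h1 : (n : ℤ) ^ (p - 1) = 1 + p * Q := by exact_mod_cast hQ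
  have h2 : ((n : ℤ) + p * b) ^ (p - 1) = 1 + p * R := by exact_mod_cast hR
  have h3 : (p : ℤ) ^ 2 ∣ ((n : ℤ) + p * b) ^ p - (n : ℤ) ^ p := by
    have := dvd_sub_pow_of_dvd_sub (R := ℤ) (p := p) (a := n + p * b) (b := n)
      ⟨b, by ring⟩ 1
    simpa using this
  have h4 : ((n : ℤ) + p * b) ^ p = (n + p * b) * (1 + p * R) := by
    rw [← h2, ← pow_succ', Nat.sub_add_cancel hp.one_le]
  have h5 : (n : ℤ) ^ p = n * (1 + p * Q) := by
    rw [← h1, ← pow_succ', Nat.sub_add_cancel hp.one_le]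
  have hp0 : (p : ℤ) ≠ 0 := by exact_mod_cast hp.ne_zero
  rw [h4, h5, show ((n : ℤ) + p * b) * (1 + p * R) - n * (1 + p * Q) =
    p * (n * R + b - n * Q + p * (b * R)) by ring, pow_two, mul_dvd_mul_iff_left hp0] at h3
  have h6 := (ZMod.intCast_zmod_eq_zero_iff_dvd _ p).2 h3
  push_cast at h6
  rw [← hq, ← hr]
  rw [ZMod.natCast_self] at h6
  linear_combination h6

lemma choose_pred_prime_eq {i : ℕ} (hi : i < p) : ((p - 1).choose i : ZMod p) = (-1) ^ i := by
  have hp : p.Prime := Fact.out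
  induction i with
  | zero => simp
  | succ i ih =>
    have h1 : p.choose (i + 1) = (p - 1).choose i + (p - 1).choose (i + 1) := by
      conv_lhs => rw [← Nat.sub_add_cancel hp.one_le]
      exact Nat.choose_succ_succ _ _
    have h2 : ((p.choose (i + 1) : ℕ) : ZMod p) = 0 :=
      (ZMod.natCast_eq_zero_iff _ _).2 (hp.dvd_choose_self (Nat.succ_ne_zero i) hi)
    rw [h1, Nat.cast_add, ih (by omega)] at h2
    rw [pow_succ]
    linear_combination h2

lemma exists_add_one_pow_eq (s : ℕ) :
    ∃ w : ℕ, (s + 1) ^ p = s ^ p + 1 + p * w ∧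
      (w : ZMod p) = -(truncLog p).eval (-(s : ZMod p)) := by
  have hp : p.Prime := Fact.out
  have hdvd : ∀ j ∈ range (p - 1), p * (p.choose (j + 1) / p) = p.choose (j + 1) := fun j hj =>
    Nat.mul_div_cancel' (hp.dvd_choose_self (Nat.succ_ne_zero j)
      (by have := mem_range.1 hj; omega))
  refine ⟨∑ j ∈ range (p - 1), s ^ (j + 1) * (p.choose (j + 1) / p), ?_, ?_⟩
  · rw [add_pow, Finset.sum_range_succ, Finset.mul_sum]
    conv_lhs => rw [← Nat.sub_add_cancel hp.one_le]
    rw [Finset.sum_range_succ', Nat.sub_add_cancel hp.one_le]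
    simp only [one_pow, mul_one, pow_zero, Nat.choose_zero_right, Nat.choose_self, Nat.cast_one,
      Nat.cast_id]
    rw [add_comm, add_comm (∑ j ∈ range (p - 1), _), add_assoc]
    congr 2
    refine Finset.sum_congr rfl fun j hj => ?_
    rw [mul_left_comm, hdvd j hj]
  · rw [truncLog, eval_finsetSum, ← Finset.sum_neg_distrib, Nat.cast_sum]
    refine Finset.sum_congr rfl fun j hj => ?_
    have hj' : j + 1 < p := by have := mem_range.1 hj; omega
    have h0 : ((j + 1 : ℕ) : ZMod p) ≠ 0 := natCast_ne_zero_of_lt (Nat.succ_pos j) hj'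
    have h1 : (j + 1) * (p.choose (j + 1) / p) = (p - 1).choose j := by
      refine Nat.eq_of_mul_eq_mul_left hp.pos ?_
      rw [mul_left_comm, hdvd j hj]
      have := Nat.add_one_mul_choose_eq (p - 1) j
      rw [Nat.sub_add_cancel hp.one_le] at this
      rw [this, mul_comm]
    have h2 := congrArg (Nat.cast : ℕ → ZMod p) h1
    rw [Nat.cast_mul, choose_pred_prime_eq (by omega)] at h2
    simp only [eval_mul, eval_C, eval_pow, eval_X, Nat.cast_mul, Nat.cast_pow]
    push_cast at h0 h2 ⊢
    rw [← mul_right_inj' h0]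
    have h3 : ((j : ZMod p) + 1) * ((j : ZMod p) + 1)⁻¹ = 1 := mul_inv_cancel₀ h0
    rw [neg_pow]
    linear_combination (s : ZMod p) ^ (j + 1) * h2 +
      (-1) ^ (j + 1) * (s : ZMod p) ^ (j + 1) * h3

/-- Coincidences of the roots `n * q_p(n)` at a fixed distance lie on a level set of the truncated
logarithm. -/
theorem eval_truncLog_eq_of_mul_fermatQuotient_eq {n δ : ℕ} (hn : ¬p ∣ n) (hδ : ¬p ∣ δ)
    (hnδ : ¬p ∣ n + δ)
    (h : (n : ZMod p) * fermatQuotient p n = (n + δ : ℕ) * fermatQuotient p (n + δ)) :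
    (truncLog p).eval (-((n : ZMod p) / δ)) = fermatQuotient p δ := by
  have hp : p.Prime := Fact.out
  have hp0 : (p : ℤ) ≠ 0 := by exact_mod_cast hp.ne_zero
  have hδ0 : (δ : ZMod p) ≠ 0 := by rwa [Ne, ZMod.natCast_eq_zero_iff]
  have hpow : ∀ m : ℕ, ¬p ∣ m → ∃ Q : ℕ, (m : ℤ) ^ p = m + p * (m * Q) ∧
      (Q : ZMod p) = fermatQuotient p m := by
    intro m hm
    obtain ⟨Q, hQ, hq⟩ := exists_pow_sub_one_eq hm
    refine ⟨Q, ?_, hq⟩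
    have h1 : (m : ℤ) ^ (p - 1) = 1 + p * Q := by exact_mod_cast hQ
    have h2 : (m : ℤ) ^ p = m * m ^ (p - 1) := by rw [← pow_succ', Nat.sub_add_cancel hp.one_le]
    rw [h2, h1]
    ring
  obtain ⟨Q₁, hQ₁, hq₁⟩ := hpow n hn
  obtain ⟨Q₂, hQ₂, hq₂⟩ := hpow _ hnδ
  obtain ⟨Q, hQ, hq⟩ := hpow δ hδ
  set s : ℕ := ((n : ZMod p) / δ).val with hs
  have hs' : (s : ZMod p) = n / δ := ZMod.natCast_zmod_val _
  obtain ⟨w, hw, hw'⟩ := exists_add_one_pow_eq (p := p) s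
  rw [← hs', ← hq]
  suffices hsum : (Q : ZMod p) + w = 0 by
    rw [hw'] at hsum
    linear_combination -hsum
  have hlift : ∀ x y : ℤ, (x : ZMod p) = y → (p : ℤ) ^ 2 ∣ x ^ p - y ^ p := by
    intro x y hxy
    have h1 : (p : ℤ) ∣ x - y := by
      rw [← ZMod.intCast_zmod_eq_zero_iff_dvd]
      push_cast
      exact sub_eq_zero.2 hxy
    have := dvd_sub_pow_of_dvd_sub h1 1
    simpa using this
  have hδs : (δ : ZMod p) * s = n := by rw [hs']; field_simp
  have e1 := hlift (δ * s) n (by push_cast; exact hδs)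
  have e2 := hlift (δ * (s + 1)) (n + δ : ℕ) (by push_cast; linear_combination hδs)
  have e3 : (p : ℤ) ∣ n * Q₁ - (n + δ : ℕ) * Q₂ := by
    rw [← ZMod.intCast_zmod_eq_zero_iff_dvd]
    rw [← hq₁, ← hq₂] at h
    push_cast at h ⊢
    exact sub_eq_zero.2 h
  have hwz : ((s : ℤ) + 1) ^ p = s ^ p + 1 + p * w := by exact_mod_cast hw
  rw [mul_pow, hwz, hQ₂] at e2
  rw [mul_pow, hQ₁] at e1
  obtain ⟨x₁, e1⟩ := e1
  obtain ⟨x₂, e2⟩ := e2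
  obtain ⟨x₃, e3⟩ := e3
  have e4 : (p : ℤ) * (p * (x₂ - x₁ - x₃ - δ * Q * w)) = p * (δ * (Q + w)) := by
    rw [hQ] at e1 e2
    push_cast at e1 e2 e3
    linear_combination e1 - e2 + p * e3
  have e5 := (ZMod.intCast_zmod_eq_zero_iff_dvd _ p).2 ⟨_, (mul_left_cancel₀ hp0 e4).symm⟩
  push_cast at e5
  exact (mul_eq_zero.1 e5).resolve_left hδ0

/-- The number of coincidences of the roots `n * q_p(n)` at a fixed distance. -/
theorem card_mul_fermatQuotient_eq_le {e δ : ℕ} (hδ : ¬p ^ 2 ∣ δ) :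
    (((range p).filter fun a => ¬p ∣ a + e ∧ ¬p ∣ a + e + δ ∧
      ((a + e : ℕ) : ZMod p) * fermatQuotient p (a + e) =
        (a + e + δ : ℕ) * fermatQuotient p (a + e + δ)).card : ℝ) ≤ 8 * (p : ℝ) ^ (2 / 3 : ℝ) := by
  classical
  by_cases hpδ : p ∣ δ
  · obtain ⟨b, rfl⟩ := hpδ
    rw [Finset.filter_eq_empty_iff.2]
    · simp only [card_empty, Nat.cast_zero]
      positivity
    rintro a - ⟨h1, -, h3⟩
    have h4 := mul_fermatQuotient_add_mul h1 b
    have h5 : ((a + e + p * b : ℕ) : ZMod p) = (a + e : ℕ) := by push_cast; simp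
    rw [h5, h4, eq_comm, sub_eq_self, ZMod.natCast_eq_zero_iff] at h3
    exact hδ (by rw [pow_two]; exact mul_dvd_mul_left p h3)
  · have hδ0 : (δ : ZMod p) ≠ 0 := by rwa [Ne, ZMod.natCast_eq_zero_iff]
    refine le_trans ?_ (card_eval_truncLog_eq_le (fermatQuotient p δ))
    refine Nat.cast_le.2 (Finset.card_le_card_of_injOn
      (fun a => -(((a + e : ℕ) : ZMod p) / δ)) ?_ ?_)
    · intro a ha
      obtain ⟨h1, h2, h3⟩ := (mem_filter.1 ha).2
      exact mem_coe.2 (mem_filter.2 ⟨mem_univ _,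
        eval_truncLog_eq_of_mul_fermatQuotient_eq h1 hpδ h2 h3⟩)
    · intro a ha b hb hab
      have h1 := (div_left_inj' hδ0).1 (neg_injective hab)
      push_cast at h1
      exact natCast_inj_of_lt (mem_range.1 (mem_filter.1 ha).1) (mem_range.1 (mem_filter.1 hb).1)
        (add_right_cancel h1)

end FermatQuotientLemmas

section CharacterTuples

lemma mulChar_prod_apply {ι R R' : Type*} [CommMonoid R] [CommMonoidWithZero R'] {s : Finset ι}
    (hs : s.Nonempty) (χ : ι → MulChar R R') (x : R) : (∏ i ∈ s, χ i) x = ∏ i ∈ s, χ i x := by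
  classical
  induction hs using Finset.Nonempty.cons_induction with
  | singleton i => simp
  | cons i s hi hs ih => rw [prod_cons, prod_cons, MulChar.mul_apply, ih]

lemma norm_mulChar_le_one {p : ℕ} (χ : MulChar (ZMod p) ℂ) (x : ZMod p) : ‖χ x‖ ≤ 1 :=
  DirichletCharacter.norm_le_one χ x

variable {p : ℕ} [Fact p.Prime]

lemma sum_range_mul_eq {M : Type*} [AddCommMonoid M] (f : ℕ → M) (m H : ℕ) :
    ∑ n ∈ range (m * H), f n = ∑ a ∈ range m, ∑ b ∈ range H, f (a + m * b) := by
  induction H with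
  | zero => simp
  | succ H ih =>
    rw [Nat.mul_succ, Finset.sum_range_add, ih, ← Finset.sum_add_distrib]
    refine Finset.sum_congr rfl fun a _ => ?_
    rw [Finset.sum_range_succ, add_comm a]

lemma norm_sum_range_le_of_blocks {f : ℕ → ℂ} (hf : ∀ n, ‖f n‖ ≤ 1) {m : ℕ} (hm : 0 < m) (M : ℕ) :
    ‖∑ n ∈ range M, f n‖ ≤ (∑ a ∈ range m, ‖∑ b ∈ range (M / m), f (a + m * b)‖) + m := by
  conv_lhs => rw [← Nat.div_add_mod M m]
  rw [Finset.sum_range_add, sum_range_mul_eq]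
  refine (norm_add_le _ _).trans (add_le_add (norm_sum_le _ _) ?_)
  refine (norm_sum_le_of_le _ fun n _ => hf _).trans ?_
  rw [sum_const, card_range, nsmul_eq_mul, mul_one]
  exact_mod_cast (Nat.mod_lt M hm).le

/-- A tuple of shifted Fermat quotients along an arithmetic progression of difference `p`, when the
root of the first one differs from all other roots. -/
lemma norm_sum_prod_fermatQuotient_le_of_ne {k : ℕ} {n : Fin k → ℕ}
    {χ : Fin k → MulChar (ZMod p) ℂ} (i₀ : Fin k) (hχ : χ i₀ ≠ 1) (hn : ∀ i, ¬p ∣ n i)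
    (hne : ∀ i, i ≠ i₀ →
      (n i : ZMod p) * fermatQuotient p (n i) ≠ n i₀ * fermatQuotient p (n i₀))
    {H : ℕ} (hH : H ≤ p) :
    ‖∑ b ∈ range H, ∏ i, χ i (fermatQuotient p (n i + p * b))‖ ≤
      17 * k * (p : ℝ) ^ (2 / 3 : ℝ) := by
  classical
  set ρ : Fin k → ZMod p := fun i => n i * fermatQuotient p (n i) with hρ
  set U : Finset (ZMod p) := univ.image ρ with hU
  set ψ : ZMod p → MulChar (ZMod p) ℂ := fun u => ∏ i with ρ i = u, χ i with hψ
  have hn0 : ∀ i, (n i : ZMod p) ≠ 0 := fun i => by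
    rw [Ne, ZMod.natCast_eq_zero_iff]
    exact hn i
  have hstep : ∀ b : ℕ, ∏ i, χ i (fermatQuotient p (n i + p * b)) =
      (∏ i, χ i (-(n i : ZMod p)⁻¹)) * ∏ u ∈ U, ψ u (b - u) := by
    intro b
    have h1 : ∏ u ∈ U, ψ u (b - u) = ∏ i, χ i (b - ρ i) := by
      rw [← Finset.prod_fiberwise_of_maps_to (s := univ) (t := U) (g := ρ)
        fun i _ => mem_image_of_mem _ (mem_univ i)]
      refine Finset.prod_congr rfl fun u hu => ?_
      obtain ⟨j, -, hj⟩ := mem_image.1 hu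
      rw [hψ]
      dsimp only
      rw [mulChar_prod_apply ⟨j, mem_filter.2 ⟨mem_univ _, hj⟩⟩]
      refine Finset.prod_congr rfl fun i hi => ?_
      rw [(mem_filter.1 hi).2]
    rw [h1, ← Finset.prod_mul_distrib]
    refine Finset.prod_congr rfl fun i _ => ?_
    rw [← map_mul]
    congr 1
    have h2 := mul_fermatQuotient_add_mul (hn i) b
    rw [← mul_right_inj' (hn0 i), h2, hρ]
    field_simp [hn0 i]
    ring
  have hψ0 : ψ (ρ i₀) ≠ 1 := by
    have : (univ.filter fun i => ρ i = ρ i₀) = {i₀} := by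
      ext i
      simp only [mem_filter, mem_univ, true_and, mem_singleton]
      exact ⟨fun h => by_contra fun h' => hne i h' h, fun h => h ▸ rfl⟩
    rw [hψ]
    dsimp only
    rwa [this, Finset.prod_singleton]
  have key := norm_sum_range_prod_le (U := U) (χ := ψ)
    ⟨ρ i₀, mem_image_of_mem _ (mem_univ _), hψ0⟩ hH
  simp only [hstep]
  rw [← Finset.mul_sum, norm_mul]
  have hc : ‖∏ i, χ i (-(n i : ZMod p)⁻¹)‖ ≤ 1 := by
    rw [norm_prod]
    exact Finset.prod_le_one (fun _ _ => norm_nonneg _) fun _ _ => norm_mulChar_le_one _ _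
  have hUk : (U.card : ℝ) ≤ k := by
    have := card_image_le (s := (univ : Finset (Fin k))) (f := ρ)
    rw [card_univ, Fintype.card_fin] at this
    exact_mod_cast this
  calc _ ≤ 1 * (17 * U.card * (p : ℝ) ^ (2 / 3 : ℝ)) :=
        mul_le_mul hc key (norm_nonneg _) zero_le_one
    _ ≤ _ := by rw [one_mul]; gcongr

/-- Correlations of nontrivial characters of Fermat quotients. -/
theorem norm_sum_prod_fermatQuotient_le {k : ℕ} {e : Fin k → ℕ} (he : StrictMono e)
    (hep : ∀ i, e i < p ^ 2) {χ : Fin k → MulChar (ZMod p) ℂ} (hk : 0 < k)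
    (hχ : ∀ i, χ i ≠ 1) {M : ℕ} (hM : M ≤ p ^ 2) :
    ‖∑ n ∈ range M, ∏ i, χ i (fermatQuotient p (n + e i))‖ ≤
      26 * k * (p : ℝ) ^ (5 / 3 : ℝ) := by
  classical
  have hp : p.Prime := Fact.out
  have hp1 : (1 : ℝ) ≤ p := by exact_mod_cast hp.one_lt.le
  set i₀ : Fin k := ⟨0, hk⟩ with hi₀
  have hprod : ∀ n, ‖∏ i, χ i (fermatQuotient p (n + e i))‖ ≤ 1 := fun n => by
    rw [norm_prod]
    exact Finset.prod_le_one (fun _ _ => norm_nonneg _) fun _ _ => norm_mulChar_le_one _ _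
  have hH : M / p ≤ p := Nat.div_le_of_le_mul (by rwa [← pow_two])
  have hlt : ∀ i, i ≠ i₀ → e i₀ < e i := fun i hi =>
    he (Fin.lt_def.2 (Nat.pos_of_ne_zero fun h => hi (Fin.ext h)))
  set P : ℝ := (p : ℝ) ^ (2 / 3 : ℝ) with hP
  have hP1 : 1 ≤ P := Real.one_le_rpow hp1 (by norm_num)
  have hPp : (p : ℝ) ^ (5 / 3 : ℝ) = p * P := by
    rw [hP, ← Real.rpow_one_add' (by linarith) (by norm_num)]
    norm_num
  set T : Fin k → Finset ℕ := fun i => (range p).filter fun a => ¬p ∣ a + e i₀ ∧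
    ¬p ∣ a + e i₀ + (e i - e i₀) ∧ ((a + e i₀ : ℕ) : ZMod p) * fermatQuotient p (a + e i₀) =
      (a + e i₀ + (e i - e i₀) : ℕ) * fermatQuotient p (a + e i₀ + (e i - e i₀)) with hT
  set B : Finset ℕ := (univ.erase i₀).biUnion T with hB
  have hBcard : (B.card : ℝ) ≤ k * (8 * P) := by
    have h1 : B.card ≤ ∑ i ∈ univ.erase i₀, (T i).card := card_biUnion_le
    calc (B.card : ℝ) ≤ ∑ i ∈ univ.erase i₀, ((T i).card : ℝ) := by exact_mod_cast h1
      _ ≤ ∑ i ∈ univ.erase i₀, 8 * P := by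
        refine Finset.sum_le_sum fun i hi => card_mul_fermatQuotient_eq_le ?_
        have h2 := hlt i (ne_of_mem_erase hi)
        have h3 := hep i
        exact fun h => absurd (Nat.le_of_dvd (by omega) h) (by omega)
      _ ≤ k * (8 * P) := by
        rw [sum_const, nsmul_eq_mul]
        have : (univ.erase i₀).card ≤ k := (card_le_univ _).trans_eq (Fintype.card_fin k)
        gcongr
  have hblock : ∀ a ∈ range p, ‖∑ b ∈ range (M / p),
      ∏ i, χ i (fermatQuotient p (a + p * b + e i))‖ ≤
        17 * k * P + if a ∈ B then (p : ℝ) else 0 := by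
    intro a ha
    have hkP : 0 ≤ 17 * k * P := by positivity
    have hcomm : ∀ b i, a + p * b + e i = a + e i + p * b := fun b i => by ring
    simp only [hcomm]
    by_cases hd : ∃ i, p ∣ a + e i
    · obtain ⟨i, hi⟩ := hd
      rw [Finset.sum_eq_zero, norm_zero]
      · positivity
      intro b _
      refine Finset.prod_eq_zero (mem_univ i) ?_
      rw [fermatQuotient_eq_zero_of_dvd (hi.add (dvd_mul_right p b)), MulChar.map_zero]
    · push Not at hd
      by_cases hab : a ∈ B
      · rw [if_pos hab]
        have h1 : ‖∑ b ∈ range (M / p), ∏ i, χ i (fermatQuotient p (a + e i + p * b))‖ ≤ p := by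
          refine (norm_sum_le_of_le _ fun b _ => ?_).trans
            (b := ∑ b ∈ range (M / p), (1 : ℝ)) ?_
          · simpa only [hcomm] using hprod (a + p * b)
          · rw [sum_const, card_range, nsmul_eq_mul, mul_one]
            exact_mod_cast hH
        linarith
      · rw [if_neg hab, add_zero]
        refine norm_sum_prod_fermatQuotient_le_of_ne i₀ (hχ i₀) hd (fun i hi heq => hab ?_) hH
        have h2 : a + e i₀ + (e i - e i₀) = a + e i := by have := hlt i hi; omega
        refine mem_biUnion.2 ⟨i, mem_erase.2 ⟨hi, mem_univ _⟩, mem_filter.2 ⟨ha, hd i₀, ?_⟩⟩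
        rw [h2]
        exact ⟨hd i, heq.symm⟩
  have hBsub : B ⊆ range p := biUnion_subset.2 fun i _ => filter_subset _ _
  have hk1 : (1 : ℝ) ≤ k := by exact_mod_cast hk
  rw [hPp]
  calc _ ≤ (∑ a ∈ range p, ‖∑ b ∈ range (M / p),
        ∏ i, χ i (fermatQuotient p (a + p * b + e i))‖) + p :=
        norm_sum_range_le_of_blocks hprod hp.pos M
    _ ≤ (∑ a ∈ range p, (17 * k * P + if a ∈ B then (p : ℝ) else 0)) + p := by
      gcongr with a ha
      exact hblock a ha
    _ = p * (17 * k * P) + B.card * p + p := by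
      rw [Finset.sum_add_distrib, sum_const, card_range, nsmul_eq_mul, ← Finset.sum_filter,
        Finset.filter_mem_eq_inter, inter_eq_right.2 hBsub, sum_const, nsmul_eq_mul]
    _ ≤ p * (17 * k * P) + (k * (8 * P)) * p + p * (k * P) := by
      have : (p : ℝ) ≤ p * (k * P) := le_mul_of_one_le_right (by linarith) (by nlinarith)
      gcongr
    _ = _ := by ring

end CharacterTuples

section FermatQuotientSet

variable {p : ℕ} [Fact p.Prime]

/-- The nonzero `d`-th powers modulo `p`. -/
def IsUnitPow (p d : ℕ) (x : ZMod p) : Prop := ∃ y : (ZMod p)ˣ, (y : ZMod p) ^ d = x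

lemma not_isUnitPow_zero (d : ℕ) : ¬IsUnitPow p d 0 := fun ⟨y, hy⟩ => pow_ne_zero d y.ne_zero hy

lemma mem_fermatQuotientSet {d n : ℕ} :
    n ∈ fermatQuotientSet p d ↔ n < p ^ 2 ∧ IsUnitPow p d (fermatQuotient p n) := by
  classical
  have hp : p.Prime := Fact.out
  rw [fermatQuotientSet, mem_filter, mem_range]
  refine and_congr_right fun _ => ⟨?_, ?_⟩
  · rintro ⟨y, h1, h2, h3⟩
    refine ⟨Units.mk0 (y : ZMod p) (natCast_ne_zero_of_lt h1 (by have := hp.one_lt; omega)), ?_⟩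
    rw [Units.val_mk0, h3]
  · rintro ⟨y, hy⟩
    refine ⟨(y : ZMod p).val, ?_, ?_, ?_⟩
    · exact Nat.pos_of_ne_zero fun h => y.ne_zero ((ZMod.val_eq_zero _).1 h)
    · have := ZMod.val_lt (y : ZMod p)
      omega
    · rw [ZMod.natCast_zmod_val, hy]

lemma mod_mem_fermatQuotientSet {d n : ℕ} :
    n % p ^ 2 ∈ fermatQuotientSet p d ↔ IsUnitPow p d (fermatQuotient p n) := by
  rw [mem_fermatQuotientSet, fermatQuotient_mod]
  exact and_iff_right (Nat.mod_lt _ (pow_pos (Fact.out : p.Prime).pos 2))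

/-- The distribution of the Fermat quotient over a full period. -/
lemma sum_fermatQuotient {M : Type*} [AddCommMonoid M] (g : ZMod p → M) :
    ∑ n ∈ range (p ^ 2), g (fermatQuotient p n) = (p - 1) • ∑ x, g x + p • g 0 := by
  have hp : p.Prime := Fact.out
  have hsplit : ∀ F : ℕ → M,
      ∑ a ∈ range p, F a = ∑ a ∈ range (p - 1), F (a + 1) + F 0 := fun F => by
    rw [← Finset.sum_range_succ', Nat.sub_add_cancel hp.one_le]
  rw [pow_two, sum_range_mul_eq, hsplit]
  congr 1
  · rw [← card_range (p - 1), ← sum_const, card_range]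
    refine Finset.sum_congr rfl fun a ha => ?_
    have ha' : a + 1 < p := by have := mem_range.1 ha; omega
    have hn : ¬p ∣ a + 1 := Nat.not_dvd_of_pos_of_lt (Nat.succ_pos a) ha'
    have hn0 : ((a + 1 : ℕ) : ZMod p) ≠ 0 := natCast_ne_zero_of_lt (Nat.succ_pos a) ha'
    have h1 : ∀ b : ℕ, fermatQuotient p (a + 1 + p * b) =
        fermatQuotient p (a + 1) - b / (a + 1 : ℕ) := fun b => by
      rw [← mul_right_inj' hn0, mul_fermatQuotient_add_mul hn b, mul_sub, mul_div_cancel₀ _ hn0]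
    simp only [h1]
    rw [← sum_zmod_val_eq fun b : ℕ => g (fermatQuotient p (a + 1) - b / (a + 1 : ℕ))]
    simp only [ZMod.natCast_zmod_val]
    refine Fintype.sum_bijective
      (fun t : ZMod p => fermatQuotient p (a + 1) - t / (a + 1 : ℕ)) ?_ _ _ fun _ => rfl
    refine Finite.injective_iff_bijective.1 fun x y hxy => ?_
    exact (div_left_inj' hn0).1 (sub_right_injective hxy)
  · simp [fermatQuotient_eq_zero_of_dvd]

open scoped Classical in
lemma card_isUnitPow_mul {d : ℕ} (hd : d ∣ p - 1) :
    (univ.filter (IsUnitPow p d)).card * d = p - 1 := by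
  have h1 := Finset.card_eq_sum_card_fiberwise (s := (univ : Finset (ZMod p)ˣ))
    (t := univ.filter (IsUnitPow p d)) (f := fun y : (ZMod p)ˣ => (y : ZMod p) ^ d)
    fun y _ => mem_coe.2 (mem_filter.2 ⟨mem_univ _, ⟨y, rfl⟩⟩)
  rw [card_univ, ZMod.card_units] at h1
  rw [h1, ← smul_eq_mul, ← sum_const]
  refine Finset.sum_congr rfl fun x hx => ?_
  obtain ⟨b, rfl⟩ := (mem_filter.1 hx).2
  refine (card_filter_pow_eq hd b).symm.trans ?_
  congr 1
  ext y
  simp only [mem_filter, mem_univ, true_and, Units.ext_iff, Units.val_pow_eq_pow_val]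

theorem card_fermatQuotientSet_mul {d : ℕ} (hd : d ∣ p - 1) :
    (fermatQuotientSet p d).card * d = (p - 1) ^ 2 := by
  classical
  have h1 : (fermatQuotientSet p d).card =
      ∑ n ∈ range (p ^ 2), if IsUnitPow p d (fermatQuotient p n) then 1 else 0 := by
    rw [← Finset.card_filter]
    congr 1
    ext n
    rw [mem_fermatQuotientSet, mem_filter, mem_range]
  rw [h1, sum_fermatQuotient fun x => if IsUnitPow p d x then 1 else 0,
    if_neg (not_isUnitPow_zero d), smul_zero, add_zero, ← Finset.card_filter, smul_eq_mul,
    mul_assoc,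
    card_isUnitPow_mul hd, pow_two]

/-- Detection of `d`-th powers by the powers of a multiplicative character of order `d`. -/
lemma exists_mulChar_sum_pow_eq {d : ℕ} (hd : d ∣ p - 1) :
    ∃ ψ : MulChar (ZMod p) ℂ, orderOf ψ = d ∧ ∀ x, ∀ [Decidable (IsUnitPow p d x)],
      ∑ j ∈ Ico 1 d, (ψ ^ j) x =
        (if IsUnitPow p d x then (d : ℂ) else 0) - if x = 0 then 0 else 1 := by
  have hp1 : 0 < p - 1 := by have := (Fact.out : p.Prime).one_lt; omega
  have hd0 : 0 < d := Nat.pos_of_dvd_of_pos hd hp1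
  obtain ⟨ψ, hψ⟩ := MulChar.exists_mulChar_orderOf (ZMod p) (R := ℂ) (n := d)
    (by rwa [ZMod.card]) (Complex.isPrimitiveRoot_exp d hd0.ne')
  refine ⟨ψ, hψ, fun x _ => ?_⟩
  by_cases hx : x = 0
  · subst hx
    rw [if_pos rfl, if_neg (not_isUnitPow_zero d)]
    simp [MulChar.map_zero]
  rw [if_neg hx, eq_sub_iff_add_eq]
  obtain ⟨u, rfl⟩ : ∃ u : (ZMod p)ˣ, (u : ZMod p) = x := ⟨Units.mk0 x hx, rfl⟩
  have h1 : ∑ j ∈ Ico 1 d, (ψ ^ j) (u : ZMod p) + 1 = ∑ j ∈ range d, ψ u ^ j := by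
    rw [range_eq_Ico, Finset.sum_eq_sum_Ico_succ_bot hd0, pow_zero, add_comm]
    simp only [MulChar.pow_apply_coe, zero_add]
  have h2 : ψ u ^ d = 1 := by
    rw [← MulChar.pow_apply_coe, ← hψ, pow_orderOf_eq_one, MulChar.one_apply_coe]
  rw [h1]
  split_ifs with h
  · obtain ⟨y, hy⟩ := h
    have h3 : ψ u = 1 := by
      rw [← hy, map_pow, ← MulChar.pow_apply_coe, ← hψ, pow_orderOf_eq_one, MulChar.one_apply_coe]
    simp [h3]
  · have h3 : ψ u ≠ 1 := by
      intro h3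
      obtain ⟨γ, hγ⟩ := IsCyclic.exists_generator (α := (ZMod p)ˣ)
      obtain ⟨i, hi⟩ := mem_powers_iff_mem_zpowers.2 (hγ u)
      have hi' : γ ^ i = u := hi
      have h4 : ψ ^ i = 1 := by
        ext v
        obtain ⟨l, hl⟩ := mem_powers_iff_mem_zpowers.2 (hγ v)
        have hl' : γ ^ l = v := hl
        rw [MulChar.one_apply_coe, MulChar.pow_apply_coe, ← hl', Units.val_pow_eq_pow_val, map_pow,
          ← pow_mul, mul_comm, pow_mul, ← map_pow, ← Units.val_pow_eq_pow_val, hi', h3, one_pow]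
      obtain ⟨c, rfl⟩ := hψ ▸ orderOf_dvd_of_pow_eq_one h4
      refine h ⟨γ ^ c, ?_⟩
      rw [← hi', ← Units.val_pow_eq_pow_val, ← pow_mul, mul_comm]
    have h4 := mul_neg_geom_sum (ψ u) d
    rw [h2, sub_self] at h4
    exact (mul_eq_zero.1 h4).resolve_left (sub_ne_zero.2 h3.symm)

lemma abs_prod_sub_prod_le {ι : Type*} (s : Finset ι) {f g : ι → ℝ} (hf : ∀ i, |f i| ≤ 1)
    (hg : ∀ i, |g i| ≤ 1) : |∏ i ∈ s, f i - ∏ i ∈ s, g i| ≤ ∑ i ∈ s, |f i - g i| := by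
  classical
  induction s using Finset.induction_on with
  | empty => simp
  | insert i s hi ih =>
    rw [prod_insert hi, prod_insert hi, sum_insert hi]
    have h1 : |∏ j ∈ s, g j| ≤ 1 := by
      rw [Finset.abs_prod]
      exact Finset.prod_le_one (fun _ _ => abs_nonneg _) fun _ _ => hg _
    calc |f i * ∏ j ∈ s, f j - g i * ∏ j ∈ s, g j|
        = |f i * (∏ j ∈ s, f j - ∏ j ∈ s, g j) + (f i - g i) * ∏ j ∈ s, g j| := by ring_nf
      _ ≤ |f i| * |∏ j ∈ s, f j - ∏ j ∈ s, g j| + |f i - g i| * |∏ j ∈ s, g j| := by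
        rw [← abs_mul, ← abs_mul]
        exact abs_add_le _ _
      _ ≤ 1 * (∑ j ∈ s, |f j - g j|) + |f i - g i| * 1 := by
        gcongr
        exact hf i
      _ = _ := by ring

lemma sum_range_add_le_two_mul {f : ℕ → ℝ} (hf : ∀ n, 0 ≤ f n) {m : ℕ}
    (hper : ∀ n, f (n + m) = f n) {M e : ℕ} (hM : M ≤ m) (he : e ≤ m) :
    ∑ n ∈ range M, f (n + e) ≤ 2 * ∑ n ∈ range m, f n := by
  calc ∑ n ∈ range M, f (n + e) = ∑ n ∈ range M, f (e + n) := by simp only [add_comm]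
    _ ≤ ∑ n ∈ range e, f n + ∑ n ∈ range M, f (e + n) :=
      le_add_of_nonneg_left (Finset.sum_nonneg fun _ _ => hf _)
    _ = ∑ n ∈ range (e + M), f n := (Finset.sum_range_add _ _ _).symm
    _ ≤ ∑ n ∈ range (m + m), f n :=
      Finset.sum_le_sum_of_subset_of_nonneg (range_subset_range.2 (by omega)) fun _ _ _ => hf _
    _ = _ := by
      rw [Finset.sum_range_add, two_mul]
      simp only [add_comm m, hper]

end FermatQuotientSet

section Correlation

open scoped Classical in
/-- The indicator function of the nonzero `d`-th powers, balanced over the nonzero residues. -/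
noncomputable def balancedPow (p d : ℕ) (x : ZMod p) : ℝ :=
  (if IsUnitPow p d x then 1 else 0) - (d : ℝ)⁻¹ * if x = 0 then 0 else 1

lemma inv_natCast_mem_Icc {d : ℕ} (hd : 0 < d) : 0 ≤ (d : ℝ)⁻¹ ∧ (d : ℝ)⁻¹ ≤ 1 :=
  ⟨by positivity, inv_le_one_of_one_le₀ (by exact_mod_cast hd)⟩

lemma abs_balancedPow_le_one {p d : ℕ} (hd : 0 < d) (x : ZMod p) : |balancedPow p d x| ≤ 1 := by
  obtain ⟨h0, h1⟩ := inv_natCast_mem_Icc hd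
  rw [balancedPow, abs_le]
  split_ifs <;> constructor <;> linarith

lemma card_div_mem_Icc (p d : ℕ) : 0 ≤ ((fermatQuotientSet p d).card : ℝ) / (p ^ 2 : ℕ) ∧
    ((fermatQuotientSet p d).card : ℝ) / (p ^ 2 : ℕ) ≤ 1 := by
  classical
  refine ⟨by positivity, div_le_one_of_le₀ ?_ (Nat.cast_nonneg _)⟩
  exact_mod_cast (card_filter_le _ _).trans_eq (card_range _)

lemma abs_fsub_le_one (p d n : ℕ) : |fsub (p ^ 2) (fermatQuotientSet p d) n| ≤ 1 := by
  obtain ⟨h0, h1⟩ := card_div_mem_Icc p d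
  rw [fsub, abs_le]
  split_ifs <;> constructor <;> linarith

variable {p : ℕ} [Fact p.Prime]

theorem abs_sum_prod_balancedPow_le {d : ℕ} (hd : d ∣ p - 1) (hd0 : 0 < d) {k : ℕ} (hk : 0 < k)
    {e : Fin k → ℕ} (he : StrictMono e) (hep : ∀ i, e i < p ^ 2) {M : ℕ} (hM : M ≤ p ^ 2) :
    |∑ n ∈ range M, ∏ i, balancedPow p d (fermatQuotient p (n + e i))| ≤
      26 * k * (p : ℝ) ^ (5 / 3 : ℝ) := by
  classical
  obtain ⟨ψ, hψo, hψ⟩ := exists_mulChar_sum_pow_eq hd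
  have hdc : (d : ℂ) ≠ 0 := by exact_mod_cast hd0.ne'
  have hg : ∀ x, (balancedPow p d x : ℂ) = (d : ℂ)⁻¹ * ∑ j ∈ Ico 1 d, (ψ ^ j) x := by
    intro x
    rw [hψ x, balancedPow, mul_sub]
    push_cast
    congr 1
    · split_ifs <;> simp [hdc]
    · split_ifs <;> simp
  have hC : ((∑ n ∈ range M, ∏ i, balancedPow p d (fermatQuotient p (n + e i)) : ℝ) : ℂ) =
      (d : ℂ)⁻¹ ^ k * ∑ c ∈ Fintype.piFinset fun _ : Fin k => Ico 1 d,
        ∑ n ∈ range M, ∏ i, (ψ ^ c i) (fermatQuotient p (n + e i)) := by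
    push_cast
    rw [Finset.sum_comm, Finset.mul_sum]
    refine Finset.sum_congr rfl fun n _ => ?_
    rw [← Finset.prod_univ_sum (fun _ => Ico 1 d) fun i j => (ψ ^ j) (fermatQuotient p (n + e i))]
    simp only [hg]
    rw [Finset.prod_mul_distrib, prod_const, card_univ, Fintype.card_fin]
  set K : ℝ := 26 * k * (p : ℝ) ^ (5 / 3 : ℝ) with hK
  have hK0 : 0 ≤ K := by positivity
  rw [← Real.norm_eq_abs, ← Complex.norm_real, hC, norm_mul, norm_pow, norm_inv,
    Complex.norm_natCast]
  have hcard : ((Fintype.piFinset fun _ : Fin k => Ico 1 d).card : ℝ) ≤ (d : ℝ) ^ k := by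
    rw [Fintype.card_piFinset_const, Nat.card_Ico]
    exact_mod_cast Nat.pow_le_pow_left (Nat.sub_le d 1) k
  have hdr : (0 : ℝ) < d := by exact_mod_cast hd0
  have hterm : ∀ c ∈ Fintype.piFinset fun _ : Fin k => Ico 1 d,
      ‖∑ n ∈ range M, ∏ i, (ψ ^ c i) (fermatQuotient p (n + e i))‖ ≤ K := by
    intro c hc
    refine norm_sum_prod_fermatQuotient_le he hep hk (fun i => ?_) hM
    have h1 := mem_Ico.1 (Fintype.mem_piFinset.1 hc i)
    exact pow_ne_one_of_lt_orderOf (by omega) (by omega)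
  calc _ ≤ (d : ℝ)⁻¹ ^ k * ((d : ℝ) ^ k * K) := by
        gcongr
        refine (norm_sum_le_of_le _ hterm).trans ?_
        rw [sum_const, nsmul_eq_mul]
        gcongr
    _ = K := by rw [inv_pow, inv_mul_cancel_left₀ (by positivity)]

/-- The deviation of `fsub` from the balanced indicator of the nonzero `d`-th powers. -/
noncomputable def balanceError (p d : ℕ) (x : ZMod p) : ℝ :=
  (d : ℝ)⁻¹ * (if x = 0 then 0 else 1) - (fermatQuotientSet p d).card / (p ^ 2 : ℕ)

lemma fsub_eq_balancedPow_add (d n : ℕ) : fsub (p ^ 2) (fermatQuotientSet p d) n =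
    balancedPow p d (fermatQuotient p n) + balanceError p d (fermatQuotient p n) := by
  classical
  rw [fsub, balancedPow, balanceError]
  simp only [mod_mem_fermatQuotientSet]
  split_ifs <;> ring

lemma sum_abs_balanceError_le {d : ℕ} (hd : d ∣ p - 1) (hd0 : 0 < d) :
    ∑ n ∈ range (p ^ 2), |balanceError p d (fermatQuotient p n)| ≤ 4 * p := by
  have hp : p.Prime := Fact.out
  have hp1 : (1 : ℝ) ≤ p := by exact_mod_cast hp.one_lt.le
  obtain ⟨hδ0, hδ1⟩ := inv_natCast_mem_Icc hd0
  obtain ⟨hβ0, hβ1⟩ := card_div_mem_Icc p d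
  set β : ℝ := ((fermatQuotientSet p d).card : ℝ) / (p ^ 2 : ℕ) with hβ
  have hdr : (d : ℝ) ≠ 0 := by exact_mod_cast hd0.ne'
  have hβp : (p : ℝ) ^ 2 * β = (d : ℝ)⁻¹ * (p - 1) ^ 2 := by
    have h1 : ((fermatQuotientSet p d).card : ℝ) * d = (p - 1) ^ 2 := by
      have := congrArg (Nat.cast : ℕ → ℝ) (card_fermatQuotientSet_mul hd)
      rw [Nat.cast_mul, Nat.cast_pow, Nat.cast_sub hp.one_le, Nat.cast_one] at this
      exact this
    rw [hβ, ← h1]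
    push_cast
    field_simp
  set s : ℝ := (d : ℝ)⁻¹ - β with hs
  have hsp : (p : ℝ) ^ 2 * s = (d : ℝ)⁻¹ * (2 * p - 1) := by
    rw [hs, mul_sub, hβp]
    ring
  have hs0 : 0 ≤ s := by
    have h1 : 0 ≤ (p : ℝ) ^ 2 * s := by
      rw [hsp]
      exact mul_nonneg hδ0 (by linarith)
    exact nonneg_of_mul_nonneg_right h1 (by positivity)
  have hsp' : (p : ℝ) ^ 2 * s ≤ 2 * p - 1 := by
    rw [hsp]
    exact mul_le_of_le_one_left (by linarith) hδ1
  have h0 : |balanceError p d 0| = β := by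
    rw [balanceError, if_pos rfl, mul_zero, zero_sub, abs_neg, abs_of_nonneg hβ0]
  have hsum : ∑ x : ZMod p, |balanceError p d x| ≤ p * s + β := by
    calc _ ≤ ∑ x : ZMod p, (s + if x = 0 then β else 0) := by
          refine Finset.sum_le_sum fun x _ => ?_
          split_ifs with hx
          · rw [hx, h0]
            linarith
          · rw [balanceError, if_neg hx, mul_one, add_zero, abs_of_nonneg hs0]
      _ = _ := by
          rw [Finset.sum_add_distrib, sum_const, card_univ, ZMod.card, nsmul_eq_mul,
            Finset.sum_ite_eq', if_pos (mem_univ _)]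
  rw [sum_fermatQuotient fun x => |balanceError p d x|, h0, nsmul_eq_mul, nsmul_eq_mul,
    Nat.cast_sub hp.one_le, Nat.cast_one]
  have h2 : ((p : ℝ) - 1) * ∑ x : ZMod p, |balanceError p d x| ≤ (p - 1) * (p * s + β) :=
    mul_le_mul_of_nonneg_left hsum (by linarith)
  have h3 : 0 ≤ (p : ℝ) * s := by positivity
  nlinarith

theorem corrK_fermatQuotientSet_le {d : ℕ} (hd : d ∣ p - 1) {k : ℕ} (hk : 0 < k) :
    corrK (fermatQuotientSet p d) (p ^ 2) k ≤ 34 * k * (p : ℝ) ^ (5 / 3 : ℝ) := by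
  have hp : p.Prime := Fact.out
  have hp1 : (1 : ℝ) ≤ p := by exact_mod_cast hp.one_lt.le
  have hd0 : 0 < d := Nat.pos_of_dvd_of_pos hd (by have := hp.one_lt; omega)
  refine Real.sSup_le ?_ (by positivity)
  rintro _ ⟨M, e, -, hM, he, hep, rfl⟩
  have hep' : ∀ i, e i < p ^ 2 := fun i => by
    have := hep i
    have := pow_pos hp.pos 2
    omega
  have hmain := abs_sum_prod_balancedPow_le hd hd0 hk he hep' hM
  have hdiff : |∑ n ∈ range M, ∏ i, fsub (p ^ 2) (fermatQuotientSet p d) (n + e i) -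
      ∑ n ∈ range M, ∏ i, balancedPow p d (fermatQuotient p (n + e i))| ≤ 8 * k * p := by
    rw [← Finset.sum_sub_distrib]
    calc _ ≤ ∑ n ∈ range M, |∏ i, fsub (p ^ 2) (fermatQuotientSet p d) (n + e i) -
          ∏ i, balancedPow p d (fermatQuotient p (n + e i))| := Finset.abs_sum_le_sum_abs _ _
      _ ≤ ∑ n ∈ range M, ∑ i, |balanceError p d (fermatQuotient p (n + e i))| := by
        refine Finset.sum_le_sum fun n _ => ?_
        refine (abs_prod_sub_prod_le _ (fun i => abs_fsub_le_one p d _)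
          fun i => abs_balancedPow_le_one hd0 _).trans_eq ?_
        simp only [fsub_eq_balancedPow_add, add_sub_cancel_left]
      _ = ∑ i, ∑ n ∈ range M, |balanceError p d (fermatQuotient p (n + e i))| := Finset.sum_comm
      _ ≤ ∑ _i : Fin k, 2 * (4 * (p : ℝ)) := by
        refine Finset.sum_le_sum fun i _ => ?_
        refine (sum_range_add_le_two_mul (f := fun n => |balanceError p d (fermatQuotient p n)|)
          (fun _ => abs_nonneg _) (fun n => ?_) hM (hep' i).le).trans
          (mul_le_mul_of_nonneg_left (sum_abs_balanceError_le hd hd0) zero_le_two)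
        have := fermatQuotient_add_mul_sq (p := p) n 1
        rw [mul_one] at this
        rw [this]
      _ = _ := by
        rw [sum_const, card_univ, Fintype.card_fin, nsmul_eq_mul]
        ring
  have hpow : (p : ℝ) ≤ (p : ℝ) ^ (5 / 3 : ℝ) := by
    conv_lhs => rw [← Real.rpow_one (p : ℝ)]
    exact Real.rpow_le_rpow_of_exponent_le hp1 (by norm_num)
  have hlast : 8 * k * (p : ℝ) ≤ 8 * k * (p : ℝ) ^ (5 / 3 : ℝ) := by gcongr
  have htri := abs_sub_abs_le_abs_sub
    (∑ n ∈ range M, ∏ i, fsub (p ^ 2) (fermatQuotientSet p d) (n + e i))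
    (∑ n ∈ range M, ∏ i, balancedPow p d (fermatQuotient p (n + e i)))
  linarith

end Correlation

end FermatCorr

theorem statement19 :
    ∃ c > (0 : ℝ), ∀ p : ℕ, p.Prime → Odd p → ∀ d : ℕ, d ∣ p - 1 →
      (fermatQuotientSet p d).card = (p - 1) ^ 2 / d ∧
      ∀ k : ℕ, 0 < k →
        corrK (fermatQuotientSet p d) (p ^ 2) k ≤ c * k * (p : ℝ) ^ ((5 : ℝ) / 3) := by
  refine ⟨34, by norm_num, fun p hp _ d hd => ?_⟩
  have : Fact p.Prime := ⟨hp⟩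
  have hd0 : 0 < d := Nat.pos_of_dvd_of_pos hd (by have := hp.one_lt; omega)
  exact ⟨(Nat.div_eq_of_eq_mul_left hd0 (FermatCorr.card_fermatQuotientSet_mul hd).symm).symm,
    fun k hk => FermatCorr.corrK_fermatQuotientSet_le hd hk⟩
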